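/- arXiv:1710.00198 — 2 statements merged into one kernel-verified Lean document; each statement's English description precedes it below -/
import Mathlib

section
/- Fix integers n ≥ 1 and k₁, k₂ ≥ 0 and a real C > 0. Then there exist constants K > 0 and M > 0 such that for all (x, t) ∈ ℝ^{2n} × ℝ with x ≠ 0, |x|² + |t| ≥ M and ω := 4|t|/|x|² ≤ C, one has |p_{1,k₁,k₂}(x,t) − (1/|x|) e^{−d(x,t)²/4} Ψ(ω) B(ω)| ≤ K |x|^{−3} e^{−d(x,t)²/4} Ψ(ω), where Ψ(ω) = (1/(4ⁿ π^{n+1})) √(π sin(y_ω)³/(sin(y_ω) − y_ω cos(y_ω))) for ω > 0 and Ψ(0) = √(3π)/(4ⁿ π^{n+1}), and B(ω) = (−1)^{k₁+k₂} y_ω^{n+k₁+k₂} cos(y_ω)^{k₁}/sin(y_ω)^{n+k₁} for ω > 0, with B(0) = (−1)^{k₁} if k₂ = 0 and B(0) = 0 if k₂ > 0. -/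
open Real Complex MeasureTheory

/-- θ(y) = (2y − sin(2y))/(2 sin²(y)) for y ≠ 0, θ(0) = 0. -/
noncomputable def theta (y : ℝ) : ℝ :=
  if y = 0 then 0 else (2 * y - Real.sin (2 * y)) / (2 * Real.sin y ^ 2)

/-- The radial derivative p_{1,k₁,k₂} of the heat kernel at time 1 on the Heisenberg
group ℍⁿ, with R = |x|²/4 (integrand extended by continuity at λ = 0). -/
noncomputable def pH (n k₁ k₂ : ℕ) (x : EuclideanSpace ℝ (Fin (2 * n))) (t : ℝ) : ℂ :=
  (2 * (-1 : ℂ) ^ k₁ * Complex.I ^ k₂ / (4 * (π : ℂ)) ^ (n + 1)) *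
    ∫ lam : ℝ,
      if lam = 0 then (if k₂ = 0 then Complex.exp (-((‖x‖ ^ 2 / 4 : ℝ) : ℂ)) else 0)
      else
        Complex.exp (Complex.I * (lam : ℂ) * (|t| : ℝ)
            - ((‖x‖ ^ 2 / 4 * lam * Real.cosh lam / Real.sinh lam : ℝ) : ℂ)) *
          ((lam : ℂ) ^ (n + k₁ + k₂) * ((Real.cosh lam : ℝ) : ℂ) ^ k₁
            / ((Real.sinh lam : ℝ) : ℂ) ^ (n + k₁))

/-- The Carnot–Carathéodory distance from the origin: d = |x|·y_ω/sin(y_ω), = |x| if y_ω = 0. -/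
noncomputable def dCC (r yω : ℝ) : ℝ :=
  if yω = 0 then r else r * yω / Real.sin yω

/-- Ψ(ω), expressed through y_ω (ω = 0 iff y_ω = 0). -/
noncomputable def PsiH (n : ℕ) (yω : ℝ) : ℝ :=
  if yω = 0 then Real.sqrt (3 * π) / (4 ^ n * π ^ (n + 1))
  else Real.sqrt (π * Real.sin yω ^ 3 / (Real.sin yω - yω * Real.cos yω)) / (4 ^ n * π ^ (n + 1))

/-- B(ω) = (−1)^{k₁+k₂} y_ω^{n+k₁+k₂} cos(y_ω)^{k₁}/sin(y_ω)^{n+k₁},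
with B(0) = (−1)^{k₁} if k₂ = 0 and B(0) = 0 otherwise. -/
noncomputable def BH (n k₁ k₂ : ℕ) (yω : ℝ) : ℝ :=
  if yω = 0 then (if k₂ = 0 then (-1 : ℝ) ^ k₁ else 0)
  else (-1 : ℝ) ^ (k₁ + k₂) * yω ^ (n + k₁ + k₂) * Real.cos yω ^ k₁ / Real.sin yω ^ (n + k₁)


open Filter Topology

theorem mul_cos_le_sin {y : ℝ} (hy : y ∈ Set.Icc 0 π) : y * Real.cos y ≤ Real.sin y := by
  have hd : ∀ x : ℝ, HasDerivAt (fun x => Real.sin x - x * Real.cos x) (x * Real.sin x) x := by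
    intro x
    have := (Real.hasDerivAt_sin x).sub ((hasDerivAt_id' x).mul (Real.hasDerivAt_cos x))
    exact this.congr_deriv (by ring)
  have hm : MonotoneOn (fun x => Real.sin x - x * Real.cos x) (Set.Icc 0 π) := by
    refine monotoneOn_of_deriv_nonneg (convex_Icc 0 π) (by fun_prop)
      (fun x _ => (hd x).differentiableAt.differentiableWithinAt) fun x hx => ?_
    rw [interior_Icc] at hx
    rw [(hd x).deriv]
    exact mul_nonneg hx.1.le (Real.sin_nonneg_of_mem_Icc ⟨hx.1.le, hx.2.le⟩)
  have := hm (Set.left_mem_Icc.2 Real.pi_pos.le) hy hy.1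
  simp at this
  linarith

theorem sq_mul_sin_le {y : ℝ} (hy : y ∈ Set.Icc 0 π) :
    y ^ 2 * Real.sin y ≤ 3 * (Real.sin y - y * Real.cos y) := by
  have hd : ∀ x : ℝ, HasDerivAt
      (fun x => 3 * (Real.sin x - x * Real.cos x) - x ^ 2 * Real.sin x)
      (x * (Real.sin x - x * Real.cos x)) x := by
    intro x
    have := (((Real.hasDerivAt_sin x).sub
      ((hasDerivAt_id' x).mul (Real.hasDerivAt_cos x))).const_mul 3).sub
      ((hasDerivAt_pow 2 x).mul (Real.hasDerivAt_sin x))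
    exact this.congr_deriv (by push_cast; ring)
  have hm : MonotoneOn (fun x => 3 * (Real.sin x - x * Real.cos x) - x ^ 2 * Real.sin x)
      (Set.Icc 0 π) := by
    refine monotoneOn_of_deriv_nonneg (convex_Icc 0 π) (by fun_prop)
      (fun x _ => (hd x).differentiableAt.differentiableWithinAt) fun x hx => ?_
    rw [interior_Icc] at hx
    rw [(hd x).deriv]
    exact mul_nonneg hx.1.le (sub_nonneg.2 (mul_cos_le_sin ⟨hx.1.le, hx.2.le⟩))
  have := hm (Set.left_mem_Icc.2 Real.pi_pos.le) hy hy.1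
  simp at this
  linarith

theorem hasDerivAt_mul_cosh_sub_sinh (x : ℝ) :
    HasDerivAt (fun x => x * Real.cosh x - Real.sinh x) (x * Real.sinh x) x := by
  have := ((hasDerivAt_id' x).mul (Real.hasDerivAt_cosh x)).sub (Real.hasDerivAt_sinh x)
  exact this.congr_deriv (by ring)

theorem sinh_le_mul_cosh {x : ℝ} (hx : 0 ≤ x) : Real.sinh x ≤ x * Real.cosh x := by
  have hm : MonotoneOn (fun x => x * Real.cosh x - Real.sinh x) (Set.Ici 0) := by
    refine monotoneOn_of_deriv_nonneg (convex_Ici 0) (by fun_prop)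
      (fun x _ => (hasDerivAt_mul_cosh_sub_sinh x).differentiableAt.differentiableWithinAt)
      fun x hx => ?_
    rw [interior_Ici] at hx
    rw [(hasDerivAt_mul_cosh_sub_sinh x).deriv]
    exact mul_nonneg hx.le (Real.sinh_nonneg_iff.2 hx.le)
  have := hm (Set.self_mem_Ici) hx hx
  simp at this
  linarith

theorem sq_mul_sinh_le {x : ℝ} (hx : 0 ≤ x) :
    x ^ 2 * Real.sinh x ≤ 3 * (1 + x ^ 2) * (x * Real.cosh x - Real.sinh x) := by
  have hd : ∀ x : ℝ, HasDerivAt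
      (fun x => 3 * (1 + x ^ 2) * (x * Real.cosh x - Real.sinh x) - x ^ 2 * Real.sinh x)
      (6 * x * (x * Real.cosh x - Real.sinh x) + 3 * (1 + x ^ 2) * (x * Real.sinh x)
        - (2 * x * Real.sinh x + x ^ 2 * Real.cosh x)) x := by
    intro x
    have := ((((hasDerivAt_pow 2 x).const_add 1).const_mul 3).mul
      (hasDerivAt_mul_cosh_sub_sinh x)).sub ((hasDerivAt_pow 2 x).mul (Real.hasDerivAt_sinh x))
    exact this.congr_deriv (by push_cast; ring)
  have hm : MonotoneOn
      (fun x => 3 * (1 + x ^ 2) * (x * Real.cosh x - Real.sinh x) - x ^ 2 * Real.sinh x)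
      (Set.Ici 0) := by
    refine monotoneOn_of_deriv_nonneg (convex_Ici 0) (by fun_prop)
      (fun x _ => (hd x).differentiableAt.differentiableWithinAt) fun x hx => ?_
    rw [interior_Ici] at hx
    rw [(hd x).deriv]
    have hx' : 0 < x := hx
    have h1 := mul_le_mul_of_nonneg_left (sinh_le_mul_cosh hx'.le) hx'.le
    have h2 : 0 ≤ x * Real.sinh x := mul_nonneg hx'.le (Real.sinh_nonneg_iff.2 hx'.le)
    nlinarith [mul_nonneg (sq_nonneg x) h2]
  have := hm (Set.self_mem_Ici) hx hx
  simp at this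
  linarith

/-- For `0 ≤ y < π` this is the excess of `Re (z coth z)` at `z = x + iy` over its value
at `x = 0`, see `phase_re`. -/
noncomputable def phaseExcess (y x : ℝ) : ℝ :=
  Real.sinh x ^ 2 *
    (x * Real.cosh x / Real.sinh x - (if y = 0 then 1 else y * Real.cos y / Real.sin y))
    / (Real.sinh x ^ 2 + Real.sin y ^ 2)

theorem phaseExcess_neg (y x : ℝ) : phaseExcess y (-x) = phaseExcess y x := by
  simp [phaseExcess]

theorem sq_div_le_one_sub_mul_cot {y : ℝ} (hy : y ∈ Set.Ico 0 π) :
    y ^ 2 / 3 ≤ 1 - (if y = 0 then 1 else y * Real.cos y / Real.sin y) := by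
  split_ifs with h
  · simp [h]
  · have hs : 0 < Real.sin y :=
      Real.sin_pos_of_pos_of_lt_pi (lt_of_le_of_ne hy.1 (Ne.symm h)) hy.2
    have := sq_mul_sin_le ⟨hy.1, hy.2.le⟩
    rw [one_sub_div hs.ne', div_le_div_iff₀ (by norm_num) hs]
    linarith

theorem le_phaseExcess {y : ℝ} (hy : y ∈ Set.Ico 0 π) (x : ℝ) :
    x ^ 2 / (3 * (1 + x ^ 2)) ≤ phaseExcess y x := by
  wlog hx : 0 < x generalizing x
  · rcases eq_or_lt_of_le (not_lt.1 hx) with h | h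
    · simp [h, phaseExcess]
    · have := this (-x) (by linarith)
      rwa [phaseExcess_neg, neg_sq] at this
  have hs : 0 < Real.sinh x := Real.sinh_pos_iff.2 hx
  have hxs : x ≤ Real.sinh x := Real.self_le_sinh_iff.2 hx.le
  have hsy : Real.sin y ^ 2 ≤ y ^ 2 := by
    have h1 := Real.sin_le hy.1
    have h2 := Real.sin_nonneg_of_mem_Icc ⟨hy.1, hy.2.le⟩
    gcongr
  have h1 : x ^ 2 / (3 * (1 + x ^ 2)) ≤ x * Real.cosh x / Real.sinh x - 1 := by
    rw [div_sub_one hs.ne', div_le_div_iff₀ (by positivity) hs]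
    linarith [sq_mul_sinh_le hx.le]
  have h2 := sq_div_le_one_sub_mul_cot hy
  unfold phaseExcess
  rw [le_div_iff₀ (by positivity)]
  generalize (if y = 0 then (1 : ℝ) else y * Real.cos y / Real.sin y) = c at *
  generalize x * Real.cosh x / Real.sinh x = d at *
  generalize Real.sinh x = S at *
  generalize Real.sin y = σ at *
  have h3 : y ^ 2 / (3 * (1 + x ^ 2)) ≤ y ^ 2 / 3 := by
    apply div_le_div_of_nonneg_left (sq_nonneg y) (by norm_num); nlinarith
  have h4 : x ^ 2 ≤ S ^ 2 := by gcongr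
  calc x ^ 2 / (3 * (1 + x ^ 2)) * (S ^ 2 + σ ^ 2)
      = (x ^ 2 * S ^ 2 + x ^ 2 * σ ^ 2) / (3 * (1 + x ^ 2)) := by ring
    _ ≤ (x ^ 2 * S ^ 2 + S ^ 2 * y ^ 2) / (3 * (1 + x ^ 2)) := by gcongr
    _ = S ^ 2 * (x ^ 2 / (3 * (1 + x ^ 2)) + y ^ 2 / (3 * (1 + x ^ 2))) := by ring
    _ ≤ S ^ 2 * (d - c) := by gcongr; linarith

/-- Half the second derivative of `x ↦ (x + iy) coth (x + iy)` at `x = 0`. -/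
noncomputable def phaseCurvature (y : ℝ) : ℝ :=
  if y = 0 then 1 / 3 else (Real.sin y - y * Real.cos y) / Real.sin y ^ 3

theorem tendsto_sinh_div : Tendsto (fun x : ℝ => Real.sinh x / x) (𝓝[≠] 0) (𝓝 1) := by
  have := (hasDerivAt_iff_tendsto_slope.1 (Real.hasDerivAt_sinh 0))
  simp only [Real.cosh_zero] at this
  refine this.congr fun x => ?_
  simp [slope_def_field]

theorem tendsto_mul_cosh_div_sinh :
    Tendsto (fun x : ℝ => x * Real.cosh x / Real.sinh x) (𝓝[≠] 0) (𝓝 1) := by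
  have h1 : Tendsto (fun x : ℝ => Real.cosh x) (𝓝[≠] 0) (𝓝 1) :=
    ((Real.continuous_cosh.tendsto' 0 1 (by simp))).mono_left nhdsWithin_le_nhds
  have := h1.div tendsto_sinh_div one_ne_zero
  simp only [div_one] at this
  refine this.congr fun x => ?_
  simp only [Pi.div_apply]
  rw [div_div_eq_mul_div, mul_comm]

theorem tendsto_mul_cosh_sub_sinh_div :
    Tendsto (fun x : ℝ => (x * Real.cosh x - Real.sinh x) / x ^ 3) (𝓝[≠] 0) (𝓝 (1 / 3)) := by
  refine HasDerivAt.lhopital_zero_nhdsNE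
    (.of_forall hasDerivAt_mul_cosh_sub_sinh) (.of_forall fun x => hasDerivAt_pow 3 x) ?_ ?_ ?_ ?_
  · filter_upwards [self_mem_nhdsWithin] with x hx
    have : x ≠ 0 := hx
    positivity
  · exact (Continuous.tendsto' (by fun_prop) _ _ (by simp)).mono_left nhdsWithin_le_nhds
  · exact (Continuous.tendsto' (by fun_prop) _ _ (by simp)).mono_left nhdsWithin_le_nhds
  · refine (tendsto_sinh_div.div_const 3).congr' ?_
    filter_upwards [self_mem_nhdsWithin] with x hx
    have : x ≠ 0 := hx
    simp
    field_simp

theorem tendsto_phaseExcess_div_sq {y : ℝ} (hy : y ∈ Set.Ico 0 π) :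
    Tendsto (fun x => phaseExcess y x / x ^ 2) (𝓝[≠] 0) (𝓝 (phaseCurvature y)) := by
  unfold phaseExcess phaseCurvature
  split_ifs with h
  · subst h
    have := tendsto_mul_cosh_sub_sinh_div.div tendsto_sinh_div one_ne_zero
    rw [div_one] at this
    refine this.congr' ?_
    filter_upwards [self_mem_nhdsWithin] with x hx
    have h0 : x ≠ 0 := hx
    have h1 : Real.sinh x ≠ 0 := by simpa using h0
    simp
    field_simp
  · have hs : 0 < Real.sin y :=
      Real.sin_pos_of_pos_of_lt_pi (lt_of_le_of_ne hy.1 (Ne.symm h)) hy.2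
    have h1 : Tendsto (fun x : ℝ => Real.sinh x ^ 2 + Real.sin y ^ 2) (𝓝[≠] 0)
        (𝓝 (Real.sin y ^ 2)) :=
      (Continuous.tendsto' (by fun_prop) _ _ (by simp)).mono_left nhdsWithin_le_nhds
    have := ((tendsto_sinh_div.pow 2).mul
      (tendsto_mul_cosh_div_sinh.sub_const (y * Real.cos y / Real.sin y))).div h1 (by positivity)
    convert this using 2 with x
    · simp only [Pi.div_apply]; ring
    · field_simp

theorem one_third_le_phaseCurvature {y : ℝ} (hy : y ∈ Set.Ico 0 π) : 1 / 3 ≤ phaseCurvature y := by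
  have h1 : Tendsto (fun x : ℝ => 1 / (3 * (1 + x ^ 2))) (𝓝[≠] 0) (𝓝 (1 / 3)) :=
    (Continuous.tendsto' (by fun_prop (disch := intro x; positivity)) _ _ (by simp)).mono_left
      nhdsWithin_le_nhds
  refine le_of_tendsto_of_tendsto h1 (tendsto_phaseExcess_div_sq hy) ?_
  filter_upwards [self_mem_nhdsWithin] with x hx
  have h0 : x ≠ 0 := hx
  have := le_phaseExcess hy x
  rw [le_div_iff₀ (by positivity)]
  calc _ = x ^ 2 / (3 * (1 + x ^ 2)) := by ring
    _ ≤ _ := this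

theorem exists_le_of_theta_le (C : ℝ) (hC : 0 < C) :
    ∃ Y ∈ Set.Ico 0 π, ∀ y ∈ Set.Ico 0 π, theta y ≤ C → y ≤ Y := by
  have hpi := Real.pi_pos
  set Y := max (π / 2) (π - √(π / (2 * C)))
  have hYpi : Y < π := max_lt (by linarith) (by
    have : 0 < √(π / (2 * C)) := by positivity
    linarith)
  refine ⟨Y, ⟨le_max_of_le_left (by positivity), hYpi⟩, fun y hy hyC => ?_⟩
  by_contra! h
  have hy2 : π / 2 < y := (le_max_left _ _).trans_lt h
  have hy3 : π - √(π / (2 * C)) < y := (le_max_right _ _).trans_lt h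
  have hs : 0 < Real.sin y := Real.sin_pos_of_pos_of_lt_pi (by linarith) hy.2
  rw [theta, if_neg (by linarith), div_le_iff₀ (by positivity)] at hyC
  have hcos : Real.cos y ≤ 0 := Real.cos_nonpos_of_pi_div_two_le_of_le hy2.le (by linarith [hy.2])
  rw [Real.sin_two_mul] at hyC
  have h1 : Real.sin y ≤ π - y := by
    rw [← Real.sin_pi_sub]; exact Real.sin_le (by linarith [hy.2])
  have h2 : Real.sin y < √(π / (2 * C)) := by linarith
  have h3 := Real.lt_sqrt hs.le |>.1 h2
  rw [lt_div_iff₀ (by positivity)] at h3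
  nlinarith [mul_nonneg hs.le (neg_nonneg.2 hcos)]

/-- The entire function `sinh z / z`. -/
noncomputable def sinhc (z : ℂ) : ℂ := dslope Complex.sinh 0 z

theorem sinhc_zero : sinhc 0 = 1 := by
  simp [sinhc, dslope_same, (Complex.hasDerivAt_sinh 0).deriv]

theorem sinhc_of_ne_zero {z : ℂ} (hz : z ≠ 0) : sinhc z = Complex.sinh z / z := by
  simp [sinhc, dslope_of_ne _ hz, slope_def_field]

theorem differentiable_sinhc : Differentiable ℂ sinhc := by
  have := (Complex.differentiableOn_dslope (f := Complex.sinh) (c := 0) (s := Set.univ)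
    Filter.univ_mem).2 Complex.differentiable_sinh.differentiableOn
  exact differentiableOn_univ.1 this

theorem sinh_add_mul_I_re_im (x y : ℝ) : Complex.sinh (x + y * Complex.I)
    = (Real.sinh x * Real.cos y : ℝ) + (Real.cosh x * Real.sin y : ℝ) * Complex.I := by
  rw [Complex.sinh_add, Complex.cosh_mul_I, Complex.sinh_mul_I]
  push_cast
  ring

theorem cosh_add_mul_I_re_im (x y : ℝ) : Complex.cosh (x + y * Complex.I)
    = (Real.cosh x * Real.cos y : ℝ) + (Real.sinh x * Real.sin y : ℝ) * Complex.I := by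
  rw [Complex.cosh_add, Complex.cosh_mul_I, Complex.sinh_mul_I]
  push_cast
  ring

theorem normSq_sinh_add_mul_I (x y : ℝ) :
    Complex.normSq (Complex.sinh (x + y * Complex.I)) = Real.sinh x ^ 2 + Real.sin y ^ 2 := by
  rw [sinh_add_mul_I_re_im, Complex.normSq_add_mul_I]
  linear_combination Real.sinh x ^ 2 * Real.sin_sq_add_cos_sq y
    + Real.sin y ^ 2 * Real.cosh_sq x

theorem abs_sinh_le_norm_sinh (x y : ℝ) :
    |Real.sinh x| ≤ ‖Complex.sinh (x + y * Complex.I)‖ := by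
  refine abs_le_of_sq_le_sq ?_ (norm_nonneg _)
  rw [← Complex.normSq_eq_norm_sq, normSq_sinh_add_mul_I]
  nlinarith [sq_nonneg (Real.sin y)]

theorem norm_cosh_le (x y : ℝ) : ‖Complex.cosh (x + y * Complex.I)‖ ≤ Real.cosh x := by
  refine le_of_sq_le_sq ?_ (Real.cosh_pos x).le
  rw [← Complex.normSq_eq_norm_sq, cosh_add_mul_I_re_im, Complex.normSq_add_mul_I]
  nlinarith [Real.sin_sq_add_cos_sq y, Real.cosh_sq x, sq_nonneg (Real.sin y)]

theorem sinhc_ne_zero {z : ℂ} (hz : |z.im| < π) : sinhc z ≠ 0 := by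
  by_cases h : z = 0
  · simp [h, sinhc_zero]
  · rw [sinhc_of_ne_zero h]
    refine div_ne_zero (fun h0 => h ?_) h
    have h1 := normSq_sinh_add_mul_I z.re z.im
    rw [Complex.re_add_im, h0, map_zero] at h1
    have h2 : Real.sinh z.re = 0 := by
      nlinarith [sq_nonneg (Real.sinh z.re), sq_nonneg (Real.sin z.im)]
    have h3 : Real.sin z.im = 0 := by
      nlinarith [sq_nonneg (Real.sinh z.re), sq_nonneg (Real.sin z.im)]
    refine Complex.ext (Real.sinh_eq_zero.1 h2) ?_
    exact (Real.sin_eq_zero_iff_of_lt_of_lt (abs_lt.1 hz).1 (abs_lt.1 hz).2).1 h3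

/-- The function `z coth z`, holomorphic in the strip `|Im z| < π`. -/
noncomputable def mulCoth (z : ℂ) : ℂ := Complex.cosh z / sinhc z

/-- The amplitude of the oscillatory integral, holomorphic in the strip `|Im z| < π`. -/
noncomputable def amplitude (n k₁ k₂ : ℕ) (z : ℂ) : ℂ :=
  z ^ k₂ * Complex.cosh z ^ k₁ / sinhc z ^ (n + k₁)

theorem differentiableAt_mulCoth {z : ℂ} (hz : |z.im| < π) : DifferentiableAt ℂ mulCoth z :=
  (Complex.differentiable_cosh z).div (differentiable_sinhc z) (sinhc_ne_zero hz)

theorem differentiableAt_amplitude (n k₁ k₂ : ℕ) {z : ℂ} (hz : |z.im| < π) :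
    DifferentiableAt ℂ (amplitude n k₁ k₂) z :=
  ((differentiableAt_id.pow k₂).mul ((Complex.differentiable_cosh z).pow k₁)).div
    ((differentiable_sinhc z).pow _) (pow_ne_zero _ (sinhc_ne_zero hz))

theorem mulCoth_of_ne_zero {z : ℂ} (hz : z ≠ 0) :
    mulCoth z = z * Complex.cosh z / Complex.sinh z := by
  rw [mulCoth, sinhc_of_ne_zero hz, div_div_eq_mul_div, mul_comm]

theorem mulCoth_add_mul_I {x : ℝ} (hx : x ≠ 0) (y : ℝ) :
    mulCoth (x + y * Complex.I)
      = ((x * Real.sinh x * Real.cosh x + y * Real.sin y * Real.cos y)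
          / (Real.sinh x ^ 2 + Real.sin y ^ 2) : ℝ)
        + ((y * Real.sinh x * Real.cosh x - x * Real.sin y * Real.cos y)
          / (Real.sinh x ^ 2 + Real.sin y ^ 2) : ℝ) * Complex.I := by
  have hz : (x + y * Complex.I : ℂ) ≠ 0 := fun h => hx (by simpa using congrArg Complex.re h)
  have hs : Real.sinh x ≠ 0 := by simpa using hx
  have hd : Real.sinh x ^ 2 + Real.sin y ^ 2 ≠ 0 := by positivity
  have hsz : Complex.sinh (x + y * Complex.I) ≠ 0 := by
    rw [← Complex.normSq_pos, normSq_sinh_add_mul_I]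
    positivity
  rw [mulCoth_of_ne_zero hz, div_eq_iff hsz, cosh_add_mul_I_re_im, sinh_add_mul_I_re_im]
  have e1 := Real.sin_sq_add_cos_sq y
  have e2 := Real.cosh_sq x
  generalize Real.sinh x = S at *
  generalize Real.cosh x = T at *
  generalize Real.sin y = u at *
  generalize Real.cos y = v at *
  apply Complex.ext <;>
    simp only [Complex.add_re, Complex.add_im, Complex.mul_re, Complex.mul_im, Complex.ofReal_re,
      Complex.ofReal_im, Complex.I_re, Complex.I_im] <;>
    field_simp
  · linear_combination (-y * S * u) * (e1 - e2)
  · linear_combination (x * S * u) * (e1 - e2)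

theorem mulCoth_mul_I {y : ℝ} (hy : y ∈ Set.Ico 0 π) : mulCoth (y * Complex.I)
    = ((if y = 0 then 1 else y * Real.cos y / Real.sin y : ℝ) : ℂ) := by
  split_ifs with h
  · simp [h, mulCoth, sinhc_zero]
  · have hs : Real.sin y ≠ 0 :=
      (Real.sin_pos_of_pos_of_lt_pi (lt_of_le_of_ne hy.1 (Ne.symm h)) hy.2).ne'
    have hs' : Complex.sin y ≠ 0 := by exact_mod_cast hs
    have hy' : (y : ℂ) ≠ 0 := by exact_mod_cast h
    rw [mulCoth_of_ne_zero (by simp [h]), Complex.cosh_mul_I, Complex.sinh_mul_I]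
    push_cast
    field_simp

/-- The phase of the integrand on the line `Im z = y`, normalised at its critical point. -/
noncomputable def phase (y x : ℝ) : ℂ :=
  mulCoth (x + y * Complex.I) - mulCoth (y * Complex.I) - theta y * x * Complex.I

theorem phase_zero (y : ℝ) : phase y 0 = 0 := by simp [phase]

theorem phase_re {y : ℝ} (hy : y ∈ Set.Ico 0 π) (x : ℝ) : (phase y x).re = phaseExcess y x := by
  by_cases hx : x = 0
  · simp [hx, phase_zero, phaseExcess]
  have hs : Real.sinh x ≠ 0 := by simpa using hx
  have hd : Real.sinh x ^ 2 + Real.sin y ^ 2 ≠ 0 := by positivity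
  rw [phase, mulCoth_add_mul_I hx, mulCoth_mul_I hy, phaseExcess]
  simp only [Complex.sub_re, Complex.add_re, Complex.ofReal_re, Complex.mul_re, Complex.mul_im,
    Complex.ofReal_im, Complex.I_re, Complex.I_im]
  split_ifs with h
  · simp [h]
    field_simp
  · have hs : Real.sin y ≠ 0 :=
      (Real.sin_pos_of_pos_of_lt_pi (lt_of_le_of_ne hy.1 (Ne.symm h)) hy.2).ne'
    field_simp
    ring

theorem phase_im {y : ℝ} (hy : y ∈ Set.Ico 0 π) {x : ℝ} (hx : x ≠ 0) : (phase y x).im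
    = (y * Real.sinh x * Real.cosh x - x * Real.sin y * Real.cos y)
          / (Real.sinh x ^ 2 + Real.sin y ^ 2) - theta y * x := by
  rw [phase, mulCoth_add_mul_I hx, mulCoth_mul_I hy]
  simp only [Complex.sub_im, Complex.add_im, Complex.ofReal_im, Complex.mul_re, Complex.mul_im,
    Complex.ofReal_re, Complex.I_re, Complex.I_im]
  ring

theorem phase_neg {y : ℝ} (hy : y ∈ Set.Ico 0 π) (x : ℝ) :
    phase y (-x) = (starRingEnd ℂ) (phase y x) := by
  by_cases hx : x = 0
  · simp [hx, phase_zero]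
  apply Complex.ext
  · rw [Complex.conj_re, phase_re hy, phase_re hy, phaseExcess_neg]
  · rw [Complex.conj_im, phase_im hy hx, phase_im hy (neg_ne_zero.2 hx)]
    simp only [Real.sinh_neg, Real.cosh_neg]
    ring

theorem tendsto_phase_im_div {y : ℝ} (hy : y ∈ Set.Ico 0 π) :
    Tendsto (fun x => (phase y x).im / x) (𝓝[≠] 0) (𝓝 0) := by
  by_cases h : y = 0
  · refine tendsto_const_nhds.congr' ?_
    filter_upwards [self_mem_nhdsWithin] with x hx
    rw [phase_im hy hx]
    simp [h, theta]
  have hs : 0 < Real.sin y :=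
    Real.sin_pos_of_pos_of_lt_pi (lt_of_le_of_ne hy.1 (Ne.symm h)) hy.2
  have hc : ∀ f : ℝ → ℝ, Continuous f → Tendsto f (𝓝[≠] 0) (𝓝 (f 0)) := fun f hf =>
    (hf.tendsto 0).mono_left nhdsWithin_le_nhds
  have h1 := (((tendsto_sinh_div.const_mul y).mul (hc _ Real.continuous_cosh)).sub_const
    (Real.sin y * Real.cos y)).div
    (hc (fun x => Real.sinh x ^ 2 + Real.sin y ^ 2) (by fun_prop)) (by simpa using hs.ne')
  have h2 := h1.sub_const (theta y)
  have h3 : (y * 1 * Real.cosh 0 - Real.sin y * Real.cos y) /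
      (Real.sinh 0 ^ 2 + Real.sin y ^ 2) - theta y = 0 := by
    rw [theta, if_neg h, Real.sin_two_mul]
    simp
    field_simp
    ring
  rw [h3] at h2
  refine h2.congr' ?_
  filter_upwards [self_mem_nhdsWithin] with x hx
  have hx' : x ≠ 0 := hx
  have hd : Real.sinh x ^ 2 + Real.sin y ^ 2 ≠ 0 :=
    (add_pos_of_nonneg_of_pos (sq_nonneg _) (pow_pos hs 2)).ne'
  rw [phase_im hy hx]
  simp only [Pi.div_apply]
  field_simp

/-- Identification of the low order Taylor coefficients of a function with conjugation symmetry. -/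
theorem taylor_coeff_of_tendsto {F : ℝ → ℂ} {r K q : ℝ} {p₁ p₂ p₃ : ℂ} (hr : 0 < r)
    (hF : ∀ x : ℝ, |x| < r → ‖F x - (p₁ * x + p₂ * x ^ 2 + p₃ * x ^ 3)‖ ≤ K * x ^ 4)
    (hconj : ∀ x, F (-x) = (starRingEnd ℂ) (F x))
    (hre : Tendsto (fun x => (F x).re / x ^ 2) (𝓝[≠] 0) (𝓝 q))
    (him : Tendsto (fun x => (F x).im / x) (𝓝[≠] 0) (𝓝 0)) : p₁ = 0 ∧ p₂ = q := by
  have hev : ∀ᶠ x : ℝ in 𝓝[≠] 0, x ≠ 0 ∧ |x| < r := by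
    refine Filter.Eventually.and self_mem_nhdsWithin (nhdsWithin_le_nhds ?_)
    filter_upwards [Metric.ball_mem_nhds (0 : ℝ) hr] with x hx
    simpa using hx
  have hid : Tendsto (fun x : ℝ => x) (𝓝[≠] 0) (𝓝 0) :=
    tendsto_id.mono_left nhdsWithin_le_nhds
  have hcont : ∀ f : ℝ → ℝ, Continuous f → f 0 = 0 → Tendsto f (𝓝[≠] 0) (𝓝 0) :=
    fun f hf h0 => (hf.tendsto' 0 0 h0).mono_left nhdsWithin_le_nhds
  have hcontC : ∀ (f : ℝ → ℂ) (c : ℂ), Continuous f → f 0 = c → Tendsto f (𝓝[≠] 0) (𝓝 c) :=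
    fun f c hf h0 => (hf.tendsto' 0 c h0).mono_left nhdsWithin_le_nhds
  have l1 : Tendsto (fun x : ℝ => F x / x) (𝓝[≠] 0) (𝓝 p₁) := by
    have : Tendsto (fun x : ℝ => F x / x - (p₁ + p₂ * x + p₃ * x ^ 2)) (𝓝[≠] 0) (𝓝 0) := by
      refine squeeze_zero_norm' ?_ (hcont (fun x => K * |x| ^ 3) (by fun_prop) (by simp))
      filter_upwards [hev] with x hx
      have hxc : (x : ℂ) ≠ 0 := by exact_mod_cast hx.1
      have hxp : 0 < |x| := abs_pos.2 hx.1
      have e : F x / x - (p₁ + p₂ * x + p₃ * x ^ 2)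
          = (F x - (p₁ * x + p₂ * x ^ 2 + p₃ * x ^ 3)) / x := by field_simp
      rw [e, norm_div, Complex.norm_real, Real.norm_eq_abs, div_le_iff₀ hxp]
      refine (hF x hx.2).trans_eq ?_
      rw [mul_assoc, ← pow_succ, pow_abs, abs_of_nonneg (Even.pow_nonneg (by decide) x)]
    have h2 := this.add (hcontC (fun x => p₁ + p₂ * x + p₃ * x ^ 2) p₁ (by fun_prop) (by simp))
    simpa using h2
  have hp₁ : p₁ = 0 := by
    apply Complex.ext
    · refine tendsto_nhds_unique ((Complex.continuous_re.tendsto p₁).comp l1) ?_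
      have := hre.mul hid
      rw [mul_zero] at this
      refine this.congr' ?_
      filter_upwards [hev] with x hx
      have := hx.1
      simp only [Function.comp_apply, Complex.div_ofReal_re]
      field_simp
    · refine tendsto_nhds_unique ((Complex.continuous_im.tendsto p₁).comp l1) ?_
      refine him.congr fun x => ?_
      simp only [Function.comp_apply, Complex.div_ofReal_im]
  refine ⟨hp₁, ?_⟩
  subst hp₁
  have l2 : Tendsto (fun x : ℝ => F x / (x ^ 2 : ℝ)) (𝓝[≠] 0) (𝓝 p₂) := by
    have : Tendsto (fun x : ℝ => F x / (x ^ 2 : ℝ) - (p₂ + p₃ * x)) (𝓝[≠] 0) (𝓝 0) := by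
      refine squeeze_zero_norm' ?_ (hcont (fun x => K * x ^ 2) (by fun_prop) (by simp))
      filter_upwards [hev] with x hx
      have hxc : (x : ℂ) ≠ 0 := by exact_mod_cast hx.1
      have hxp : 0 < x ^ 2 := by have := hx.1; positivity
      have e : F x / (x ^ 2 : ℝ) - (p₂ + p₃ * x)
          = (F x - (0 * x + p₂ * x ^ 2 + p₃ * x ^ 3)) / (x ^ 2 : ℝ) := by
        push_cast; field_simp; ring
      rw [e, norm_div, Complex.norm_real, Real.norm_of_nonneg hxp.le, div_le_iff₀ hxp]
      exact (hF x hx.2).trans_eq (by ring)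
    have h2 := this.add (hcontC (fun x => p₂ + p₃ * x) p₂ (by fun_prop) (by simp))
    simpa using h2
  have l2i := (Complex.continuous_im.tendsto p₂).comp l2
  apply Complex.ext
  · refine tendsto_nhds_unique ((Complex.continuous_re.tendsto p₂).comp l2) ?_
    refine hre.congr fun x => ?_
    simp only [Function.comp_apply, Complex.div_ofReal_re]
  · have hneg : Tendsto (fun x : ℝ => -x) (𝓝[≠] 0) (𝓝[≠] 0) := by
      refine tendsto_nhdsWithin_iff.2 ⟨?_, ?_⟩
      · simpa using hid.neg
      · filter_upwards [self_mem_nhdsWithin] with x hx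
        simpa using hx
    have l3 := l2i.comp hneg
    have l4 := l2i.neg
    have : p₂.im = -p₂.im := tendsto_nhds_unique l3 (l4.congr fun x => by
      simp only [Function.comp_apply, Complex.div_ofReal_im, hconj, Complex.conj_im, neg_sq]
      ring)
    rw [Complex.ofReal_im]
    linarith

/-- Taylor expansion of order `k` with coefficients and remainder controlled by the supremum of the
function on a disc only. -/
theorem exists_taylor_of_bounded (r : ℝ) (hr : 0 < r) (k : ℕ) :
    ∀ (M : ℝ) (f : ℂ → ℂ) (c : ℂ), DifferentiableOn ℂ f (Metric.ball c r) →
      (∀ z ∈ Metric.ball c r, ‖f z‖ ≤ M) →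
      ∃ p : ℕ → ℂ, (∀ j, ‖p j‖ ≤ M * (2 / r) ^ j) ∧ ∀ z ∈ Metric.ball c r,
        ‖f z - ∑ j ∈ Finset.range k, p j * (z - c) ^ j‖ ≤ M * (2 / r) ^ k * ‖z - c‖ ^ k := by
  induction k with
  | zero =>
    intro M f c _ hM
    have : 0 ≤ M := (norm_nonneg _).trans (hM c (Metric.mem_ball_self hr))
    refine ⟨fun _ => 0, fun j => ?_, fun z hz => ?_⟩
    · simp only [norm_zero]; positivity
    · simpa using hM z hz
  | succ k ih =>
    intro M f c hf hM
    have hc := hM c (Metric.mem_ball_self hr)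
    have hM0 : 0 ≤ M := (norm_nonneg _).trans hc
    have hmaps : Set.MapsTo f (Metric.ball c r) (Metric.closedBall (f c) (2 * M)) := by
      intro z hz
      rw [mem_closedBall_iff_norm]
      linarith [norm_sub_le (f z) (f c), hM z hz]
    obtain ⟨p, hp, hpz⟩ := ih (M * (2 / r)) (dslope f c) c
      ((Complex.differentiableOn_dslope (Metric.ball_mem_nhds c hr)).2 hf)
      (fun z hz => (Complex.norm_dslope_le_div_of_mapsTo_ball hf hmaps hz).trans_eq (by ring))
    refine ⟨fun j => Nat.casesOn j (f c) p, fun j => ?_, fun z hz => ?_⟩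
    · cases j with
      | zero => simpa using hc
      | succ j => exact (hp j).trans_eq (by ring)
    · have h1 : f z = f c + (z - c) * dslope f c z := by
        have := sub_smul_dslope f c z
        rw [smul_eq_mul] at this
        rw [this]; ring
      rw [Finset.sum_range_succ', h1]
      have : f c + (z - c) * dslope f c z
          - (∑ j ∈ Finset.range k, p j * (z - c) ^ (j + 1) + f c * (z - c) ^ 0)
          = (z - c) * (dslope f c z - ∑ j ∈ Finset.range k, p j * (z - c) ^ j) := by
        rw [mul_sub, Finset.mul_sum]
        simp only [pow_succ]
        have : ∀ j, p j * ((z - c) ^ j * (z - c)) = (z - c) * (p j * (z - c) ^ j) := by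
          intro j; ring
        simp only [this]
        ring
      change ‖f c + (z - c) * dslope f c z
          - (∑ j ∈ Finset.range k, p j * (z - c) ^ (j + 1) + f c * (z - c) ^ 0)‖ ≤ _
      rw [this, norm_mul]
      calc _ ≤ ‖z - c‖ * (M * (2 / r) * (2 / r) ^ k * ‖z - c‖ ^ k) := by
            gcongr; exact hpz z hz
        _ = _ := by ring

/-- Shift of the line of integration from `ℝ` to `ℝ + iy`. -/
theorem integral_eq_integral_add_mul_I {f : ℂ → ℂ} {y M : ℝ} (hy : 0 ≤ y)
    (hf : ∀ z : ℂ, z.im ∈ Set.Icc 0 y → DifferentiableAt ℂ f z)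
    (hM : ∀ x : ℝ, ∀ s ∈ Set.Icc 0 y, ‖f (x + s * Complex.I)‖ ≤ M * (1 + x ^ 2)⁻¹) :
    ∫ x : ℝ, f x = ∫ x : ℝ, f (x + y * Complex.I) := by
  have hcont : ∀ s ∈ Set.Icc 0 y, Continuous fun x : ℝ => f (x + s * Complex.I) := by
    intro s hs
    refine continuous_iff_continuousAt.2 fun x => ?_
    exact ContinuousAt.comp (f := fun x : ℝ => (x : ℂ) + s * Complex.I)
      (hf _ (by simpa using hs)).continuousAt (by fun_prop)
  have hint : ∀ s ∈ Set.Icc 0 y, Integrable fun x : ℝ => f (x + s * Complex.I) := by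
    intro s hs
    exact (integrable_inv_one_add_sq.const_mul M).mono'
      (hcont s hs).aestronglyMeasurable (.of_forall fun x => hM x s hs)
  have h0 : (0 : ℝ) ∈ Set.Icc 0 y := ⟨le_rfl, hy⟩
  have hy' : y ∈ Set.Icc 0 y := ⟨hy, le_rfl⟩
  have lim : ∀ s ∈ Set.Icc 0 y, Tendsto (fun T : ℝ => ∫ x in (-T)..T, f (x + s * Complex.I)) atTop
      (𝓝 (∫ x : ℝ, f (x + s * Complex.I))) := fun s hs =>
    intervalIntegral_tendsto_integral (hint s hs) tendsto_neg_atTop_atBot tendsto_id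
  have hz : Tendsto (fun T : ℝ => M * (1 + T ^ 2)⁻¹ * |y - 0|) atTop (𝓝 0) := by
    have : Tendsto (fun T : ℝ => (1 + T ^ 2)⁻¹) atTop (𝓝 0) :=
      tendsto_inv_atTop_zero.comp (tendsto_atTop_add_const_left _ _ (tendsto_pow_atTop two_ne_zero))
    simpa using (this.const_mul M).mul_const (|y - 0|)
  have side : ∀ e : ℝ, e ^ 2 = 1 → Tendsto
      (fun T : ℝ => ∫ s in (0 : ℝ)..y, f (((e * T : ℝ) : ℂ) + s * Complex.I)) atTop (𝓝 0) := by
    intro e he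
    refine squeeze_zero_norm (fun T => ?_) hz
    refine intervalIntegral.norm_integral_le_of_norm_le_const fun s hs => ?_
    rw [Set.uIoc_of_le hy] at hs
    have := hM (e * T) s ⟨hs.1.le, hs.2⟩
    rwa [mul_pow, he, one_mul] at this
  have key := fun T : ℝ => Complex.integral_boundary_rect_eq_zero_of_differentiableOn f
    ((-T : ℝ) : ℂ) (T + y * Complex.I) (fun z hz => (hf z (by
      have := hz.2
      simpa [Set.uIcc_of_le hy] using this)).differentiableWithinAt)
  have l1 := (((lim 0 h0).sub (lim y hy')).add ((side 1 (by norm_num)).const_smul Complex.I)).sub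
    ((side (-1) (by norm_num)).const_smul Complex.I)
  have l2 := tendsto_nhds_unique (l1.congr fun T => by
    have := key T
    simpa using this) tendsto_const_nhds
  simp only [smul_zero, add_zero, sub_zero, Complex.ofReal_zero, zero_mul] at l2
  exact sub_eq_zero.1 l2

theorem norm_exp_neg_sub_one_add_le (w : ℂ) :
    ‖Complex.exp (-w) - 1 + w‖ ≤ 3 * ‖w‖ ^ 2 * max 1 (Real.exp (-w.re)) := by
  have h1 : (1 : ℝ) ≤ max 1 (Real.exp (-w.re)) := le_max_left _ _
  have h2 : Real.exp (-w.re) ≤ max 1 (Real.exp (-w.re)) := le_max_right _ _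
  rcases le_or_gt ‖w‖ 1 with h | h
  · have := Complex.norm_exp_sub_one_sub_id_le (x := -w) (by rwa [norm_neg])
    rw [norm_neg, sub_neg_eq_add] at this
    nlinarith [sq_nonneg ‖w‖]
  · have h3 : ‖Complex.exp (-w) - 1 + w‖ ≤ Real.exp (-w.re) + 1 + ‖w‖ := by
      refine (norm_add_le _ _).trans ?_
      gcongr
      refine (norm_sub_le _ _).trans ?_
      simp [Complex.norm_exp]
    have h4 : ‖w‖ ≤ ‖w‖ ^ 2 := by nlinarith
    have h5 : 1 ≤ ‖w‖ ^ 2 := by nlinarith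
    have h6 := mul_le_mul h5 h1 zero_le_one (by positivity)
    nlinarith [mul_le_mul_of_nonneg_left h1 (sq_nonneg ‖w‖),
      mul_le_mul_of_nonneg_right h5 (zero_le_one.trans h1)]

/-- Error of the second order expansion of a Laplace integrand near its critical point. -/
theorem norm_laplace_integrand_sub_le {K R x q : ℝ} {G a p₃ a₀ a₁ : ℂ} (hR : 0 ≤ R) (hx : |x| ≤ 1)
    (hq : 1 / 3 ≤ q) (hp₃ : ‖p₃‖ ≤ K) (ha₁ : ‖a₁‖ ≤ K) (ha : ‖a‖ ≤ K)
    (hG : ‖G - (q * x ^ 2 + p₃ * x ^ 3)‖ ≤ K * x ^ 4) (haa : ‖a - (a₀ + a₁ * x)‖ ≤ K * x ^ 2)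
    (hre : x ^ 2 / 6 ≤ G.re) :
    ‖Complex.exp (-(R * G)) * a
        - Complex.exp (-(R * q * x ^ 2)) * (a₀ + a₁ * x - R * a₀ * p₃ * x ^ 3)‖
      ≤ (K + 3 * K ^ 2 + 12 * K ^ 3) *
        (Real.exp (-(R * x ^ 2 / 6)) * (x ^ 2 + R * x ^ 4 + R ^ 2 * x ^ 6)) := by
  have hK : 0 ≤ K := (norm_nonneg _).trans hp₃
  set w : ℂ := R * (G - q * x ^ 2) with hw
  set E : ℂ := Complex.exp (-(R * q * x ^ 2)) with hE
  set e : ℝ := Real.exp (-(R * x ^ 2 / 6)) with he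
  have hRx : 0 ≤ R * x ^ 2 := by positivity
  have hEn : ‖E‖ = Real.exp (-(R * q * x ^ 2)) := by
    rw [hE, Complex.norm_exp]
    norm_cast
  have hEe : ‖E‖ ≤ e := by
    rw [hEn, he, Real.exp_le_exp]
    nlinarith
  have hEw : ‖E‖ * max 1 (Real.exp (-w.re)) ≤ e := by
    rw [mul_max_of_nonneg _ _ (norm_nonneg _), mul_one]
    refine max_le hEe ?_
    rw [hEn, he, ← Real.exp_add, Real.exp_le_exp]
    have : w.re = R * (G.re - q * x ^ 2) := by
      rw [hw, Complex.re_ofReal_mul, Complex.sub_re]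
      norm_cast
    rw [this]
    nlinarith
  have hax : ‖(x : ℂ)‖ = |x| := by simp
  have hx0 := abs_nonneg x
  have e2 : |x| ^ 2 = x ^ 2 := sq_abs x
  have e4 : |x| ^ 4 = x ^ 4 := by rw [pow_abs, abs_of_nonneg (by positivity)]
  have e6 : |x| ^ 6 = x ^ 6 := by rw [pow_abs, abs_of_nonneg (by positivity)]
  have hw3 : ‖w - R * p₃ * x ^ 3‖ ≤ R * (K * x ^ 4) := by
    have : w - R * p₃ * x ^ 3 = R * (G - (q * x ^ 2 + p₃ * x ^ 3)) := by rw [hw]; ring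
    rw [this, norm_mul, Complex.norm_real, Real.norm_of_nonneg hR]
    gcongr
  have hRp : ‖R * p₃ * (x : ℂ) ^ 3‖ ≤ R * K * |x| ^ 3 := by
    rw [norm_mul, norm_mul, norm_pow, hax, Complex.norm_real, Real.norm_of_nonneg hR]
    gcongr
  have hwn : ‖w‖ ≤ 2 * R * K * |x| ^ 3 := by
    have h1 := norm_add_le (w - R * p₃ * x ^ 3) (R * p₃ * x ^ 3)
    rw [sub_add_cancel] at h1
    have h3 : x ^ 4 ≤ |x| ^ 3 := by
      rw [← e4]
      exact pow_le_pow_of_le_one hx0 hx (by norm_num)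
    have h2 : R * (K * x ^ 4) ≤ R * (K * |x| ^ 3) := by gcongr
    linarith
  have ha0 : ‖a - a₀‖ ≤ 2 * K * |x| := by
    have h1 := norm_add_le (a - (a₀ + a₁ * x)) (a₁ * x)
    have h2 : ‖a₁ * x‖ ≤ K * |x| := by rw [norm_mul, hax]; gcongr
    have h3 : K * x ^ 2 ≤ K * |x| := by
      rw [← e2]
      gcongr
      exact pow_le_of_le_one hx0 hx (by norm_num)
    have h4 : a - (a₀ + a₁ * x) + a₁ * x = a - a₀ := by ring
    rw [h4] at h1
    linarith
  have hsplit : Complex.exp (-(R * G)) * a - E * (a₀ + a₁ * x - R * a₀ * p₃ * x ^ 3)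
      = E * (Complex.exp (-w) - 1 + w) * a + E * ((a - (a₀ + a₁ * x)) - (w - R * p₃ * x ^ 3) * a
        - R * p₃ * x ^ 3 * (a - a₀)) := by
    have : Complex.exp (-(R * G)) = E * Complex.exp (-w) := by
      rw [hE, hw, ← Complex.exp_add]
      congr 1
      ring
    rw [this]
    ring
  rw [hsplit]
  have b1 : ‖E * (Complex.exp (-w) - 1 + w) * a‖ ≤ e * (12 * K ^ 3 * (R ^ 2 * x ^ 6)) := by
    rw [norm_mul, norm_mul]
    calc ‖E‖ * ‖Complex.exp (-w) - 1 + w‖ * ‖a‖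
        ≤ ‖E‖ * (3 * ‖w‖ ^ 2 * max 1 (Real.exp (-w.re))) * K := by
          gcongr; exact norm_exp_neg_sub_one_add_le w
      _ = (‖E‖ * max 1 (Real.exp (-w.re))) * (3 * ‖w‖ ^ 2 * K) := by ring
      _ ≤ e * (3 * (2 * R * K * |x| ^ 3) ^ 2 * K) := by gcongr
      _ = e * (12 * K ^ 3 * (R ^ 2 * |x| ^ 6)) := by ring
      _ = _ := by rw [e6]
  have b2 : ‖E * ((a - (a₀ + a₁ * x)) - (w - R * p₃ * x ^ 3) * a - R * p₃ * x ^ 3 * (a - a₀))‖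
      ≤ e * (K * x ^ 2 + 3 * K ^ 2 * (R * x ^ 4)) := by
    rw [norm_mul]
    refine mul_le_mul hEe ?_ (norm_nonneg _) (Real.exp_pos _).le
    refine (norm_sub_le _ _).trans ((add_le_add_left (norm_sub_le _ _) _).trans ?_)
    rw [norm_mul, norm_mul]
    calc _ ≤ K * x ^ 2 + R * (K * x ^ 4) * K + R * K * |x| ^ 3 * (2 * K * |x|) := by gcongr
      _ = K * x ^ 2 + R * (K * x ^ 4) * K + R * K * (2 * K * |x| ^ 4) := by ring
      _ = _ := by rw [e4]; ring
  refine (norm_add_le _ _).trans ((add_le_add b1 b2).trans ?_)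
  have : 0 ≤ e := (Real.exp_pos _).le
  have p2 : 0 ≤ x ^ 2 := by positivity
  have p4 : 0 ≤ R * x ^ 4 := by positivity
  have p6 : 0 ≤ R ^ 2 * x ^ 6 := by positivity
  calc _ = e * (K * x ^ 2 + 3 * K ^ 2 * (R * x ^ 4) + 12 * K ^ 3 * (R ^ 2 * x ^ 6)) := by ring
    _ ≤ e * ((K + 3 * K ^ 2 + 12 * K ^ 3) * x ^ 2 + (K + 3 * K ^ 2 + 12 * K ^ 3) * (R * x ^ 4)
        + (K + 3 * K ^ 2 + 12 * K ^ 3) * (R ^ 2 * x ^ 6)) := by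
      gcongr <;> nlinarith [pow_nonneg hK 2, pow_nonneg hK 3]
    _ = _ := by ring

/-- Crude bound for the Laplace integrand and its model away from the critical point. -/
theorem norm_laplace_integrand_sub_le_of_le {K R r x q : ℝ} {G a p₃ a₀ a₁ : ℂ} (hR : 0 ≤ R)
    (hr : 0 < r) (hx : r ≤ |x|) (hq : 1 / 3 ≤ q) (hp₃ : ‖p₃‖ ≤ K) (ha₀ : ‖a₀‖ ≤ K)
    (ha₁ : ‖a₁‖ ≤ K) (ha : ‖a‖ ≤ K * (1 + x ^ 2)⁻¹) (hre : r ^ 2 / 6 ≤ G.re) :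
    ‖Complex.exp (-(R * G)) * a
        - Complex.exp (-(R * q * x ^ 2)) * (a₀ + a₁ * x - R * a₀ * p₃ * x ^ 3)‖
      ≤ (K / r ^ 2 + K / r + K ^ 2 / r) *
        (Real.exp (-(R * x ^ 2 / 6)) * (x ^ 2 + R * x ^ 4 + R ^ 2 * x ^ 6))
        + K * Real.exp (-(R * r ^ 2 / 6)) * (1 + x ^ 2)⁻¹ := by
  have hK : 0 ≤ K := (norm_nonneg _).trans hp₃
  have hx0 := abs_nonneg x
  have hax : ‖(x : ℂ)‖ = |x| := by simp
  have e2 : |x| ^ 2 = x ^ 2 := sq_abs x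
  have e4 : |x| ^ 4 = x ^ 4 := by rw [pow_abs, abs_of_nonneg (by positivity)]
  refine (norm_sub_le _ _).trans ?_
  rw [norm_mul, norm_mul, add_comm]
  have h1 : ‖Complex.exp (-(R * G))‖ ≤ Real.exp (-(R * r ^ 2 / 6)) := by
    rw [Complex.norm_exp, Complex.neg_re, Complex.re_ofReal_mul, Real.exp_le_exp]
    nlinarith
  have h2 : ‖Complex.exp (-(R * q * x ^ 2))‖ ≤ Real.exp (-(R * x ^ 2 / 6)) := by
    rw [Complex.norm_exp]
    norm_cast
    rw [Real.exp_le_exp]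
    nlinarith [mul_nonneg hR (sq_nonneg x)]
  have h3 : ‖a₀ + a₁ * x - R * a₀ * p₃ * x ^ 3‖ ≤ K + K * |x| + R * K * K * |x| ^ 3 := by
    refine (norm_sub_le _ _).trans (add_le_add ((norm_add_le _ _).trans ?_) ?_)
    · rw [norm_mul, hax]; gcongr
    · rw [norm_mul, norm_mul, norm_mul, norm_pow, hax, Complex.norm_real, Real.norm_of_nonneg hR]
      gcongr
  have hxr : 1 ≤ |x| / r := (one_le_div hr).2 hx
  have h4 : K + K * |x| + R * K * K * |x| ^ 3
      ≤ (K / r ^ 2 + K / r + K ^ 2 / r) * (x ^ 2 + R * x ^ 4 + R ^ 2 * x ^ 6) := by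
    have q1 : K ≤ K / r ^ 2 * x ^ 2 := by
      have : K * 1 ≤ K * (|x| / r) ^ 2 := by gcongr; exact one_le_pow₀ hxr
      calc K ≤ K * (|x| / r) ^ 2 := by linarith
        _ = K / r ^ 2 * |x| ^ 2 := by ring
        _ = _ := by rw [e2]
    have q2 : K * |x| ≤ K / r * x ^ 2 := by
      calc K * |x| = K * |x| * 1 := by ring
        _ ≤ K * |x| * (|x| / r) := by gcongr
        _ = K / r * |x| ^ 2 := by ring
        _ = _ := by rw [e2]
    have q3 : R * K * K * |x| ^ 3 ≤ K ^ 2 / r * (R * x ^ 4) := by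
      calc R * K * K * |x| ^ 3 = R * K * K * |x| ^ 3 * 1 := by ring
        _ ≤ R * K * K * |x| ^ 3 * (|x| / r) := by gcongr
        _ = K ^ 2 / r * (R * |x| ^ 4) := by ring
        _ = _ := by rw [e4]
    have n1 : 0 ≤ K / r ^ 2 := by positivity
    have n2 : 0 ≤ K / r := by positivity
    have n3 : 0 ≤ K ^ 2 / r := by positivity
    have p2 : 0 ≤ x ^ 2 := by positivity
    have p4 : 0 ≤ R * x ^ 4 := by positivity
    have p6 : 0 ≤ R ^ 2 * x ^ 6 := by positivity
    nlinarith [mul_nonneg n1 p4, mul_nonneg n1 p6, mul_nonneg n2 p4, mul_nonneg n2 p6,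
      mul_nonneg n3 p2, mul_nonneg n3 p6]
  refine add_le_add ?_ ?_
  · calc _ ≤ Real.exp (-(R * x ^ 2 / 6)) * (K + K * |x| + R * K * K * |x| ^ 3) := by gcongr
      _ ≤ Real.exp (-(R * x ^ 2 / 6)) *
          ((K / r ^ 2 + K / r + K ^ 2 / r) * (x ^ 2 + R * x ^ 4 + R ^ 2 * x ^ 6)) := by gcongr
      _ = _ := by ring
  · calc _ ≤ Real.exp (-(R * r ^ 2 / 6)) * (K * (1 + x ^ 2)⁻¹) := by gcongr
      _ = _ := by ring

theorem integrable_pow_mul_exp_neg_mul_sq {b : ℝ} (hb : 0 < b) (k : ℕ) :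
    Integrable fun x : ℝ => x ^ k * Real.exp (-(b * x ^ 2)) := by
  have := integrable_rpow_mul_exp_neg_mul_sq hb (s := k) (by linarith [k.cast_nonneg (α := ℝ)])
  simpa [Real.rpow_natCast] using this

theorem integral_gaussian_mul_cubic {b : ℝ} (hb : 0 < b) (a₀ a₁ a₃ : ℂ) :
    Integrable (fun x : ℝ => Complex.exp (-(b * x ^ 2)) * (a₀ + a₁ * x - a₃ * x ^ 3)) ∧
    ∫ x : ℝ, Complex.exp (-(b * x ^ 2)) * (a₀ + a₁ * x - a₃ * x ^ 3) = a₀ * √(π / b) := by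
  have hk : ∀ k : ℕ, Integrable fun x : ℝ => (x : ℂ) ^ k * Complex.exp (-(b * x ^ 2)) := by
    intro k
    have := (integrable_pow_mul_exp_neg_mul_sq hb k).ofReal (𝕜 := ℂ)
    refine this.congr (.of_forall fun x => ?_)
    change ((x ^ k * Real.exp (-(b * x ^ 2)) : ℝ) : ℂ) = _
    push_cast
    rfl
  have hodd : ∀ k : ℕ, Odd k → ∫ x : ℝ, (x : ℂ) ^ k * Complex.exp (-(b * x ^ 2)) = 0 := by
    intro k hk
    have := integral_neg_eq_self (fun x : ℝ => (x : ℂ) ^ k * Complex.exp (-(b * x ^ 2))) volume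
    simp only [Complex.ofReal_neg, hk.neg_pow, even_two.neg_pow, neg_mul, integral_neg] at this
    exact self_eq_neg.1 this.symm
  have hsplit : (fun x : ℝ => Complex.exp (-(b * x ^ 2)) * (a₀ + a₁ * x - a₃ * x ^ 3))
      = fun x : ℝ => a₀ * ((x : ℂ) ^ 0 * Complex.exp (-(b * x ^ 2)))
        + a₁ * ((x : ℂ) ^ 1 * Complex.exp (-(b * x ^ 2)))
        - a₃ * ((x : ℂ) ^ 3 * Complex.exp (-(b * x ^ 2))) := by
    funext x; ring
  have i0 := (hk 0).const_mul a₀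
  have i1 := (hk 1).const_mul a₁
  have i3 := (hk 3).const_mul a₃
  have i01 : Integrable fun x : ℝ => a₀ * ((x : ℂ) ^ 0 * Complex.exp (-(b * x ^ 2)))
      + a₁ * ((x : ℂ) ^ 1 * Complex.exp (-(b * x ^ 2))) := i0.add i1
  rw [hsplit]
  refine ⟨i01.sub i3, ?_⟩
  rw [integral_sub i01 i3, integral_add i0 i1]
  simp only [integral_const_mul]
  rw [hodd 1 (by decide), hodd 3 (by decide)]
  simp only [pow_zero, one_mul, mul_zero, add_zero, sub_zero]
  congr 1
  rw [← integral_gaussian, ← integral_complex_ofReal]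
  push_cast
  simp

/-- Laplace's method with a second order error term, uniform in the phase and the amplitude. -/
theorem exists_laplace_bound (K r : ℝ) (hr : 0 < r) (hr1 : r ≤ 1) :
    ∃ K' : ℝ, ∀ (s : ℝ), 0 < s → ∀ (G a : ℝ → ℂ) (q : ℝ) (p₃ a₀ a₁ : ℂ),
      Continuous G → Continuous a → 1 / 3 ≤ q → ‖p₃‖ ≤ K → ‖a₀‖ ≤ K → ‖a₁‖ ≤ K →
      (∀ x : ℝ, |x| < r → ‖G x - (q * x ^ 2 + p₃ * x ^ 3)‖ ≤ K * x ^ 4) →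
      (∀ x : ℝ, |x| < r → ‖a x - (a₀ + a₁ * x)‖ ≤ K * x ^ 2) →
      (∀ x : ℝ, x ^ 2 / (3 * (1 + x ^ 2)) ≤ (G x).re) →
      (∀ x : ℝ, ‖a x‖ ≤ K * (1 + x ^ 2)⁻¹) → 1 ≤ s →
      ‖(∫ x : ℝ, Complex.exp (-((s ^ 2 : ℝ) * G x)) * a x) - a₀ * √(π / (s ^ 2 * q))‖
        ≤ K' / s ^ 3 := by
  set J := ∫ x : ℝ, Real.exp (-(x ^ 2 / 6)) * (x ^ 2 + x ^ 4 + x ^ 6) with hJ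
  set A := (K + 3 * K ^ 2 + 12 * K ^ 3) + (K / r ^ 2 + K / r + K ^ 2 / r) with hA
  refine ⟨A * J + K * (72 / r ^ 4) * π, ?_⟩
  intro s hs G a q p₃ a₀ a₁ hGc hac hq hp₃ ha₀ ha₁ hG haa hre ha hs1
  have hK : 0 ≤ K := (norm_nonneg _).trans hp₃
  have hqs : 0 < s ^ 2 * q := by
    have : 0 < q := by linarith
    positivity
  set f : ℝ → ℝ := fun x => Real.exp (-(x ^ 2 / 6)) * (x ^ 2 + x ^ 4 + x ^ 6) with hf
  have hfint : Integrable f := by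
    have h := fun k => integrable_pow_mul_exp_neg_mul_sq (b := 1 / 6) (by norm_num) k
    refine (((h 2).add (h 4)).add (h 6)).congr (.of_forall fun x => ?_)
    simp only [hf, Pi.add_apply]
    rw [show (1 / 6 : ℝ) * x ^ 2 = x ^ 2 / 6 by ring]
    ring
  have hfs : Integrable fun x => f (s * x) := hfint.comp_mul_left' hs.ne'
  have hpt : ∀ x : ℝ, ‖Complex.exp (-((s ^ 2 : ℝ) * G x)) * a x
      - Complex.exp (-((s ^ 2 * q : ℝ) * x ^ 2)) * (a₀ + a₁ * x - (s ^ 2 * a₀ * p₃) * x ^ 3)‖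
      ≤ A * ((s ^ 2)⁻¹ * f (s * x)) + K * Real.exp (-(s ^ 2 * r ^ 2 / 6)) * (1 + x ^ 2)⁻¹ := by
    intro x
    have hfx : (s ^ 2)⁻¹ * f (s * x) = Real.exp (-(s ^ 2 * x ^ 2 / 6)) *
        (x ^ 2 + s ^ 2 * x ^ 4 + (s ^ 2) ^ 2 * x ^ 6) := by
      simp only [hf]
      rw [mul_pow]
      field_simp
    have hpos : 0 ≤ Real.exp (-(s ^ 2 * x ^ 2 / 6)) *
        (x ^ 2 + s ^ 2 * x ^ 4 + (s ^ 2) ^ 2 * x ^ 6) := by positivity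
    have hB : 0 ≤ K * Real.exp (-(s ^ 2 * r ^ 2 / 6)) * (1 + x ^ 2)⁻¹ := by positivity
    have hC1 : 0 ≤ K + 3 * K ^ 2 + 12 * K ^ 3 := by positivity
    have hC2 : 0 ≤ K / r ^ 2 + K / r + K ^ 2 / r := by positivity
    have hcongr : Complex.exp (-((s ^ 2 : ℝ) * G x)) * a x
        - Complex.exp (-((s ^ 2 * q : ℝ) * x ^ 2)) * (a₀ + a₁ * x - (s ^ 2 * a₀ * p₃) * x ^ 3)
        = Complex.exp (-((s ^ 2 : ℝ) * G x)) * a x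
        - Complex.exp (-((s ^ 2 : ℝ) * q * x ^ 2)) *
          (a₀ + a₁ * x - (s ^ 2 : ℝ) * a₀ * p₃ * x ^ 3) := by
      push_cast; rfl
    rw [hfx, hcongr]
    have hax : ‖a x‖ ≤ K := (ha x).trans (by
      have : (1 + x ^ 2)⁻¹ ≤ 1 := inv_le_one_of_one_le₀ (by nlinarith)
      nlinarith)
    have hxe := hre x
    rcases lt_or_ge |x| r with hx | hx
    · refine (norm_laplace_integrand_sub_le (sq_nonneg s) (hx.le.trans hr1) hq hp₃ ha₁ hax (hG x hx)
        (haa x hx) ?_).trans ?_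
      · refine le_trans ?_ hxe
        have : x ^ 2 ≤ 1 := by
          rw [← sq_abs]; exact pow_le_one₀ (abs_nonneg x) (hx.le.trans hr1)
        apply div_le_div_of_nonneg_left <;> nlinarith
      · rw [hA, add_mul]
        have := mul_nonneg hC2 hpos
        linarith
    · refine (norm_laplace_integrand_sub_le_of_le (sq_nonneg s) hr hx hq hp₃ ha₀ ha₁ (ha x)
        ?_).trans ?_
      · refine le_trans ?_ hxe
        have h1 : r ^ 2 ≤ x ^ 2 := by
          rw [← sq_abs x]; gcongr
        have h2 : r ^ 2 ≤ 1 := pow_le_one₀ hr.le hr1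
        rw [div_le_div_iff₀ (by norm_num) (by positivity)]
        nlinarith [mul_le_mul_of_nonneg_right h2 (sq_nonneg x)]
      · rw [hA, add_mul]
        have := mul_nonneg hC1 hpos
        linarith
  have hmaj : Integrable fun x : ℝ => A * ((s ^ 2)⁻¹ * f (s * x))
      + K * Real.exp (-(s ^ 2 * r ^ 2 / 6)) * (1 + x ^ 2)⁻¹ :=
    ((hfs.const_mul _).const_mul _).add (integrable_inv_one_add_sq.const_mul _)
  obtain ⟨hmi, hmv⟩ := integral_gaussian_mul_cubic hqs a₀ a₁ (s ^ 2 * a₀ * p₃)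
  have hdiff : Integrable fun x : ℝ => Complex.exp (-((s ^ 2 : ℝ) * G x)) * a x
      - Complex.exp (-((s ^ 2 * q : ℝ) * x ^ 2)) *
        (a₀ + a₁ * x - (s ^ 2 * a₀ * p₃) * x ^ 3) :=
    hmaj.mono' (Continuous.aestronglyMeasurable (by fun_prop)) (.of_forall hpt)
  have hIi : Integrable fun x : ℝ => Complex.exp (-((s ^ 2 : ℝ) * G x)) * a x := by
    refine (hdiff.add hmi).congr (.of_forall fun x => ?_)
    simp
  rw [← hmv, ← integral_sub hIi hmi]
  refine (norm_integral_le_of_norm_le hmaj (.of_forall hpt)).trans ?_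
  rw [integral_add ((hfs.const_mul _).const_mul _) (integrable_inv_one_add_sq.const_mul _),
    integral_const_mul, integral_const_mul, integral_const_mul, integral_univ_inv_one_add_sq,
    Measure.integral_comp_mul_left, abs_of_pos (inv_pos.2 hs), smul_eq_mul, add_div]
  refine add_le_add (le_of_eq ?_) ?_
  · rw [← hJ]; field_simp
  · have h1 : Real.exp (-(s ^ 2 * r ^ 2 / 6)) ≤ 72 / r ^ 4 / s ^ 3 := by
      set v := s ^ 2 * r ^ 2 / 6 with hv
      have hv0 : 0 < v := by positivity
      have h2 : v ^ 2 / 2 ≤ Real.exp v := by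
        have := Real.quadratic_le_exp_of_nonneg hv0.le
        linarith
      have h3 : s ^ 3 ≤ s ^ 4 := pow_le_pow_right₀ hs1 (by norm_num)
      rw [Real.exp_neg, div_div]
      calc (Real.exp v)⁻¹ ≤ (v ^ 2 / 2)⁻¹ := inv_anti₀ (by positivity) h2
        _ = 72 / (r ^ 4 * s ^ 4) := by rw [hv]; field_simp; norm_num
        _ ≤ _ := by gcongr
    calc _ ≤ K * (72 / r ^ 4 / s ^ 3) * π := by gcongr
      _ = _ := by ring

theorem abs_im_lt_pi_of_mem_Icc {Y : ℝ} (hY : Y < π) {z : ℂ} (hz : z.im ∈ Set.Icc 0 Y) :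
    |z.im| < π := by
  rw [abs_of_nonneg hz.1]; exact hz.2.trans_lt hY

theorem exists_bound_on_discs (Y : ℝ) (hY : Y ∈ Set.Ico 0 π) : ∃ r : ℝ, 0 < r ∧ r ≤ 1 ∧
    ∀ f : ℂ → ℂ, (∀ z : ℂ, |z.im| < π → DifferentiableAt ℂ f z) → ∃ M : ℝ, ∀ y ∈ Set.Icc 0 Y,
      DifferentiableOn ℂ f (Metric.ball (y * Complex.I) r) ∧
      ∀ z ∈ Metric.ball (y * Complex.I) r, ‖f z‖ ≤ M := by
  have hpi := Real.pi_gt_three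
  set r := min 1 ((π - Y) / 2) with hr
  have hr1 : r ≤ 1 := min_le_left _ _
  have hr2 : r ≤ (π - Y) / 2 := min_le_right _ _
  have hY2 := hY.2
  refine ⟨r, lt_min one_pos (by linarith), hr1, fun f hf => ?_⟩
  have hcomp : IsCompact (Set.Icc (-1 : ℝ) 1 ×ℂ Set.Icc (-1 : ℝ) (Y + r)) :=
    isCompact_Icc.reProdIm isCompact_Icc
  have hsub : ∀ z ∈ Set.Icc (-1 : ℝ) 1 ×ℂ Set.Icc (-1 : ℝ) (Y + r), |z.im| < π := by
    intro z hz
    have h1 := hz.2.1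
    have h2 := hz.2.2
    rw [abs_lt]
    constructor <;> linarith
  have hball : ∀ y ∈ Set.Icc 0 Y, ∀ z ∈ Metric.ball (y * Complex.I) r,
      z ∈ Set.Icc (-1 : ℝ) 1 ×ℂ Set.Icc (-1 : ℝ) (Y + r) := by
    intro y hy z hz
    rw [mem_ball_iff_norm] at hz
    have h1 := abs_lt.1 ((Complex.abs_re_le_norm _).trans_lt hz)
    have h2 := abs_lt.1 ((Complex.abs_im_le_norm _).trans_lt hz)
    simp at h1 h2
    have h3 := hy.1
    have h4 := hy.2
    refine ⟨⟨?_, ?_⟩, ⟨?_, ?_⟩⟩ <;> linarith [h1.1, h1.2, h2.1, h2.2]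
  obtain ⟨M, hM⟩ := hcomp.exists_bound_of_continuousOn (f := f)
    fun z hz => (hf z (hsub z hz)).continuousAt.continuousWithinAt
  exact ⟨M, fun y hy => ⟨fun z hz => (hf z (hsub z (hball y hy z hz))).differentiableWithinAt,
    fun z hz => hM z (hball y hy z hz)⟩⟩

theorem norm_amplitude_le_of_one_le {n : ℕ} (k₁ k₂ : ℕ) (hn : 1 ≤ n) {x y : ℝ} (hx : 1 ≤ |x|)
    (hy : |y| ≤ π) : ‖amplitude n k₁ k₂ (x + y * Complex.I)‖
      ≤ 2 ^ k₁ * 4 * ((k₂ + n + k₁ + 2).factorial * Real.exp π) * (1 + x ^ 2)⁻¹ := by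
  set S := |Real.sinh x| with hS
  set B := |x| + π with hB
  have hpi := Real.pi_gt_three
  have hSx : S = Real.sinh |x| := Real.abs_sinh x
  have hexp : Real.exp |x| ≤ 4 * S ∧ Real.cosh x ≤ 2 * S := by
    have h2 : 2 ≤ Real.exp |x| := by linarith [Real.add_one_le_exp |x|]
    have h3 : Real.exp |x| * Real.exp (-|x|) = 1 := by rw [← Real.exp_add]; simp
    rw [hSx, ← Real.cosh_abs x, Real.sinh_eq, Real.cosh_eq]
    constructor <;> nlinarith [Real.exp_pos (-|x|)]
  have hS1 : 1 ≤ S := by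
    rw [hSx]; exact hx.trans (Real.self_le_sinh_iff.2 (abs_nonneg x))
  have hB1 : 1 ≤ B := by linarith
  set z : ℂ := x + y * Complex.I with hz
  have hzB : ‖z‖ ≤ B := by
    refine (norm_add_le _ _).trans ?_
    simp only [norm_mul, Complex.norm_I, Complex.norm_real, Real.norm_eq_abs, mul_one]
    linarith
  have hz0 : z ≠ 0 := by
    intro h
    have := congrArg Complex.re h
    simp [hz] at this
    simp [this] at hx
    linarith
  have hsz : S ≤ ‖Complex.sinh z‖ := abs_sinh_le_norm_sinh x y
  have hsc : S / B ≤ ‖sinhc z‖ := by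
    rw [sinhc_of_ne_zero hz0, norm_div]
    have : 0 < ‖z‖ := norm_pos_iff.2 hz0
    gcongr
  have hcz : ‖Complex.cosh z‖ ≤ 2 * S := (norm_cosh_le x y).trans hexp.2
  have hfac : B ^ (k₂ + n + k₁) * (1 + x ^ 2)
      ≤ (k₂ + n + k₁ + 2).factorial * (Real.exp π * Real.exp |x|) := by
    have h1 := Real.pow_div_factorial_le_exp (x := B) (by linarith) (k₂ + n + k₁ + 2)
    rw [div_le_iff₀ (by positivity), hB, Real.exp_add, ← hB] at h1
    have h2 : 1 + x ^ 2 ≤ B ^ 2 := by rw [← sq_abs x]; nlinarith [abs_nonneg x]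
    calc B ^ (k₂ + n + k₁) * (1 + x ^ 2) ≤ B ^ (k₂ + n + k₁) * B ^ 2 := by gcongr
      _ = B ^ (k₂ + n + k₁ + 2) := (pow_add _ _ 2).symm
      _ ≤ _ := by linarith
  rw [amplitude, norm_div, norm_mul, norm_pow, norm_pow, norm_pow, ← div_eq_mul_inv,
    le_div_iff₀ (by positivity)]
  have hfac' : B ^ (k₂ + n + k₁) * (1 + x ^ 2)
      ≤ (k₂ + n + k₁ + 2).factorial * (Real.exp π * (4 * S)) :=
    hfac.trans (by gcongr; exact hexp.1)
  have hSn : S ≤ S ^ n := le_self_pow₀ hS1 (by omega)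
  calc ‖z‖ ^ k₂ * ‖Complex.cosh z‖ ^ k₁ / ‖sinhc z‖ ^ (n + k₁) * (1 + x ^ 2)
      ≤ B ^ k₂ * (2 * S) ^ k₁ / (S / B) ^ (n + k₁) * (1 + x ^ 2) := by gcongr
    _ = 2 ^ k₁ * (B ^ (k₂ + n + k₁) * (1 + x ^ 2)) / S ^ n := by
        rw [div_pow, mul_pow, pow_add, pow_add, pow_add, pow_add]
        field_simp
    _ ≤ 2 ^ k₁ * ((k₂ + n + k₁ + 2).factorial * (Real.exp π * (4 * S))) / S :=
        div_le_div₀ (by positivity) (mul_le_mul_of_nonneg_left hfac' (by positivity))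
          (by linarith) hSn
    _ = _ := by field_simp

theorem exists_amplitude_bound {n : ℕ} (k₁ k₂ : ℕ) (hn : 1 ≤ n) (Y : ℝ) (hY : Y ∈ Set.Ico 0 π) :
    ∃ K : ℝ, ∀ x : ℝ, ∀ y ∈ Set.Icc 0 Y,
      ‖amplitude n k₁ k₂ (x + y * Complex.I)‖ ≤ K * (1 + x ^ 2)⁻¹ := by
  have hcomp : IsCompact (Set.Icc (-1 : ℝ) 1 ×ℂ Set.Icc (0 : ℝ) Y) :=
    isCompact_Icc.reProdIm isCompact_Icc
  obtain ⟨M, hM⟩ := hcomp.exists_bound_of_continuousOn (f := amplitude n k₁ k₂)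
    fun z hz => (differentiableAt_amplitude n k₁ k₂
      (abs_im_lt_pi_of_mem_Icc hY.2 hz.2)).continuousAt.continuousWithinAt
  refine ⟨max (2 * M) (2 ^ k₁ * 4 * ((k₂ + n + k₁ + 2).factorial * Real.exp π)), fun x y hy => ?_⟩
  rcases le_total 1 |x| with h | h
  · refine (norm_amplitude_le_of_one_le k₁ k₂ hn h ?_).trans ?_
    · rw [abs_of_nonneg hy.1]; exact hy.2.trans hY.2.le
    · gcongr
      exact le_max_right _ _
  · have h1 := hM (x + y * Complex.I) ⟨by simpa using abs_le.1 h, by simpa using hy⟩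
    have hM0 : 0 ≤ M := (norm_nonneg _).trans h1
    have h2 : x ^ 2 ≤ 1 := by rw [← sq_abs]; exact pow_le_one₀ (abs_nonneg x) h
    rw [← div_eq_mul_inv, le_div_iff₀ (by positivity)]
    calc _ ≤ M * 2 := by gcongr; linarith
      _ ≤ _ := by rw [mul_comm]; exact le_max_left _ _

/-- The critical value of the phase, `d² / |x|²` in terms of the Carnot–Carathéodory distance. -/
noncomputable def criticalValue (y : ℝ) : ℝ :=
  theta y * y + if y = 0 then 1 else y * Real.cos y / Real.sin y

/-- Moving the contour through the saddle point `iy`. -/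
theorem integral_eq_exp_mul_integral_phase {n : ℕ} (k₁ k₂ : ℕ) (hn : 1 ≤ n) {y R : ℝ}
    (hy : y ∈ Set.Ico 0 π) (hR : 0 ≤ R) :
    ∫ u : ℝ, Complex.exp (Complex.I * u * (R * theta y : ℝ) - R * mulCoth u) * amplitude n k₁ k₂ u
      = Real.exp (-(R * criticalValue y)) *
        ∫ u : ℝ, Complex.exp (-(R * phase y u)) * amplitude n k₁ k₂ (u + y * Complex.I) := by
  obtain ⟨K, hK⟩ := exists_amplitude_bound k₁ k₂ hn y hy
  have hstrip : ∀ {z : ℂ}, z.im ∈ Set.Icc 0 y → |z.im| < π := fun hz =>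
    abs_im_lt_pi_of_mem_Icc hy.2 hz
  have hc : ContinuousOn (fun s : ℝ =>
      Real.exp (-s * (R * theta y) - R * (mulCoth (s * Complex.I)).re)) (Set.Icc 0 y) := by
    have : ContinuousOn (fun s : ℝ => mulCoth (s * Complex.I)) (Set.Icc 0 y) := fun s hs =>
      (ContinuousAt.comp (f := fun s : ℝ => (s : ℂ) * Complex.I)
        (differentiableAt_mulCoth (hstrip (by simpa using hs))).continuousAt
        (by fun_prop)).continuousWithinAt
    have h2 := Complex.continuous_re.comp_continuousOn this
    simp only [Function.comp_def] at h2
    fun_prop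
  obtain ⟨M, hM⟩ := isCompact_Icc.exists_bound_of_continuousOn hc
  have hshift := integral_eq_integral_add_mul_I (y := y) (M := M * K) (f := fun z : ℂ =>
    Complex.exp (Complex.I * z * (R * theta y : ℝ) - R * mulCoth z) * amplitude n k₁ k₂ z) hy.1
    (fun z hz => by
      have h1 := differentiableAt_mulCoth (hstrip hz)
      have h2 := differentiableAt_amplitude n k₁ k₂ (hstrip hz)
      fun_prop)
    (fun x s hs => by
      have hs' : s ∈ Set.Ico 0 π := ⟨hs.1, hs.2.trans_lt hy.2⟩
      have h1 : (mulCoth (s * Complex.I)).re ≤ (mulCoth (x + s * Complex.I)).re := by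
        have h2 := phase_re hs' x
        have h3 := le_phaseExcess hs' x
        have h4 : 0 ≤ x ^ 2 / (3 * (1 + x ^ 2)) := by positivity
        simp [phase] at h2
        linarith
      rw [norm_mul, mul_assoc M]
      have h5 : ‖Complex.exp (Complex.I * (x + s * Complex.I) * (R * theta y : ℝ)
          - R * mulCoth (x + s * Complex.I))‖ ≤ M := by
        refine le_trans ?_ (hM s hs)
        rw [Complex.norm_exp, Real.norm_of_nonneg (Real.exp_pos _).le, Real.exp_le_exp]
        have h6 := mul_le_mul_of_nonneg_left h1 hR
        rw [Complex.sub_re, Complex.re_mul_ofReal, Complex.re_ofReal_mul]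
        simp
        linarith
      exact mul_le_mul h5 (hK x s hs) (norm_nonneg _) ((norm_nonneg _).trans h5))
  rw [hshift, ← integral_const_mul]
  congr 1
  funext u
  rw [← mul_assoc, Complex.ofReal_exp, ← Complex.exp_add]
  congr 2
  rw [phase, mulCoth_mul_I hy, criticalValue]
  push_cast
  ring_nf
  rw [Complex.I_sq]
  ring

/-- Second order asymptotics of the shifted integral, uniformly for `0 ≤ y ≤ Y < π`. -/
theorem exists_integral_phase_bound {n : ℕ} (k₁ k₂ : ℕ) (hn : 1 ≤ n) (Y : ℝ)
    (hY : Y ∈ Set.Ico 0 π) : ∃ K Q : ℝ, ∀ y ∈ Set.Icc 0 Y, phaseCurvature y ≤ Q ∧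
      ∀ s : ℝ, 1 ≤ s →
        ‖(∫ u : ℝ, Complex.exp (-((s ^ 2 : ℝ) * phase y u)) * amplitude n k₁ k₂ (u + y * Complex.I))
          - amplitude n k₁ k₂ (y * Complex.I) * √(π / (s ^ 2 * phaseCurvature y))‖ ≤ K / s ^ 3 := by
  obtain ⟨r, hr, hr1, hdisc⟩ := exists_bound_on_discs Y hY
  obtain ⟨M₁, hM₁⟩ := hdisc mulCoth fun z hz => differentiableAt_mulCoth hz
  obtain ⟨M₂, hM₂⟩ := hdisc (amplitude n k₁ k₂) fun z hz => differentiableAt_amplitude n k₁ k₂ hz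
  obtain ⟨K₀, hK₀⟩ := exists_amplitude_bound k₁ k₂ hn Y hY
  set K := max K₀ (max (max (M₁ * (2 / r) ^ 3) (M₁ * (2 / r) ^ 4))
    (max (M₂ * (2 / r) ^ 0) (max (M₂ * (2 / r) ^ 1) (M₂ * (2 / r) ^ 2)))) with hK
  obtain ⟨K', hK'⟩ := exists_laplace_bound K r hr hr1
  refine ⟨K', M₁ * (2 / r) ^ 2, fun y hy => ?_⟩
  have hyπ : y ∈ Set.Ico 0 π := ⟨hy.1, hy.2.trans_lt hY.2⟩
  obtain ⟨p, hp, hpz⟩ := exists_taylor_of_bounded r hr 4 M₁ mulCoth (y * Complex.I)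
    (hM₁ y hy).1 (hM₁ y hy).2
  obtain ⟨b, hb, hbz⟩ := exists_taylor_of_bounded r hr 2 M₂ (amplitude n k₁ k₂) (y * Complex.I)
    (hM₂ y hy).1 (hM₂ y hy).2
  have hmem : ∀ x : ℝ, |x| < r → (x + y * Complex.I : ℂ) ∈ Metric.ball (y * Complex.I) r := by
    intro x hx
    simpa [mem_ball_iff_norm] using hx
  have hp0 : p 0 = mulCoth (y * Complex.I) := by
    have := hpz (y * Complex.I) (Metric.mem_ball_self hr)
    simp [Finset.sum_range_succ] at this
    exact (sub_eq_zero.1 this).symm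
  have hb0 : b 0 = amplitude n k₁ k₂ (y * Complex.I) := by
    have := hbz (y * Complex.I) (Metric.mem_ball_self hr)
    simp [Finset.sum_range_succ] at this
    exact (sub_eq_zero.1 this).symm
  have hph : ∀ x : ℝ, |x| < r → ‖phase y x - ((p 1 - theta y * Complex.I) * x + p 2 * x ^ 2
      + p 3 * x ^ 3)‖ ≤ M₁ * (2 / r) ^ 4 * x ^ 4 := by
    intro x hx
    have h1 := hpz _ (hmem x hx)
    rw [add_sub_cancel_right, Complex.norm_real, Real.norm_eq_abs, pow_abs,
      abs_of_nonneg (Even.pow_nonneg (by decide) x)] at h1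
    convert h1 using 2
    simp only [Finset.sum_range_succ, Finset.sum_range_zero, hp0, phase]
    ring
  obtain ⟨hp1, hp2⟩ := taylor_coeff_of_tendsto hr hph (phase_neg hyπ)
    ((tendsto_phaseExcess_div_sq hyπ).congr fun x => by rw [phase_re hyπ])
    (tendsto_phase_im_div hyπ)
  have hq := one_third_le_phaseCurvature hyπ
  refine ⟨?_, fun s hs => ?_⟩
  · have := hp 2
    rw [hp2, Complex.norm_real] at this
    exact (le_abs_self _).trans this
  have hline : ∀ x : ℝ, |(x + y * Complex.I : ℂ).im| < π := fun x =>
    abs_im_lt_pi_of_mem_Icc hY.2 (by simpa using hy)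
  have hcont : ∀ f : ℂ → ℂ, (∀ z : ℂ, |z.im| < π → DifferentiableAt ℂ f z) →
      Continuous fun x : ℝ => f (x + y * Complex.I) := fun f hf =>
    continuous_iff_continuousAt.2 fun x =>
      ContinuousAt.comp (f := fun x : ℝ => (x : ℂ) + y * Complex.I)
        (hf _ (hline x)).continuousAt (by fun_prop)
  have hmc := hcont mulCoth fun z hz => differentiableAt_mulCoth hz
  have hpc : Continuous (phase y) := by unfold phase; fun_prop
  rw [← hb0]
  refine hK' s (by linarith) (phase y) (fun u => amplitude n k₁ k₂ (u + y * Complex.I))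
    (phaseCurvature y) (p 3) (b 0) (b 1) hpc
    (hcont _ fun z hz => differentiableAt_amplitude n k₁ k₂ hz) hq ((hp 3).trans (by simp [hK]))
    ((hb 0).trans (by simp [hK])) ((hb 1).trans (by simp [hK])) ?_ ?_ ?_ ?_ hs
  · intro x hx
    have h1 := hph x hx
    rw [hp1, hp2, zero_mul, zero_add] at h1
    refine h1.trans ?_
    have : M₁ * (2 / r) ^ 4 ≤ K := by simp [hK]
    have := Even.pow_nonneg (by decide : Even 4) x
    gcongr
  · intro x hx
    have h1 := hbz _ (hmem x hx)
    rw [add_sub_cancel_right, Complex.norm_real, Real.norm_eq_abs, sq_abs] at h1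
    have : M₂ * (2 / r) ^ 2 ≤ K := by simp [hK]
    refine le_trans ?_ (h1.trans (by gcongr))
    simp [Finset.sum_range_succ]
  · intro x
    rw [phase_re hyπ]
    exact le_phaseExcess hyπ x
  · intro x
    refine (hK₀ x y hy).trans ?_
    gcongr
    simp [hK]

theorem amplitude_mul_I {n : ℕ} (k₁ k₂ : ℕ) {y : ℝ} (hy : y ∈ Set.Ico 0 π) :
    2 * (-1 : ℂ) ^ k₁ * Complex.I ^ k₂ * amplitude n k₁ k₂ (y * Complex.I)
      = (2 * BH n k₁ k₂ y : ℝ) := by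
  have hI : Complex.I ^ k₂ * Complex.I ^ k₂ = (-1) ^ k₂ := by
    rw [← mul_pow, Complex.I_mul_I]
  rcases eq_or_ne y 0 with rfl | h0
  · rcases eq_or_ne k₂ 0 with rfl | h2
    · simp [amplitude, BH, sinhc_zero]
    · simp [amplitude, BH, h2]
  · have hsin : Real.sin y ≠ 0 :=
      (Real.sin_pos_of_pos_of_lt_pi (lt_of_le_of_ne hy.1 h0.symm) hy.2).ne'
    have hsc : sinhc (y * Complex.I) = (Real.sin y : ℂ) / y := by
      rw [sinhc_of_ne_zero (by simp [h0]), Complex.sinh_mul_I, Complex.ofReal_sin]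
      exact mul_div_mul_right _ _ Complex.I_ne_zero
    have hsin' : (Real.sin y : ℂ) ≠ 0 := by exact_mod_cast hsin
    have h0' : (y : ℂ) ≠ 0 := by exact_mod_cast h0
    rw [amplitude, hsc, Complex.cosh_mul_I, ← Complex.ofReal_cos, BH, if_neg h0]
    simp only [Complex.ofReal_mul, Complex.ofReal_div, Complex.ofReal_pow, Complex.ofReal_neg,
      Complex.ofReal_one, Complex.ofReal_ofNat]
    rw [mul_pow, pow_add (-1 : ℂ), ← hI, div_pow]
    field_simp
    ring

theorem PsiH_eq (n : ℕ) (y : ℝ) :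
    PsiH n y = √(π / phaseCurvature y) / (4 ^ n * π ^ (n + 1)) := by
  rw [PsiH, phaseCurvature]
  split_ifs with h
  · congr 2
    field_simp
  · rw [div_div_eq_mul_div]

theorem criticalValue_eq {y : ℝ} (hy : y ∈ Set.Ico 0 π) (r : ℝ) :
    r ^ 2 / 4 * criticalValue y = dCC r y ^ 2 / 4 := by
  rw [criticalValue, dCC, theta]
  split_ifs with h
  · simp [h]
  · have hsin : Real.sin y ≠ 0 :=
      (Real.sin_pos_of_pos_of_lt_pi (lt_of_le_of_ne hy.1 (Ne.symm h)) hy.2).ne'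
    rw [Real.sin_two_mul]
    field_simp
    ring

theorem pH_eq_integral_amplitude (n k₁ k₂ : ℕ) (x : EuclideanSpace ℝ (Fin (2 * n))) (t : ℝ) :
    pH n k₁ k₂ x t = 2 * (-1 : ℂ) ^ k₁ * Complex.I ^ k₂ / (4 * (π : ℂ)) ^ (n + 1) *
      ∫ u : ℝ, Complex.exp (Complex.I * u * (|t| : ℝ) - (‖x‖ ^ 2 / 4 : ℝ) * mulCoth u)
        * amplitude n k₁ k₂ u := by
  rw [pH]
  congr 2
  funext u
  split_ifs with h h2
  · simp [h, h2, mulCoth, amplitude, sinhc_zero]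
  · simp [h, h2, amplitude]
  · have hu : (u : ℂ) ≠ 0 := by exact_mod_cast h
    have hs : Complex.sinh u ≠ 0 := by
      rw [← Complex.ofReal_sinh]; exact_mod_cast fun h' => h (Real.sinh_eq_zero.1 h')
    rw [amplitude, mulCoth, sinhc_of_ne_zero hu, div_pow]
    push_cast
    congr 1
    · congr 2
      field_simp
    · field_simp
      ring

/-- Case I asymptotics on the Heisenberg group: for |x|² + |t| large with ω = 4|t|/|x|² ≤ C,
p_{1,k₁,k₂}(x,t) = |x|⁻¹ e^{−d²/4} Ψ(ω) [B(ω) + O(|x|⁻²)]. -/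
theorem heisenberg_caseI (n k₁ k₂ : ℕ) (hn : 1 ≤ n) (C : ℝ) (hC : 0 < C) :
    ∃ K : ℝ, 0 < K ∧ ∃ M : ℝ, 0 < M ∧
      ∀ (x : EuclideanSpace ℝ (Fin (2 * n))) (t : ℝ) (yω : ℝ),
        x ≠ 0 → M ≤ ‖x‖ ^ 2 + |t| →
        yω ∈ Set.Ico 0 π → theta yω = 4 * |t| / ‖x‖ ^ 2 →
        4 * |t| / ‖x‖ ^ 2 ≤ C →
        ‖pH n k₁ k₂ x t -
            (((1 / ‖x‖) * Real.exp (-(dCC ‖x‖ yω) ^ 2 / 4) * PsiH n yω * BH n k₁ k₂ yω : ℝ) : ℂ)‖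
          ≤ K / ‖x‖ ^ 3 * Real.exp (-(dCC ‖x‖ yω) ^ 2 / 4) * PsiH n yω := by
  obtain ⟨Y, hY, hYC⟩ := exists_le_of_theta_le C hC
  obtain ⟨K₁, Q, hKQ⟩ := exists_integral_phase_bound k₁ k₂ hn Y hY
  have hpi := Real.pi_pos
  have hQ : 0 < Q := by
    have h0 : (0 : ℝ) ∈ Set.Ico 0 π := ⟨le_rfl, hpi⟩
    linarith [one_third_le_phaseCurvature h0, (hKQ 0 ⟨le_rfl, hY.1⟩).1]
  set A : ℝ := 2 / (4 * π) ^ (n + 1) with hA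
  set c : ℝ := √(π / Q) / (4 ^ n * π ^ (n + 1)) with hc
  have hA0 : 0 < A := by positivity
  have hc0 : 0 < c := by positivity
  refine ⟨A * |K₁| * 8 / c + 1, by positivity, 4 * (1 + C / 4), by positivity, ?_⟩
  intro x t y hx hM hy hθ hω
  have hr : 0 < ‖x‖ := norm_pos_iff.2 hx
  have hyY : y ∈ Set.Icc 0 Y := ⟨hy.1, hYC y hy (hθ.trans_le hω)⟩
  obtain ⟨hq, hbound⟩ := hKQ y hyY
  have hq0 : 0 < phaseCurvature y := by linarith [one_third_le_phaseCurvature hy]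
  have hs1 : 1 ≤ ‖x‖ / 2 := by
    rw [div_le_iff₀ (by positivity)] at hω
    have h4 : 4 ≤ ‖x‖ ^ 2 := by
      have : 4 * (1 + C / 4) ≤ ‖x‖ ^ 2 * (1 + C / 4) := by linarith
      exact le_of_mul_le_mul_right this (by positivity)
    nlinarith
  have ht : |t| = ‖x‖ ^ 2 / 4 * theta y := by
    rw [hθ]; field_simp
  have hJ := hbound (‖x‖ / 2) hs1
  have hs2 : (‖x‖ / 2) ^ 2 = ‖x‖ ^ 2 / 4 := by ring
  have hsqrt : √(π / ((‖x‖ / 2) ^ 2 * phaseCurvature y)) = 2 / ‖x‖ * √(π / phaseCurvature y) := by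
    rw [mul_comm, ← div_div, Real.sqrt_div' _ (sq_nonneg _), Real.sqrt_sq (by positivity)]
    field_simp
  rw [hsqrt, hs2] at hJ
  rw [pH_eq_integral_amplitude, ht, integral_eq_exp_mul_integral_phase k₁ k₂ hn hy (by positivity),
    criticalValue_eq hy, ← neg_div]
  set J := ∫ u : ℝ, Complex.exp (-((‖x‖ ^ 2 / 4 : ℝ) * phase y u))
    * amplitude n k₁ k₂ (u + y * Complex.I)
  set E := Real.exp (-dCC ‖x‖ y ^ 2 / 4) with hE
  have hmain : (((1 / ‖x‖) * E * PsiH n y * BH n k₁ k₂ y : ℝ) : ℂ)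
      = 2 * (-1 : ℂ) ^ k₁ * Complex.I ^ k₂ / (4 * (π : ℂ)) ^ (n + 1) *
        (E * (amplitude n k₁ k₂ (y * Complex.I) *
          (2 / ‖x‖ * √(π / phaseCurvature y) : ℝ))) := by
    have h := amplitude_mul_I (n := n) k₁ k₂ hy
    calc _ = ((2 * BH n k₁ k₂ y : ℝ) : ℂ) / (4 * (π : ℂ)) ^ (n + 1) *
          (E * (2 / ‖x‖ * √(π / phaseCurvature y) : ℝ)) := by
          rw [PsiH_eq]
          norm_cast
          push_cast
          rw [mul_pow, pow_succ 4]
          field_simp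
          ring
      _ = _ := by rw [← h]; ring
  have hPsi : c ≤ PsiH n y := by
    rw [PsiH_eq, hc]
    gcongr
  have hpre : ‖2 * (-1 : ℂ) ^ k₁ * Complex.I ^ k₂ / (4 * (π : ℂ)) ^ (n + 1)‖ = A := by
    simp [hA, abs_of_pos hpi]
  have hEn : ‖(E : ℂ)‖ = E := by
    rw [Complex.norm_real, Real.norm_of_nonneg (Real.exp_pos _).le]
  have hE0 : 0 < E := Real.exp_pos _
  rw [hmain, ← mul_sub, ← mul_sub, norm_mul, norm_mul, hpre, hEn]
  calc _ ≤ A * (E * (K₁ / (‖x‖ / 2) ^ 3)) := by gcongr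
    _ ≤ A * (E * (|K₁| / (‖x‖ / 2) ^ 3)) := by gcongr; exact le_abs_self K₁
    _ = A * |K₁| * 8 / c * c * (E / ‖x‖ ^ 3) := by field_simp; ring
    _ ≤ (A * |K₁| * 8 / c + 1) * PsiH n y * (E / ‖x‖ ^ 3) := by
        gcongr
        linarith
    _ = _ := by ring
end

section
/- Fix integers n ≥ 1 and k₁, k₂ ≥ 0. Then there exist constants K > 0, δ₀ > 0 and κ₀ > 0 such that for all (x, t) ∈ ℝ^{2n} × ℝ with x ≠ 0, t ≠ 0, δ ≤ δ₀ and κ ≥ κ₀, one has |p_{1,k₁,k₂}(x,t) − P(x,t)| ≤ K |P(x,t)| (1/κ + δ), where P(x,t) = ((−1)^{k₂} π^{k₁+k₂} / (4ⁿ (πδ)^{n+k₁−1} √(2πκ))) · e^{−d(x,t)²/4}. -/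
open Real Complex MeasureTheory

namespace HeisenbergHeat

theorem exists_norm_le_of_differentiableOn {g : ℂ → ℂ}
    (hg : DifferentiableOn ℂ g (Metric.ball 0 3)) :
    ∃ C, 0 < C ∧ ∀ z ∈ Metric.closedBall (0 : ℂ) 2, ‖g z‖ ≤ C := by
  have hc : ContinuousOn g (Metric.closedBall 0 2) :=
    hg.continuousOn.mono (Metric.closedBall_subset_ball (by norm_num))
  obtain ⟨C, hC⟩ := (isCompact_closedBall (0 : ℂ) 2).exists_bound_of_continuousOn hc
  exact ⟨max C 1, by positivity, fun z hz => (hC z hz).trans (le_max_left _ _)⟩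

theorem exists_norm_sub_le_of_differentiableOn {g : ℂ → ℂ}
    (hg : DifferentiableOn ℂ g (Metric.ball 0 3)) :
    ∃ C, 0 < C ∧ ∀ z ∈ Metric.closedBall (0 : ℂ) 2, ∀ a ∈ Metric.closedBall (0 : ℂ) 2,
      ‖g z - g a‖ ≤ C * ‖z - a‖ := by
  obtain ⟨C, hC0, hC⟩ := exists_norm_le_of_differentiableOn (hg.deriv Metric.isOpen_ball)
  refine ⟨C, hC0, fun z hz a ha => ?_⟩
  refine (convex_closedBall (0 : ℂ) 2).norm_image_sub_le_of_norm_deriv_le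
    (fun w hw => ?_) hC ha hz
  exact hg.differentiableAt (Metric.isOpen_ball.mem_nhds
    (Metric.closedBall_subset_ball (by norm_num) hw))

theorem exists_norm_sub_sub_le_of_differentiableOn {g : ℂ → ℂ}
    (hg : DifferentiableOn ℂ g (Metric.ball 0 3)) :
    ∃ C, 0 < C ∧ ∀ z ∈ Metric.closedBall (0 : ℂ) 2, ∀ a ∈ Metric.closedBall (0 : ℂ) 2,
      ‖g z - g a - (z - a) * deriv g a‖ ≤ C * ‖z - a‖ ^ 2 := by
  obtain ⟨C, hC0, hC⟩ := exists_norm_sub_le_of_differentiableOn (hg.deriv Metric.isOpen_ball)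
  refine ⟨C, hC0, fun z hz a ha => ?_⟩
  have hd : ∀ w ∈ segment ℝ a z, HasDerivAt (fun w => g w - w * deriv g a)
      (deriv g w - 1 * deriv g a) w := fun w hw => by
    have hw' : w ∈ Metric.closedBall (0 : ℂ) 2 :=
      (convex_closedBall (0 : ℂ) 2).segment_subset ha hz hw
    exact ((hg.differentiableAt (Metric.isOpen_ball.mem_nhds
      (Metric.closedBall_subset_ball (by norm_num) hw'))).hasDerivAt).sub
      ((hasDerivAt_id w).mul_const _)
  have := (convex_segment a z).norm_image_sub_le_of_norm_hasDerivWithin_le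
    (C := C * ‖z - a‖) (fun w hw => (hd w hw).hasDerivWithinAt) (fun w hw => ?_)
    (left_mem_segment ℝ a z) (right_mem_segment ℝ a z)
  · calc _ = ‖g z - z * deriv g a - (g a - a * deriv g a)‖ := by congr 1; ring
      _ ≤ _ := this
      _ = _ := by ring
  · have hw' : w ∈ Metric.closedBall (0 : ℂ) 2 :=
      (convex_closedBall (0 : ℂ) 2).segment_subset ha hz hw
    rw [one_mul]
    refine (hC w hw' a ha).trans (mul_le_mul_of_nonneg_left ?_ hC0.le)
    obtain ⟨s, hs, rfl⟩ := (segment_eq_image' ℝ a z ▸ hw)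
    simp only [add_sub_cancel_left, norm_smul, Real.norm_eq_abs, abs_of_nonneg hs.1]
    exact mul_le_of_le_one_left (norm_nonneg _) hs.2

theorem integrableOn_Ioi_horizontal {F : ℂ → ℂ} {a b C y : ℝ}
    (hc : ContinuousOn (fun s : ℝ => F (s + y * I)) (Set.Ici a))
    (hb : ∀ s ≥ b, ‖F (s + y * I)‖ ≤ C * Real.exp (-s / 2)) :
    IntegrableOn (fun s : ℝ => F (s + y * I)) (Set.Ioi a) := by
  refine (integrableOn_Ici_iff_integrableOn_Ioi (by finiteness)).mp <|
    (hc.locallyIntegrableOn measurableSet_Ici).integrableOn_of_isBigO_atTop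
    (g := fun s => Real.exp (-(1 / 2) * s)) ?_
    ⟨Set.Ioi b, Filter.Ioi_mem_atTop b, exp_neg_integrableOn_Ioi b (by norm_num)⟩
  refine Asymptotics.IsBigO.of_bound C ?_
  filter_upwards [Filter.eventually_ge_atTop b] with s hs
  rw [Real.norm_eq_abs, Real.abs_exp]
  convert hb s hs using 3
  ring

/-- Cauchy's theorem on a half-strip for an exponentially decaying function. -/
theorem integral_halfStrip {F : ℂ → ℂ} {a b y₀ y₁ C : ℝ} (hy : y₀ ≤ y₁)
    (hd : DifferentiableOn ℂ F (Set.Ici a ×ℂ Set.Icc y₀ y₁))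
    (hb : ∀ s ≥ b, ∀ y ∈ Set.Icc y₀ y₁, ‖F (s + y * I)‖ ≤ C * Real.exp (-s / 2)) :
    (∫ s : ℝ in Set.Ioi a, F (s + y₀ * I)) =
      I * (∫ y : ℝ in y₀..y₁, F (a + y * I)) + ∫ s : ℝ in Set.Ioi a, F (s + y₁ * I) := by
  have hcont : ∀ y ∈ Set.Icc y₀ y₁,
      ContinuousOn (fun s : ℝ => F (s + y * I)) (Set.Ici a) := fun y hy' => by
    refine hd.continuousOn.comp (by fun_prop) fun s hs => ?_
    simp [mem_reProdIm] at hs hy' ⊢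
    exact ⟨hs, hy'⟩
  have hlim : ∀ y ∈ Set.Icc y₀ y₁,
      Filter.Tendsto (fun L : ℝ => ∫ s in a..L, F (s + y * I)) Filter.atTop
        (nhds (∫ s : ℝ in Set.Ioi a, F (s + y * I))) := fun y hy' =>
    intervalIntegral_tendsto_integral_Ioi a
      (integrableOn_Ioi_horizontal (hcont y hy') fun s hs => hb s hs y hy') Filter.tendsto_id
  have hright : Filter.Tendsto (fun L : ℝ => ∫ y in y₀..y₁, F (L + y * I)) Filter.atTop
      (nhds 0) := by
    refine squeeze_zero_norm' (a := fun L => C * Real.exp (-L / 2) * |y₁ - y₀|) ?_ ?_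
    · filter_upwards [Filter.eventually_ge_atTop b] with L hL
      refine intervalIntegral.norm_integral_le_of_norm_le_const fun y hy' => ?_
      rw [Set.uIoc_of_le hy] at hy'
      exact hb L hL y ⟨hy'.1.le, hy'.2⟩
    · have : Filter.Tendsto (fun L : ℝ => Real.exp (-L / 2)) Filter.atTop (nhds 0) := by
        refine Real.tendsto_exp_atBot.comp ?_
        simp only [neg_div]
        exact Filter.tendsto_neg_atTop_atBot.comp (Filter.tendsto_id.atTop_div_const (by norm_num))
      simpa using (this.const_mul C).mul_const |y₁ - y₀|
  have hrect : ∀ᶠ L : ℝ in Filter.atTop, (∫ s in a..L, F (s + y₀ * I)) =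
      I * (∫ y : ℝ in y₀..y₁, F (a + y * I)) + (∫ s in a..L, F (s + y₁ * I))
        - I * ∫ y in y₀..y₁, F (L + y * I) := by
    filter_upwards [Filter.eventually_ge_atTop a] with L hL
    have := Complex.integral_boundary_rect_eq_zero_of_differentiableOn F ⟨a, y₀⟩ ⟨L, y₁⟩
      (hd.mono ?_)
    · simp only [smul_eq_mul] at this
      linear_combination this
    · intro z hz
      simp only [mem_reProdIm, Set.uIcc_of_le hL, Set.uIcc_of_le hy] at hz ⊢
      exact ⟨hz.1.1, hz.2⟩
  have h0 := hlim y₀ ⟨le_rfl, hy⟩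
  have h1 := (((hlim y₁ ⟨hy, le_rfl⟩).const_add
    (I * (∫ y : ℝ in y₀..y₁, F (a + y * I)))).sub (hright.const_mul I))
  rw [mul_zero, sub_zero] at h1
  exact tendsto_nhds_unique h0 (h1.congr' (hrect.mono fun L hL => hL.symm))

/-- The entire function `sinh z / z`. -/
noncomputable def sinhc : ℂ → ℂ := dslope Complex.sinh 0

theorem sinhc_zero : sinhc 0 = 1 := by
  simp [sinhc, dslope_same, Complex.deriv_sinh]

theorem sinhc_of_ne {z : ℂ} (hz : z ≠ 0) : sinhc z = Complex.sinh z / z := by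
  simp [sinhc, dslope_of_ne _ hz, slope_def_field]

theorem differentiable_sinhc : Differentiable ℂ sinhc := by
  have := (Complex.differentiableOn_dslope (c := (0 : ℂ)) (s := Set.univ)
    Filter.univ_mem (f := Complex.sinh)).2 Complex.differentiable_sinh.differentiableOn
  exact differentiableOn_univ.1 this

theorem sinh_re_im (s y : ℝ) : Complex.sinh (s + y * I) =
    (Real.sinh s * Real.cos y : ℝ) + (Real.cosh s * Real.sin y : ℝ) * I := by
  rw [Complex.sinh_add, Complex.cosh_mul_I, Complex.sinh_mul_I]
  push_cast
  ring

theorem cosh_re_im (s y : ℝ) : Complex.cosh (s + y * I) =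
    (Real.cosh s * Real.cos y : ℝ) + (Real.sinh s * Real.sin y : ℝ) * I := by
  rw [Complex.cosh_add, Complex.cosh_mul_I, Complex.sinh_mul_I]
  push_cast
  ring

theorem norm_sinh_sq (s y : ℝ) :
    ‖Complex.sinh (s + y * I)‖ ^ 2 = Real.sinh s ^ 2 + Real.sin y ^ 2 := by
  rw [sinh_re_im, Complex.sq_norm, Complex.normSq_add_mul_I]
  nlinarith [Real.sin_sq_add_cos_sq y, Real.cosh_sq s]

theorem norm_cosh_sq (s y : ℝ) :
    ‖Complex.cosh (s + y * I)‖ ^ 2 = Real.cosh s ^ 2 - Real.sin y ^ 2 := by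
  rw [cosh_re_im, Complex.sq_norm, Complex.normSq_add_mul_I]
  nlinarith [Real.sin_sq_add_cos_sq y, Real.cosh_sq s]

theorem sinhc_ne_zero_of_re_ne_zero {z : ℂ} (hz : z.re ≠ 0) : sinhc z ≠ 0 := by
  have hz0 : z ≠ 0 := fun h => hz (by simp [h])
  rw [sinhc_of_ne hz0]
  refine div_ne_zero (fun h => ?_) hz0
  have := norm_sinh_sq z.re z.im
  rw [Complex.re_add_im, h] at this
  have h1 : Real.sinh z.re ≠ 0 := fun h => hz (Real.sinh_eq_zero.1 h)
  have : 0 < Real.sinh z.re ^ 2 := by positivity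
  simp at *
  nlinarith [sq_nonneg (Real.sin z.im)]

theorem sinhc_ne_zero_of_im_mem {z : ℂ} (hz : z.im ∈ Set.Ioo (-π) π) : sinhc z ≠ 0 := by
  by_cases hre : z.re = 0
  · by_cases h0 : z.im = 0
    · rw [Complex.ext (z := z) (w := 0) hre h0, sinhc_zero]
      exact one_ne_zero
    · have hz0 : z ≠ 0 := fun h => by simp [h] at h0
      rw [sinhc_of_ne hz0]
      refine div_ne_zero (fun h => ?_) hz0
      have := norm_sinh_sq z.re z.im
      rw [Complex.re_add_im, h, hre] at this
      have hs := (Real.sin_eq_zero_iff_of_lt_of_lt hz.1 hz.2).not.2 h0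
      have : 0 < Real.sin z.im ^ 2 := by positivity
      simp_all
  · exact sinhc_ne_zero_of_re_ne_zero hre

/-- The amplitude of the heat kernel integrand. -/
noncomputable def amplitude (n k₁ k₂ : ℕ) (z : ℂ) : ℂ :=
  z ^ k₂ * Complex.cosh z ^ k₁ / sinhc z ^ (n + k₁)

/-- The holomorphic extension of the heat kernel integrand, normalised so that its values at `z`
and `-conj z` are conjugate. -/
noncomputable def integrand (n k₁ k₂ : ℕ) (R t : ℝ) (z : ℂ) : ℂ :=
  I ^ k₂ * (Complex.exp (I * z * t - R * (Complex.cosh z / sinhc z)) * amplitude n k₁ k₂ z)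

theorem differentiableAt_amplitude (n k₁ k₂ : ℕ) {z : ℂ} (hz : sinhc z ≠ 0) :
    DifferentiableAt ℂ (amplitude n k₁ k₂) z := by
  have h := differentiable_sinhc z
  have hc := Complex.differentiable_cosh z
  have h' : DifferentiableAt ℂ (fun z => z) z := differentiableAt_id
  exact ((h'.pow k₂).mul (hc.pow k₁)).div (h.pow _) (pow_ne_zero _ hz)

theorem differentiableAt_integrand (n k₁ k₂ : ℕ) (R t : ℝ) {z : ℂ} (hz : sinhc z ≠ 0) :
    DifferentiableAt ℂ (integrand n k₁ k₂ R t) z := by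
  have h := differentiable_sinhc z
  have hc := Complex.differentiable_cosh z
  have h1 : DifferentiableAt ℂ (fun z => I * z * t - R * (Complex.cosh z / sinhc z)) z :=
    (by fun_prop : DifferentiableAt ℂ (fun z => I * z * t) z).sub
      ((hc.div h hz).const_mul _)
  exact (h1.cexp.mul (differentiableAt_amplitude n k₁ k₂ hz)).const_mul _

theorem re_cosh_div_sinhc_nonneg {s y : ℝ} (h : 0 ≤ s * Real.sinh (2 * s) + y * Real.sin (2 * y)) :
    0 ≤ (Complex.cosh (s + y * I) / sinhc (s + y * I)).re := by
  by_cases h0 : (s + y * I : ℂ) = 0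
  · simp [h0, sinhc_zero]
  · rw [sinhc_of_ne h0, div_div_eq_mul_div, Complex.div_re, ← add_div]
    refine div_nonneg ?_ (Complex.normSq_nonneg _)
    rw [sinh_re_im, cosh_re_im]
    rw [Real.sinh_two_mul, Real.sin_two_mul] at h
    simp only [mul_re, mul_im, add_re, add_im, ofReal_re, ofReal_im, I_re, I_im, mul_zero, mul_one,
      zero_add, add_zero, sub_self]
    have h1 := Real.cosh_sq s
    have h2 := Real.sin_sq_add_cos_sq y
    have e : (Real.cosh s * Real.cos y * s - Real.sinh s * Real.sin y * y) *
        (Real.sinh s * Real.cos y) + (Real.cosh s * Real.cos y * y + Real.sinh s * Real.sin y * s) *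
        (Real.cosh s * Real.sin y) =
        s * (Real.sinh s * Real.cosh s) + y * (Real.sin y * Real.cos y) := by
      linear_combination (y * (Real.sin y * Real.cos y)) * h1 +
        (s * (Real.sinh s * Real.cosh s)) * h2
    nlinarith

theorem norm_integrand_le (n k₁ k₂ : ℕ) {R t s y : ℝ} (hR : 0 ≤ R)
    (h : 0 ≤ s * Real.sinh (2 * s) + y * Real.sin (2 * y)) :
    ‖integrand n k₁ k₂ R t (s + y * I)‖ ≤
      Real.exp (-(y * t)) * ‖amplitude n k₁ k₂ (s + y * I)‖ := by
  rw [integrand, norm_mul, norm_pow, norm_I, one_pow, one_mul, norm_mul, Complex.norm_exp]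
  refine mul_le_mul_of_nonneg_right (Real.exp_le_exp.2 ?_) (norm_nonneg _)
  have := mul_nonneg hR (re_cosh_div_sinhc_nonneg h)
  rw [sub_re, re_ofReal_mul]
  have e : (I * (s + y * I) * t : ℂ).re = -(y * t) := by simp
  rw [e]
  linarith

theorem exists_norm_amplitude_le {n : ℕ} (hn : 1 ≤ n) (k₁ k₂ : ℕ) :
    ∃ C, 0 < C ∧ ∀ s ≥ (2 : ℝ), ∀ y ∈ Set.Icc (0 : ℝ) (3 * π / 2),
      ‖amplitude n k₁ k₂ (s + y * I)‖ ≤ C * Real.exp (-s / 2) := by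
  set N := n + k₁ + k₂ with hN
  refine ⟨N.factorial * 2 ^ N * Real.exp (5 / 2) * 2 ^ k₁ * 4, by positivity, ?_⟩
  rintro s hs y ⟨hy0, hy1⟩
  have hpi := Real.pi_lt_d2
  set z : ℂ := s + y * I with hz
  have hz0 : z ≠ 0 := fun h => by
    have := congrArg Complex.re h
    simp [hz] at this
    linarith
  have hzn : ‖z‖ ≤ s + 5 := by
    refine (norm_add_le _ _).trans ?_
    simp [abs_of_nonneg hy0, abs_of_nonneg (by linarith : 0 ≤ s)]
    linarith
  have hsp : 0 < Real.sinh s := Real.sinh_pos_iff.2 (by linarith)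
  have hS : Real.sinh s ≤ ‖Complex.sinh z‖ := by
    refine le_of_sq_le_sq ?_ (norm_nonneg _)
    rw [hz, norm_sinh_sq]; nlinarith [sq_nonneg (Real.sin y)]
  have hC : ‖Complex.cosh z‖ ≤ Real.cosh s := by
    refine le_of_sq_le_sq ?_ (Real.cosh_pos s).le
    rw [hz, norm_cosh_sq]; nlinarith [sq_nonneg (Real.sin y)]
  have he1 : 3 ≤ Real.exp s := by linarith [Real.add_one_le_exp s]
  have he2 : Real.exp (-s) ≤ 1 / 3 := by
    rw [Real.exp_neg, ← one_div]; exact one_div_le_one_div_of_le (by norm_num) he1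
  have hCS : Real.cosh s ≤ 2 * Real.sinh s := by
    rw [Real.cosh_eq, Real.sinh_eq]; linarith
  have hSe : Real.exp s / 4 ≤ Real.sinh s := by
    rw [Real.sinh_eq]; linarith
  have hS1 : 1 ≤ Real.sinh s := by
    rw [Real.sinh_eq]; linarith
  have hpow : ‖z‖ ^ N ≤ N.factorial * 2 ^ N * Real.exp (5 / 2) * Real.exp (s / 2) := by
    have h1 := Real.pow_div_factorial_le_exp ((s + 5) / 2) (by linarith) N
    rw [div_le_iff₀ (by positivity)] at h1
    calc ‖z‖ ^ N ≤ (s + 5) ^ N := pow_le_pow_left₀ (norm_nonneg _) hzn _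
      _ = ((s + 5) / 2) ^ N * 2 ^ N := by rw [← mul_pow]; congr 1; ring
      _ ≤ Real.exp ((s + 5) / 2) * N.factorial * 2 ^ N := by gcongr
      _ = _ := by
        rw [show (s + 5) / 2 = 5 / 2 + s / 2 by ring, Real.exp_add]; ring
  have hamp : amplitude n k₁ k₂ z =
      z ^ N * (Complex.cosh z / Complex.sinh z) ^ k₁ / Complex.sinh z ^ n := by
    have : Complex.sinh z ≠ 0 := fun h => by rw [h, norm_zero] at hS; linarith
    rw [amplitude, sinhc_of_ne hz0, hN, div_pow, div_pow, pow_add, pow_add, pow_add, pow_add]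
    field_simp
  rw [hamp, norm_div, norm_mul, norm_pow, norm_pow, norm_pow, norm_div]
  have hq : ‖Complex.cosh z‖ / ‖Complex.sinh z‖ ≤ 2 := by
    rw [div_le_iff₀ (by linarith)]; linarith
  have hden : Real.exp s / 4 ≤ ‖Complex.sinh z‖ ^ n :=
    hSe.trans (hS.trans (le_self_pow₀ (hS1.trans hS) (by omega)))
  calc _ ≤ (N.factorial * 2 ^ N * Real.exp (5 / 2) * Real.exp (s / 2)) * 2 ^ k₁ /
        (Real.exp s / 4) := by gcongr
    _ = _ := by
      have : Real.exp s = Real.exp (s / 2) * Real.exp (s / 2) := by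
        rw [← Real.exp_add]; congr 1; ring
      rw [this, neg_div, Real.exp_neg]
      field_simp

theorem two_mul_sinh_add_nonneg {s y : ℝ} (hs : 2 ≤ s) (hy : y ∈ Set.Icc (0 : ℝ) (3 * π / 2)) :
    0 ≤ s * Real.sinh (2 * s) + y * Real.sin (2 * y) := by
  have hpi := Real.pi_lt_d2
  have h1 : 2 * s ≤ Real.sinh (2 * s) := Real.self_le_sinh_iff.2 (by linarith)
  have h2 : -y ≤ y * Real.sin (2 * y) := by
    nlinarith [hy.1, Real.neg_one_le_sin (2 * y)]
  nlinarith [hy.2]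

theorem exists_norm_integrand_le {n : ℕ} (hn : 1 ≤ n) (k₁ k₂ : ℕ) {R t : ℝ} (hR : 0 ≤ R)
    (ht : 0 ≤ t) :
    ∃ C, ∀ s ≥ (2 : ℝ), ∀ y ∈ Set.Icc (0 : ℝ) (3 * π / 2),
      ‖integrand n k₁ k₂ R t (s + y * I)‖ ≤ C * Real.exp (-s / 2) := by
  obtain ⟨C, -, hC⟩ := exists_norm_amplitude_le hn k₁ k₂
  refine ⟨C, fun s hs y hy => ?_⟩
  refine (norm_integrand_le n k₁ k₂ hR (two_mul_sinh_add_nonneg hs hy)).trans ?_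
  refine (mul_le_of_le_one_left (norm_nonneg _) ?_).trans (hC s hs y hy)
  exact Real.exp_le_one_iff.2 (neg_nonpos.2 (mul_nonneg hy.1 ht))

theorem sinhc_neg_conj (z : ℂ) :
    sinhc (-(starRingEnd ℂ z)) = starRingEnd ℂ (sinhc z) := by
  by_cases hz : z = 0
  · simp [hz, sinhc_zero]
  · rw [sinhc_of_ne hz, sinhc_of_ne (by simpa using hz)]
    simp [Complex.sinh_conj]

theorem integrand_neg_conj (n k₁ k₂ : ℕ) (R t : ℝ) (z : ℂ) :
    integrand n k₁ k₂ R t (-(starRingEnd ℂ z)) =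
      starRingEnd ℂ (integrand n k₁ k₂ R t z) := by
  simp only [integrand, amplitude, sinhc_neg_conj, Complex.cosh_neg, Complex.cosh_conj, map_mul,
    map_pow, map_div₀, Complex.conj_I, ← Complex.exp_conj, map_sub, Complex.conj_ofReal]
  rw [neg_pow I, neg_pow (starRingEnd ℂ z)]
  ring_nf

theorem continuous_integrand_ofReal (n k₁ k₂ : ℕ) (R t : ℝ) :
    Continuous fun s : ℝ => integrand n k₁ k₂ R t s := by
  refine continuous_iff_continuousAt.2 fun s => ?_
  have h : sinhc (s : ℂ) ≠ 0 := sinhc_ne_zero_of_im_mem (by simp [Real.pi_pos])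
  exact (differentiableAt_integrand n k₁ k₂ R t h).continuousAt.comp
    (f := fun s : ℝ => (s : ℂ)) Complex.continuous_ofReal.continuousAt

theorem integral_integrand_eq {n : ℕ} (hn : 1 ≤ n) (k₁ k₂ : ℕ) {R t : ℝ} (hR : 0 ≤ R)
    (ht : 0 ≤ t) :
    ∫ s : ℝ, integrand n k₁ k₂ R t s =
      ((2 * (∫ s : ℝ in Set.Ioi 0, integrand n k₁ k₂ R t s).re : ℝ) : ℂ) := by
  obtain ⟨C, hC⟩ := exists_norm_integrand_le hn k₁ k₂ hR ht
  have hneg : ∀ s : ℝ, integrand n k₁ k₂ R t (-s : ℝ) =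
      starRingEnd ℂ (integrand n k₁ k₂ R t s) := fun s => by
    rw [← integrand_neg_conj]; simp
  have hIoi : IntegrableOn (fun s : ℝ => integrand n k₁ k₂ R t s) (Set.Ioi 0) := by
    have := integrableOn_Ioi_horizontal (F := integrand n k₁ k₂ R t) (a := 0) (b := 2) (C := C)
      (y := 0) (by simpa using (continuous_integrand_ofReal n k₁ k₂ R t).continuousOn)
      (fun s hs => hC s hs 0 ⟨le_rfl, by positivity⟩)
    simpa using this
  have hIic : IntegrableOn (fun s : ℝ => integrand n k₁ k₂ R t s) (Set.Iic 0) := by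
    rw [← (Measure.measurePreserving_neg (volume : Measure ℝ)).integrableOn_comp_preimage
      (Homeomorph.neg ℝ).measurableEmbedding]
    have e : (Neg.neg ⁻¹' Set.Iic (0 : ℝ)) = Set.Ici 0 := by ext; simp
    rw [e]
    refine (integrableOn_Ici_iff_integrableOn_Ioi (by finiteness)).2 ?_
    refine IntegrableOn.congr_fun (f := fun s : ℝ => starRingEnd ℂ (integrand n k₁ k₂ R t s))
      (Complex.conjCLE.toContinuousLinearMap.integrable_comp hIoi) (fun s _ => (hneg s).symm)
      measurableSet_Ioi
  rw [← intervalIntegral.integral_Iic_add_Ioi hIic hIoi]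
  have : ∫ s : ℝ in Set.Iic 0, integrand n k₁ k₂ R t s =
      starRingEnd ℂ (∫ s : ℝ in Set.Ioi 0, integrand n k₁ k₂ R t s) := by
    rw [← integral_conj, ← neg_zero, ← integral_comp_neg_Ioi]
    simp only [neg_zero]
    exact setIntegral_congr_fun measurableSet_Ioi fun s _ => hneg s
  rw [this, add_comm, Complex.add_conj]

theorem pH_eq {n : ℕ} (hn : 1 ≤ n) (k₁ k₂ : ℕ) (x : EuclideanSpace ℝ (Fin (2 * n))) (t : ℝ) :
    pH n k₁ k₂ x t = ((2 * (-1) ^ k₁ / (4 * π) ^ (n + 1) *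
      (2 * (∫ s : ℝ in Set.Ioi 0, integrand n k₁ k₂ (‖x‖ ^ 2 / 4) |t| s).re) : ℝ) : ℂ) := by
  have h := integral_integrand_eq hn k₁ k₂ (R := ‖x‖ ^ 2 / 4) (by positivity) (abs_nonneg t)
  rw [Complex.ofReal_mul, ← h, pH]
  have : ∀ lam : ℝ, integrand n k₁ k₂ (‖x‖ ^ 2 / 4) |t| lam = I ^ k₂ *
      (if lam = 0 then (if k₂ = 0 then Complex.exp (-((‖x‖ ^ 2 / 4 : ℝ) : ℂ)) else 0)
      else
        Complex.exp (Complex.I * (lam : ℂ) * (|t| : ℝ)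
            - ((‖x‖ ^ 2 / 4 * lam * Real.cosh lam / Real.sinh lam : ℝ) : ℂ)) *
          ((lam : ℂ) ^ (n + k₁ + k₂) * ((Real.cosh lam : ℝ) : ℂ) ^ k₁
            / ((Real.sinh lam : ℝ) : ℂ) ^ (n + k₁))) := fun lam => by
    rw [integrand, amplitude]
    congr 1
    split_ifs with h0 hk
    · simp [h0, hk, sinhc_zero]
    · simp [h0, hk]
    · have h1 : (lam : ℂ) ≠ 0 := by exact_mod_cast h0
      have h2 : Complex.sinh lam ≠ 0 := by
        rw [← Complex.ofReal_sinh]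
        exact_mod_cast fun h => h0 (Real.sinh_eq_zero.1 h)
      rw [sinhc_of_ne h1]
      push_cast
      congr 1
      · congr 2
        field_simp
      · rw [div_pow, pow_add, pow_add, pow_add]
        field_simp
        ring
  simp_rw [this]
  rw [integral_const_mul]
  push_cast
  ring

theorem sinhc_I_mul {w : ℂ} (hw : w ≠ 0) : sinhc (I * w) = Complex.sin w / w := by
  rw [sinhc_of_ne (mul_ne_zero I_ne_zero hw), mul_comm I w, Complex.sinh_mul_I,
    mul_div_mul_right _ _ I_ne_zero]

theorem sinhc_I_mul_ne_zero {w : ℂ} (hw : w ∈ Metric.ball (0 : ℂ) 3) : sinhc (I * w) ≠ 0 := by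
  apply sinhc_ne_zero_of_im_mem
  have h1 : |w.re| < 3 := (Complex.abs_re_le_norm w).trans_lt (by simpa using hw)
  have h2 := abs_lt.1 h1
  have := Real.pi_gt_three
  simp only [mul_im, I_re, I_im, zero_mul, one_mul, zero_add]
  exact ⟨by linarith, by linarith⟩

theorem sin_ne_zero_of_mem_ball {w : ℂ} (hw : w ∈ Metric.ball (0 : ℂ) 3) (h0 : w ≠ 0) :
    Complex.sin w ≠ 0 := fun h => by
  have := sinhc_I_mul_ne_zero hw
  rw [sinhc_I_mul h0, h, zero_div] at this
  exact this rfl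

/-- The holomorphic function `w cot w`. -/
noncomputable def mulCot (w : ℂ) : ℂ := Complex.cos w / sinhc (I * w)

theorem mulCot_zero : mulCot 0 = 1 := by simp [mulCot, sinhc_zero]

theorem mulCot_of_ne {w : ℂ} (hw : w ≠ 0) : mulCot w = w * Complex.cos w / Complex.sin w := by
  rw [mulCot, sinhc_I_mul hw, div_div_eq_mul_div, mul_comm]

theorem differentiableOn_mulCot : DifferentiableOn ℂ mulCot (Metric.ball 0 3) := by
  refine Complex.differentiable_cos.differentiableOn.div
    (differentiable_sinhc.comp (by fun_prop)).differentiableOn fun w hw => sinhc_I_mul_ne_zero hw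

/-- The regular part at the origin of `(π - w) cot w`. -/
noncomputable def regPart (w : ℂ) : ℂ := π * dslope mulCot 0 w - mulCot w

theorem differentiableOn_regPart : DifferentiableOn ℂ regPart (Metric.ball 0 3) := by
  refine DifferentiableOn.sub (DifferentiableOn.const_mul ?_ _) differentiableOn_mulCot
  exact (Complex.differentiableOn_dslope (Metric.ball_mem_nhds _ (by norm_num))).2
    differentiableOn_mulCot

theorem pole_add_regPart {w : ℂ} (hw : w ∈ Metric.ball (0 : ℂ) 3) (h0 : w ≠ 0) :
    π / w + regPart w = (π - w) * Complex.cos w / Complex.sin w := by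
  have := sin_ne_zero_of_mem_ball hw h0
  rw [regPart, dslope_of_ne _ h0, slope_def_field, mulCot_zero, mulCot_of_ne h0]
  field_simp
  ring

theorem deriv_regPart {ε : ℝ} (h0 : 0 < ε) (h3 : ε < 3) :
    deriv regPart ε = ((π / ε ^ 2 -
      (Real.cos ε / Real.sin ε + (π - ε) / Real.sin ε ^ 2) : ℝ) : ℂ) := by
  have hball : (ε : ℂ) ∈ Metric.ball (0 : ℂ) 3 := by simpa [abs_of_pos h0] using h3
  have hne : (ε : ℂ) ≠ 0 := by exact_mod_cast h0.ne'
  have hs := sin_ne_zero_of_mem_ball hball hne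
  have hev : regPart =ᶠ[nhds (ε : ℂ)]
      fun w => (π - w) * Complex.cos w / Complex.sin w - π / w := by
    filter_upwards [Metric.isOpen_ball.mem_nhds hball, isOpen_ne.mem_nhds hne] with w hw hw0
    rw [← pole_add_regPart hw hw0]
    ring
  have hd : HasDerivAt (fun w : ℂ => (π - w) * Complex.cos w / Complex.sin w - π / w)
      ((((0 - 1) * Complex.cos ε + (π - ε) * (-Complex.sin ε)) * Complex.sin ε
        - (π - ε) * Complex.cos ε * Complex.cos ε) / Complex.sin ε ^ 2
        - (0 * ε - π * 1) / (ε : ℂ) ^ 2) (ε : ℂ) :=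
    (((((hasDerivAt_const _ _).sub (hasDerivAt_id _)).mul (Complex.hasDerivAt_cos _)).div
      (Complex.hasDerivAt_sin _) hs)).sub ((hasDerivAt_const _ _).div (hasDerivAt_id _) hne)
  rw [hev.deriv_eq, hd.deriv]
  push_cast
  have := Complex.sin_sq_add_cos_sq ε
  field_simp
  linear_combination (-(π - ε) * ε ^ 2 : ℂ) * this

/-- The holomorphic factor of the integrand at its pole. -/
noncomputable def poleFactor (n k₁ k₂ : ℕ) (w : ℂ) : ℂ :=
  (π - w) ^ (n + k₁ + k₂) * Complex.cos w ^ k₁ / sinhc (I * w) ^ (n + k₁)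

theorem poleFactor_zero (n k₁ k₂ : ℕ) : poleFactor n k₁ k₂ 0 = π ^ (n + k₁ + k₂) := by
  simp [poleFactor, sinhc_zero]

theorem differentiableOn_poleFactor (n k₁ k₂ : ℕ) :
    DifferentiableOn ℂ (poleFactor n k₁ k₂) (Metric.ball 0 3) := by
  have h1 : Differentiable ℂ fun w : ℂ => (π - w) ^ (n + k₁ + k₂) * Complex.cos w ^ k₁ :=
    ((differentiable_const _).sub differentiable_id).pow _ |>.mul
      (Complex.differentiable_cos.pow _)
  exact h1.differentiableOn.div
    ((differentiable_sinhc.comp (by fun_prop)).pow _).differentiableOn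
    fun w hw => pow_ne_zero _ (sinhc_I_mul_ne_zero hw)

/-- The exponent of the integrand near its pole. -/
noncomputable def phase (R t : ℝ) (w : ℂ) : ℂ := -(π - w) * t + R * (π / w + regPart w)

theorem integrand_eq_phase (n k₁ k₂ : ℕ) (R t : ℝ) {w : ℂ} (hw : w ∈ Metric.ball (0 : ℂ) 3)
    (h0 : w ≠ 0) :
    integrand n k₁ k₂ R t (I * (π - w)) =
      (-1) ^ (k₁ + k₂) * (poleFactor n k₁ k₂ w / w ^ (n + k₁) * Complex.exp (phase R t w)) := by
  have hs := sin_ne_zero_of_mem_ball hw h0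
  have hpi : (π : ℂ) - w ≠ 0 := fun h => by
    have : ‖(π : ℂ)‖ < 3 := by rw [sub_eq_zero.1 h]; simpa using hw
    rw [Complex.norm_real, Real.norm_eq_abs, abs_of_pos Real.pi_pos] at this
    linarith [Real.pi_gt_three]
  have hcosh : Complex.cosh (I * (π - w)) = -Complex.cos w := by
    rw [mul_comm, Complex.cosh_mul_I, Complex.cos_pi_sub]
  have hsinh : sinhc (I * (π - w)) = Complex.sin w / (π - w) := by
    rw [sinhc_I_mul hpi, Complex.sin_pi_sub]
  rw [integrand, amplitude, hcosh, hsinh, phase, pole_add_regPart hw h0, poleFactor,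
    sinhc_I_mul h0]
  have e1 : I * (I * (π - w)) * t - R * (-Complex.cos w / (Complex.sin w / (π - w))) =
      -(π - w) * t + R * ((π - w) * Complex.cos w / Complex.sin w) := by
    rw [← mul_assoc, I_mul_I]
    field_simp
    ring
  rw [e1, mul_pow, neg_pow (Complex.cos w), div_pow, div_pow]
  have e2 : (I : ℂ) ^ k₂ * I ^ k₂ = (-1) ^ k₂ := by rw [← mul_pow, I_mul_I]
  rw [pow_add (-1 : ℂ), ← e2, pow_add _ (n + k₁) k₂]
  field_simp

theorem phase_sub_phase {R t ε : ℝ} (hε : 0 < ε)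
    (ht : (t : ℂ) = R * (π / ε ^ 2 - deriv regPart ε)) {w : ℂ} (hw : w ≠ 0) :
    phase R t w - phase R t ε = R * π * ((w - ε) ^ 2 / (ε ^ 2 * w)) +
      R * (regPart w - regPart ε - (w - ε) * deriv regPart ε) := by
  have hne : (ε : ℂ) ≠ 0 := by exact_mod_cast hε.ne'
  rw [phase, phase, ht]
  field_simp
  ring

theorem one_add_mul_I_ne_zero (u : ℝ) : (1 + u * I : ℂ) ≠ 0 := fun h => by
  have := congrArg Complex.re h
  simp at this

theorem one_le_norm_one_add_mul_I (u : ℝ) : 1 ≤ ‖(1 + u * I : ℂ)‖ := by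
  have := Complex.abs_re_le_norm (1 + u * I)
  simpa using this

theorem norm_inv_one_add_mul_I_le_one (u : ℝ) : ‖(1 + u * I : ℂ)⁻¹‖ ≤ 1 := by
  rw [norm_inv]
  exact inv_le_one_of_one_le₀ (one_le_norm_one_add_mul_I u)

theorem norm_one_sub_mul_I_le (m : ℕ) {u : ℝ} (hu : u ∈ Set.Icc (0 : ℝ) 1) :
    ‖(1 - m * u * I : ℂ)‖ ≤ 1 + m := by
  refine (norm_sub_le _ _).trans ?_
  simp only [norm_one, norm_mul, Complex.norm_natCast, norm_real, norm_I, mul_one,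
    Real.norm_eq_abs, abs_of_nonneg hu.1]
  gcongr
  exact mul_le_of_le_one_right (Nat.cast_nonneg m) hu.2

theorem norm_inv_pow_sub_le (m : ℕ) {u : ℝ} (hu : u ∈ Set.Icc (0 : ℝ) 1) :
    ‖(1 + u * I : ℂ)⁻¹ ^ m - (1 - m * u * I)‖ ≤ m ^ 2 * u ^ 2 := by
  set q : ℂ := (1 + u * I)⁻¹ with hq
  have hq1 : ‖q‖ ≤ 1 := norm_inv_one_add_mul_I_le_one u
  have hqe : q - (1 - u * I) = -u ^ 2 * q := by
    have := one_add_mul_I_ne_zero u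
    rw [hq]
    field_simp
    ring_nf
    simp
  induction m with
  | zero => simp
  | succ m ih =>
    have e : q ^ (m + 1) - (1 - (m + 1 : ℕ) * u * I) =
        (q ^ m - (1 - m * u * I)) * q + (1 - m * u * I) * (-u ^ 2 * q) - m * u ^ 2 := by
      rw [← hqe]
      push_cast
      ring_nf
      simp
    have h1 := norm_one_sub_mul_I_le m hu
    have h2 : ‖(-u ^ 2 * q : ℂ)‖ ≤ u ^ 2 := by
      rw [norm_mul, norm_neg, norm_pow, norm_real, Real.norm_eq_abs, sq_abs]
      exact mul_le_of_le_one_right (by positivity) hq1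
    rw [e]
    calc _ ≤ ‖(q ^ m - (1 - m * u * I)) * q‖ + ‖(1 - m * u * I) * (-u ^ 2 * q)‖
          + ‖(m * u ^ 2 : ℂ)‖ := (norm_sub_le _ _).trans (by gcongr; exact norm_add_le _ _)
      _ ≤ m ^ 2 * u ^ 2 * 1 + (1 + m) * u ^ 2 + m * u ^ 2 := by
        rw [norm_mul, norm_mul]
        gcongr
        simp
      _ = _ := by push_cast; ring

/-- The normalised integrand on the steepest descent segment. -/
noncomputable def saddleFn (m : ℕ) (μ u : ℝ) : ℂ :=
  (1 + u * I : ℂ)⁻¹ ^ m * Complex.exp (-(μ / 2) * u ^ 2 / (1 + u * I))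

theorem norm_saddleFn_le (m : ℕ) {μ u : ℝ} (hμ : 0 < μ) (hu : u ∈ Set.Icc (0 : ℝ) 1) :
    ‖saddleFn m μ u‖ ≤ Real.exp (-(μ * u ^ 2) / 4) := by
  rw [saddleFn, norm_mul, norm_pow, Complex.norm_exp]
  refine (mul_le_of_le_one_left (Real.exp_pos _).le
    (pow_le_one₀ (norm_nonneg _) (norm_inv_one_add_mul_I_le_one u))).trans ?_
  rw [Real.exp_le_exp]
  have e : (-(μ / 2) * u ^ 2 / (1 + u * I) : ℂ).re = -(μ * u ^ 2 / 2) / (1 + u ^ 2) := by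
    have : (-(μ / 2) * u ^ 2 / (1 + u * I) : ℂ) = ((-(μ * u ^ 2 / 2) : ℝ) : ℂ) / (1 + u * I) := by
      push_cast; ring
    rw [this, Complex.div_re]
    generalize -(μ * u ^ 2 / 2) = A
    simp [Complex.normSq_apply]
    ring
  rw [e, neg_div, neg_div, neg_le_neg_iff, le_div_iff₀ (by positivity)]
  have : u ^ 2 ≤ 1 := pow_le_one₀ hu.1 hu.2
  nlinarith [mul_nonneg hμ.le (sq_nonneg u)]

theorem abs_re_saddleFn_sub_le (m : ℕ) {μ u : ℝ} (hμ : 0 < μ) (hu : u ∈ Set.Icc (0 : ℝ) 1) :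
    |(saddleFn m μ u).re - Real.exp (-(μ * u ^ 2) / 2)| ≤
      256 * (1 + m) ^ 2 * (u ^ 2 * Real.exp (-(μ * u ^ 2) / 16)) := by
  set v := μ * u ^ 2 with hv
  have hv0 : 0 ≤ v := by positivity
  set p : ℂ := (1 + u * I)⁻¹ ^ m with hp
  set z : ℂ := (μ / 2) * u ^ 3 * I / (1 + u * I) with hz
  have hne := one_add_mul_I_ne_zero u
  have e1 : saddleFn m μ u = (Real.exp (-v / 2) : ℝ) * (p * Complex.exp z) := by
    rw [saddleFn, ← hp, Complex.ofReal_exp, mul_left_comm, ← Complex.exp_add]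
    congr 2
    rw [hz, hv]
    push_cast
    field_simp
    ring
  have hz1 : ‖z‖ ≤ v * u / 2 := by
    rw [hz, norm_div]
    refine (div_le_self (norm_nonneg _) (one_le_norm_one_add_mul_I u)).trans (le_of_eq ?_)
    simp [abs_of_pos hμ, abs_of_nonneg hu.1]
    rw [hv]; ring
  have hz2 : ‖z‖ ≤ 3 / 8 * v := by
    have h4 : u * (4 / 3) ≤ ‖(1 + u * I : ℂ)‖ := by
      refine le_of_sq_le_sq ?_ (norm_nonneg _)
      have h0 := Complex.normSq_add_mul_I 1 u
      rw [Complex.ofReal_one, ← Complex.sq_norm] at h0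
      have : u ^ 2 ≤ 1 := pow_le_one₀ hu.1 hu.2
      nlinarith
    rw [hz, norm_div, div_le_iff₀ (by linarith [one_le_norm_one_add_mul_I u])]
    simp [abs_of_pos hμ, abs_of_nonneg hu.1]
    calc μ / 2 * u ^ 3 = 3 / 8 * v * (u * (4 / 3)) := by rw [hv]; ring
      _ ≤ _ := by gcongr
  set b : ℂ := Complex.exp z - (1 + (μ * u ^ 3 / 2 : ℝ) * I) with hb
  have hbn : ‖b‖ ≤ u ^ 2 * (v / 2 + v ^ 2 / 4) * Real.exp (3 / 8 * v) := by
    have h1 := Complex.norm_exp_sub_sum_le_norm_mul_exp z 2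
    simp [Finset.sum_range_succ] at h1
    have e : b = (Complex.exp z - (1 + z)) + (μ / 2) * u ^ 4 / (1 + u * I) := by
      rw [hb, hz]
      push_cast
      field_simp
      ring_nf
      simp
    have h2 : ‖((μ / 2) * u ^ 4 / (1 + u * I) : ℂ)‖ ≤ u ^ 2 * (v / 2) := by
      rw [norm_div]
      refine (div_le_self (norm_nonneg _) (one_le_norm_one_add_mul_I u)).trans (le_of_eq ?_)
      simp [abs_of_pos hμ, abs_of_nonneg hu.1]
      rw [hv]; ring
    rw [e]
    calc _ ≤ ‖z‖ ^ 2 * Real.exp ‖z‖ + u ^ 2 * (v / 2) := (norm_add_le _ _).trans (add_le_add h1 h2)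
      _ ≤ (v * u / 2) ^ 2 * Real.exp (3 / 8 * v) + u ^ 2 * (v / 2) * Real.exp (3 / 8 * v) := by
        have := le_mul_of_one_le_right (by positivity : 0 ≤ u ^ 2 * (v / 2))
          (Real.one_le_exp (by positivity : 0 ≤ 3 / 8 * v))
        gcongr
      _ = _ := by ring
  have hkey : |(p * Complex.exp z).re - 1| ≤
      256 * (1 + m) ^ 2 * (u ^ 2 * Real.exp (7 / 16 * v)) := by
    have e : p * Complex.exp z - ((1 + m * v * u ^ 2 / 2 : ℝ) + (μ * u ^ 3 / 2 - m * u : ℝ) * I) =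
        (1 - m * u * I) * b + (p - (1 - m * u * I)) * Complex.exp z := by
      rw [hb, hv]
      push_cast
      ring_nf
      simp
      ring
    have h1 := norm_one_sub_mul_I_le m hu
    have h2 : ‖Complex.exp z‖ ≤ Real.exp (3 / 8 * v) :=
      (Complex.norm_exp_le_exp_norm z).trans (Real.exp_le_exp.2 hz2)
    have h3 := norm_inv_pow_sub_le m hu
    have h4 : |(p * Complex.exp z).re - (1 + m * v * u ^ 2 / 2)| ≤
        (1 + m) * (u ^ 2 * (v / 2 + v ^ 2 / 4) * Real.exp (3 / 8 * v)) +
          m ^ 2 * u ^ 2 * Real.exp (3 / 8 * v) := by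
      have h5 := Complex.abs_re_le_norm
        (p * Complex.exp z - ((1 + m * v * u ^ 2 / 2 : ℝ) + (μ * u ^ 3 / 2 - m * u : ℝ) * I))
      have h6 : (p * Complex.exp z -
          ((1 + m * v * u ^ 2 / 2 : ℝ) + (μ * u ^ 3 / 2 - m * u : ℝ) * I)).re =
          (p * Complex.exp z).re - (1 + m * v * u ^ 2 / 2) := by
        rw [sub_re, add_re, re_ofReal_mul, ofReal_re, I_re, mul_zero, add_zero]
      rw [h6, e] at h5
      refine h5.trans ((norm_add_le _ _).trans ?_)
      rw [norm_mul, norm_mul]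
      gcongr
    have hE := Real.one_le_exp (by positivity : 0 ≤ 3 / 8 * v)
    have h7 : |m * v * u ^ 2 / 2| ≤ m * v * u ^ 2 / 2 * Real.exp (3 / 8 * v) := by
      rw [abs_of_nonneg (by positivity)]
      exact le_mul_of_one_le_right (by positivity) hE
    have h8 : (1 + v / 2) ^ 2 ≤ 256 * Real.exp (1 / 16 * v) := by
      have : 1 + v / 2 ≤ 16 * Real.exp (1 / 32 * v) := by
        linarith [Real.add_one_le_exp (1 / 32 * v)]
      calc (1 + v / 2) ^ 2 ≤ (16 * Real.exp (1 / 32 * v)) ^ 2 := by gcongr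
        _ = _ := by rw [mul_pow, ← Real.exp_nat_mul]; norm_num; ring_nf
    calc |(p * Complex.exp z).re - 1| =
          |((p * Complex.exp z).re - (1 + m * v * u ^ 2 / 2)) + m * v * u ^ 2 / 2| := by
          congr 1; ring
      _ ≤ _ := (abs_add_le _ _).trans (add_le_add h4 h7)
      _ = u ^ 2 * Real.exp (3 / 8 * v) *
          ((1 + m) * (v / 2 + v ^ 2 / 4) + m ^ 2 + m * v / 2) := by ring
      _ ≤ u ^ 2 * Real.exp (3 / 8 * v) * ((1 + m) ^ 2 * (1 + v / 2) ^ 2) := by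
        gcongr
        have hm : (0 : ℝ) ≤ m := by positivity
        nlinarith [mul_nonneg hm hv0, mul_nonneg (mul_nonneg hm hm) hv0,
          mul_nonneg (mul_nonneg hm hm) (sq_nonneg v), mul_nonneg hm (sq_nonneg v)]
      _ ≤ u ^ 2 * Real.exp (3 / 8 * v) * ((1 + m) ^ 2 * (256 * Real.exp (1 / 16 * v))) := by gcongr
      _ = _ := by
        rw [show 7 / 16 * v = 3 / 8 * v + 1 / 16 * v by ring, Real.exp_add]; ring
  rw [e1, re_ofReal_mul]
  calc _ = Real.exp (-v / 2) * |(p * Complex.exp z).re - 1| := by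
        rw [← abs_of_pos (Real.exp_pos (-v / 2)), ← abs_mul, abs_of_pos (Real.exp_pos (-v / 2))]
        congr 1
        ring
    _ ≤ Real.exp (-v / 2) * (256 * (1 + m) ^ 2 * (u ^ 2 * Real.exp (7 / 16 * v))) := by gcongr
    _ = _ := by
      rw [show -v / 16 = -v / 2 + 7 / 16 * v by ring, Real.exp_add]; ring

theorem norm_perturbed_saddleFn_sub_le (m : ℕ) {μ u ε b c : ℝ} {β ζ : ℂ} (hμ : 0 < μ)
    (hu : u ∈ Set.Icc (0 : ℝ) 1) (hβ : ‖β‖ ≤ b * ε) (hζ : ‖ζ‖ ≤ c * ε * (μ * u ^ 2))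
    (hc : 0 ≤ c * ε) (hcε : c * ε ≤ 1 / 16) :
    ‖(1 + β) * (saddleFn m μ u * Complex.exp ζ) - saddleFn m μ u‖ ≤
      (b + 8 * c) * ε * Real.exp (-(μ * u ^ 2) / 16) := by
  set v := μ * u ^ 2 with hv
  have hv0 : 0 ≤ v := by positivity
  have hs := norm_saddleFn_le m hμ hu
  have hζ' : ‖ζ‖ ≤ 1 / 16 * v := hζ.trans (by gcongr)
  have h1 : ‖Complex.exp ζ‖ ≤ Real.exp (1 / 16 * v) :=
    (Complex.norm_exp_le_exp_norm ζ).trans (Real.exp_le_exp.2 hζ')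
  have h2 : ‖Complex.exp ζ - 1‖ ≤ c * ε * v * Real.exp (1 / 16 * v) := by
    have := Complex.norm_exp_sub_sum_le_norm_mul_exp ζ 1
    simp at this
    exact this.trans (by gcongr)
  have h3 : v ≤ 8 * Real.exp (1 / 8 * v) := by linarith [Real.add_one_le_exp (1 / 8 * v)]
  have hb : 0 ≤ b * ε := (norm_nonneg _).trans hβ
  calc _ = ‖saddleFn m μ u * (β * Complex.exp ζ + (Complex.exp ζ - 1))‖ := by congr 1; ring
    _ ≤ Real.exp (-v / 4) * (b * ε * Real.exp (1 / 16 * v) +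
          c * ε * v * Real.exp (1 / 16 * v)) := by
      rw [norm_mul]
      gcongr
      refine (norm_add_le _ _).trans ?_
      rw [norm_mul]
      gcongr
    _ ≤ Real.exp (-v / 4) * (b * ε * Real.exp (1 / 16 * v + 1 / 8 * v) +
          c * ε * (8 * Real.exp (1 / 8 * v)) * Real.exp (1 / 16 * v)) := by
      gcongr
      linarith
    _ = (b + 8 * c) * ε * (Real.exp (-v / 4) * Real.exp (1 / 16 * v) * Real.exp (1 / 8 * v)) := by
      rw [Real.exp_add]; ring
    _ = _ := by
      rw [← Real.exp_add, ← Real.exp_add]; congr 2; ring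

theorem sq_mul_exp_le {μ : ℝ} (hμ : 0 < μ) (u : ℝ) :
    u ^ 2 * Real.exp (-(μ * u ^ 2) / 16) ≤ 32 / μ * Real.exp (-(μ / 32) * u ^ 2) := by
  have h : u ^ 2 ≤ 32 / μ * Real.exp (μ / 32 * u ^ 2) := by
    have := Real.add_one_le_exp (μ / 32 * u ^ 2)
    calc u ^ 2 = 32 / μ * (μ / 32 * u ^ 2) := by field_simp
      _ ≤ _ := by gcongr; linarith
  calc _ ≤ 32 / μ * Real.exp (μ / 32 * u ^ 2) * Real.exp (-(μ * u ^ 2) / 16) := by gcongr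
    _ = _ := by rw [mul_assoc, ← Real.exp_add]; congr 2; ring

theorem abs_re_integral_sub_gaussian_le {ψ : ℝ → ℂ} {μ ε C : ℝ} (hμ : 0 < μ) (hε : 0 < ε)
    (hC : 1 ≤ C) (hψ : ContinuousOn ψ (Set.Icc 0 1))
    (hb : ∀ u ∈ Set.Icc (0 : ℝ) 1, |(ψ u).re - Real.exp (-(μ * u ^ 2) / 2)| ≤
      C * ((u ^ 2 + ε) * Real.exp (-(μ * u ^ 2) / 16))) :
    |(∫ u in (0 : ℝ)..1, ψ u).re - √(2 * π / μ) / 2| ≤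
      C * (32 / μ + ε) * (√(32 * π / μ) / 2) := by
  set g : ℝ → ℝ := fun u => C * (32 / μ + ε) * Real.exp (-(μ / 32) * u ^ 2) with hg
  have hgi : Integrable g := (integrable_exp_neg_mul_sq (by positivity)).const_mul _
  have hGi : Integrable fun u : ℝ => Real.exp (-(μ / 2) * u ^ 2) :=
    integrable_exp_neg_mul_sq (by positivity)
  have hψi : IntegrableOn ψ (Set.Ioc 0 1) :=
    (hψ.integrableOn_Icc).mono_set Set.Ioc_subset_Icc_self
  have hge : ∀ u, (u ^ 2 + ε) * Real.exp (-(μ * u ^ 2) / 16) ≤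
      (32 / μ + ε) * Real.exp (-(μ / 32) * u ^ 2) := fun u => by
    have h1 := sq_mul_exp_le hμ u
    have h2 : Real.exp (-(μ * u ^ 2) / 16) ≤ Real.exp (-(μ / 32) * u ^ 2) :=
      Real.exp_le_exp.2 (by nlinarith [mul_nonneg hμ.le (sq_nonneg u)])
    nlinarith
  have e1 : (∫ u in (0 : ℝ)..1, ψ u).re = ∫ u in Set.Ioc (0 : ℝ) 1, (ψ u).re := by
    rw [intervalIntegral.integral_of_le zero_le_one]
    exact (integral_re hψi).symm
  have split : ∀ f : ℝ → ℝ, Integrable f → ∫ u in Set.Ioi (0 : ℝ), f u =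
      (∫ u in Set.Ioc (0 : ℝ) 1, f u) + ∫ u in Set.Ioi (1 : ℝ), f u := fun f hf => by
    rw [← setIntegral_union (Set.Ioc_disjoint_Ioi le_rfl) measurableSet_Ioi hf.integrableOn
      hf.integrableOn, Set.Ioc_union_Ioi_eq_Ioi zero_le_one]
  have e2 : √(2 * π / μ) / 2 = (∫ u in Set.Ioc (0 : ℝ) 1, Real.exp (-(μ / 2) * u ^ 2)) +
      ∫ u in Set.Ioi (1 : ℝ), Real.exp (-(μ / 2) * u ^ 2) := by
    rw [← split _ hGi, integral_gaussian_Ioi]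
    congr 2
    field_simp
  have e3 : C * (32 / μ + ε) * (√(32 * π / μ) / 2) = (∫ u in Set.Ioc (0 : ℝ) 1, g u) +
      ∫ u in Set.Ioi (1 : ℝ), g u := by
    rw [← split _ hgi, hg, integral_const_mul, integral_gaussian_Ioi]
    congr 3
    field_simp
  have h1 : |∫ u in Set.Ioc (0 : ℝ) 1, ((ψ u).re - Real.exp (-(μ / 2) * u ^ 2))| ≤
      ∫ u in Set.Ioc (0 : ℝ) 1, g u := by
    rw [← Real.norm_eq_abs]
    refine norm_integral_le_of_norm_le hgi.integrableOn ?_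
    refine (ae_restrict_mem measurableSet_Ioc).mono fun u hu => ?_
    have := hb u ⟨hu.1.le, hu.2⟩
    rw [show -(μ * u ^ 2) / 2 = -(μ / 2) * u ^ 2 by ring] at this
    rw [Real.norm_eq_abs]
    refine this.trans ?_
    rw [hg]
    have := mul_le_mul_of_nonneg_left (hge u) (by linarith : 0 ≤ C)
    linarith
  have h2 : ∫ u in Set.Ioi (1 : ℝ), Real.exp (-(μ / 2) * u ^ 2) ≤
      ∫ u in Set.Ioi (1 : ℝ), g u := by
    refine setIntegral_mono_on hGi.integrableOn hgi.integrableOn measurableSet_Ioi fun u hu => ?_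
    have hu1 : 1 < u := hu
    have h3 : Real.exp (-(μ / 2) * u ^ 2) ≤ Real.exp (-(μ * u ^ 2) / 16) :=
      Real.exp_le_exp.2 (by nlinarith [mul_nonneg hμ.le (sq_nonneg u)])
    have h4 : (1 : ℝ) ≤ u ^ 2 + ε := by nlinarith
    have h5 : Real.exp (-(μ * u ^ 2) / 16) ≤ (u ^ 2 + ε) * Real.exp (-(μ * u ^ 2) / 16) :=
      le_mul_of_one_le_left (Real.exp_pos _).le h4
    refine h3.trans (h5.trans ((hge u).trans ?_))
    rw [hg]
    simp only [mul_assoc]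
    exact le_mul_of_one_le_left (by positivity) hC
  have h0 : 0 ≤ ∫ u in Set.Ioi (1 : ℝ), Real.exp (-(μ / 2) * u ^ 2) :=
    setIntegral_nonneg measurableSet_Ioi fun u _ => (Real.exp_pos _).le
  have hψre : IntegrableOn (fun u => (ψ u).re) (Set.Ioc 0 1) := hψi.re
  rw [integral_sub hψre hGi.integrableOn] at h1
  rw [e1, e2, e3]
  rw [abs_le] at h1 ⊢
  constructor <;> linarith [h1.1, h1.2]

theorem sinhc_ne_zero_of_sin_im_ne_zero {z : ℂ} (hz : Real.sin z.im ≠ 0) : sinhc z ≠ 0 := by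
  have hz0 : z ≠ 0 := fun h => by simp [h] at hz
  rw [sinhc_of_ne hz0]
  refine div_ne_zero (fun h => ?_) hz0
  have h1 := norm_sinh_sq z.re z.im
  rw [Complex.re_add_im, h, norm_zero] at h1
  have : 0 < Real.sin z.im ^ 2 := by positivity
  nlinarith [sq_nonneg (Real.sinh z.re)]

theorem sin_three_mul_pi_div_two : Real.sin (3 * π / 2) = -1 := by
  rw [show 3 * π / 2 = π / 2 + π by ring, Real.sin_add_pi, Real.sin_pi_div_two]

theorem re_integral_integrand_eq {n : ℕ} (hn : 1 ≤ n) (k₁ k₂ : ℕ) {R t ε : ℝ} (hR : 0 ≤ R)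
    (ht : 0 ≤ t) (hε : 0 < ε) (hε1 : ε ≤ 1) :
    (∫ s : ℝ in Set.Ioi 0, integrand n k₁ k₂ R t s).re =
      (∫ s : ℝ in (0 : ℝ)..ε, integrand n k₁ k₂ R t (s + (π - ε : ℝ) * I)).re +
      (I * ∫ y : ℝ in (π - ε)..(3 * π / 2), integrand n k₁ k₂ R t (ε + y * I)).re +
      (∫ s : ℝ in Set.Ioi ε, integrand n k₁ k₂ R t (s + (3 * π / 2 : ℝ) * I)).re := by
  obtain ⟨C, hC⟩ := exists_norm_integrand_le hn k₁ k₂ hR ht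
  have hpi := Real.pi_gt_three
  set F := integrand n k₁ k₂ R t
  have hd1 : DifferentiableOn ℂ F (Set.Ici 0 ×ℂ Set.Icc 0 (π - ε)) := fun z hz => by
    rw [mem_reProdIm] at hz
    exact (differentiableAt_integrand n k₁ k₂ R t (sinhc_ne_zero_of_im_mem
      ⟨by linarith [hz.2.1], by linarith [hz.2.2]⟩)).differentiableWithinAt
  have hd2 : DifferentiableOn ℂ F (Set.Ici ε ×ℂ Set.Icc (π - ε) (3 * π / 2)) := fun z hz => by
    rw [mem_reProdIm] at hz
    have : ε ≤ z.re := hz.1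
    exact (differentiableAt_integrand n k₁ k₂ R t (sinhc_ne_zero_of_re_ne_zero
      (by linarith))).differentiableWithinAt
  have h1 := integral_halfStrip (b := 2) (C := C) (by linarith : (0 : ℝ) ≤ π - ε) hd1
    fun s hs y hy => hC s hs y ⟨hy.1, by linarith [hy.2]⟩
  have h2 := integral_halfStrip (b := 2) (C := C) (by linarith : π - ε ≤ 3 * π / 2) hd2
    fun s hs y hy => hC s hs y ⟨by linarith [hy.1], by linarith [hy.2]⟩
  have hint : IntegrableOn (fun s : ℝ => F (s + (π - ε : ℝ) * I)) (Set.Ioi 0) := by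
    refine integrableOn_Ioi_horizontal (b := 2) (C := C) ?_
      fun s hs => hC s hs _ ⟨by linarith, by linarith⟩
    refine hd1.continuousOn.comp (by fun_prop) fun s hs => ?_
    rw [mem_reProdIm]
    simp at hs ⊢
    exact ⟨hs, by linarith⟩
  have h3 : ∫ s : ℝ in Set.Ioi 0, F (s + (π - ε : ℝ) * I) =
      (∫ s : ℝ in (0 : ℝ)..ε, F (s + (π - ε : ℝ) * I)) +
        ∫ s : ℝ in Set.Ioi ε, F (s + (π - ε : ℝ) * I) := by
    rw [intervalIntegral.integral_of_le hε.le,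
      ← setIntegral_union (Set.Ioc_disjoint_Ioi le_rfl) measurableSet_Ioi
        (hint.mono_set Set.Ioc_subset_Ioi_self) (hint.mono_set (Set.Ioi_subset_Ioi hε.le)),
      Set.Ioc_union_Ioi_eq_Ioi hε.le]
  have h4 : (I * ∫ y : ℝ in (0 : ℝ)..(π - ε), F ((0 : ℝ) + y * I)).re = 0 := by
    rw [I_mul_re, neg_eq_zero, ← Complex.conj_eq_iff_im, intervalIntegral.integral_of_le
      (by linarith), ← integral_conj]
    refine setIntegral_congr_fun measurableSet_Ioc fun y _ => ?_
    simp only [F]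
    rw [← integrand_neg_conj]
    simp
  have e : ∫ s : ℝ in Set.Ioi 0, F s = ∫ s : ℝ in Set.Ioi 0, F (s + (0 : ℝ) * I) := by simp
  rw [e, h1, add_re, h4, h3, h2, zero_add, add_re, add_re]
  ring

theorem phase_ofReal {R t ε : ℝ} (h0 : 0 < ε) (h3 : ε < 3) : phase R t ε =
    ((-(π - ε) * t + R * ((π - ε) * Real.cos ε / Real.sin ε) : ℝ) : ℂ) := by
  have hball : (ε : ℂ) ∈ Metric.ball (0 : ℂ) 3 := by simpa [abs_of_pos h0] using h3
  rw [phase, pole_add_regPart hball (by exact_mod_cast h0.ne')]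
  push_cast
  rfl

theorem phase_re {R t ε : ℝ} (h0 : 0 < ε) (h3 : ε < 3) :
    ((phase R t ε).re : ℂ) = phase R t ε := by
  rw [phase_ofReal h0 h3, ofReal_re]

/-- The contribution of the segment through the saddle point. -/
theorem exists_saddle_segment_bound (n k₁ k₂ : ℕ) :
    ∃ C, 1 ≤ C ∧ ∃ ε₀, 0 < ε₀ ∧ ε₀ ≤ 1 ∧ ∀ R t ε : ℝ, 0 < R → 0 < ε → ε ≤ ε₀ →
      (t : ℂ) = R * (π / ε ^ 2 - deriv regPart ε) → ∀ μ, μ = 2 * π * R / ε →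
      |(-1) ^ (k₁ + k₂) *
          (∫ s : ℝ in (0 : ℝ)..ε, integrand n k₁ k₂ R t (s + (π - ε : ℝ) * I)).re -
        π ^ (n + k₁ + k₂) * Real.exp (phase R t ε).re * (ε / ε ^ (n + k₁)) *
          (√(2 * π / μ) / 2)| ≤
      π ^ (n + k₁ + k₂) * Real.exp (phase R t ε).re * (ε / ε ^ (n + k₁)) *
        (C * (32 / μ + ε) * (√(32 * π / μ) / 2)) := by
  obtain ⟨L, hL0, hL⟩ := exists_norm_sub_le_of_differentiableOn
    (differentiableOn_poleFactor n k₁ k₂)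
  obtain ⟨T, hT0, hT⟩ := exists_norm_sub_sub_le_of_differentiableOn differentiableOn_regPart
  refine ⟨256 * (1 + (n + k₁ : ℕ)) ^ 2 + (2 * L + 8 * T), ?_, min 1 (1 / (16 * T)),
    by positivity, min_le_left _ _, ?_⟩
  · have : (0 : ℝ) ≤ (n + k₁ : ℕ) := Nat.cast_nonneg _
    nlinarith
  intro R t ε hR hε hε' ht μ hμ
  set m := n + k₁ with hm
  set N := n + k₁ + k₂ with hN
  have hε1 : ε ≤ 1 := hε'.trans (min_le_left _ _)
  have hεT : T * ε ≤ 1 / 16 := by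
    have := hε'.trans (min_le_right _ _)
    rw [le_div_iff₀ (by positivity)] at this
    linarith
  have hpi := Real.pi_gt_three
  have hμ0 : 0 < μ := by rw [hμ]; positivity
  have hne : (ε : ℂ) ≠ 0 := by exact_mod_cast hε.ne'
  have hpic : (π : ℂ) ≠ 0 := by exact_mod_cast Real.pi_ne_zero
  set p₀ := (phase R t ε).re with hp₀
  have hp₀c : (p₀ : ℂ) = phase R t ε := phase_re hε (by linarith)
  set A : ℝ := π ^ N * Real.exp p₀ / ε ^ m with hA
  have hA0 : 0 < A := by positivity
  set ψ : ℝ → ℂ := fun u => (-1) ^ (k₁ + k₂) / (A : ℂ) *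
    integrand n k₁ k₂ R t ((ε * u : ℝ) + (π - ε : ℝ) * I) with hψ
  have hcont : Continuous ψ := by
    refine continuous_const.mul (continuous_iff_continuousAt.2 fun u => ?_)
    have h : sinhc ((ε * u : ℝ) + (π - ε : ℝ) * I) ≠ 0 := sinhc_ne_zero_of_im_mem (by
      simp; constructor <;> linarith)
    exact (differentiableAt_integrand n k₁ k₂ R t h).continuousAt.comp
      (f := fun u : ℝ => (((ε * u : ℝ) : ℂ) + (π - ε : ℝ) * I))
      (by fun_prop : Continuous _).continuousAt
  have hint : (-1) ^ (k₁ + k₂) *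
      (∫ s : ℝ in (0 : ℝ)..ε, integrand n k₁ k₂ R t (s + (π - ε : ℝ) * I)).re =
      A * ε * (∫ u in (0 : ℝ)..1, ψ u).re := by
    have h1 := intervalIntegral.smul_integral_comp_mul_left (a := 0) (b := 1)
      (fun s : ℝ => integrand n k₁ k₂ R t (s + (π - ε : ℝ) * I)) ε
    rw [mul_zero, mul_one] at h1
    rw [hψ, intervalIntegral.integral_const_mul, ← h1]
    have e : ((-1) ^ (k₁ + k₂) / (A : ℂ)) = (((-1) ^ (k₁ + k₂) / A : ℝ) : ℂ) := by push_cast; rfl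
    rw [e, re_ofReal_mul, Complex.real_smul, re_ofReal_mul]
    field_simp
  have hpt : ∀ u ∈ Set.Icc (0 : ℝ) 1, |(ψ u).re - Real.exp (-(μ * u ^ 2) / 2)| ≤
      (256 * (1 + m) ^ 2 + (2 * L + 8 * T)) * ((u ^ 2 + ε) * Real.exp (-(μ * u ^ 2) / 16)) := by
    intro u hu
    set w : ℂ := ε * (1 + u * I) with hw
    have hone := one_add_mul_I_ne_zero u
    have hw0 : w ≠ 0 := mul_ne_zero hne hone
    have hwn : ‖w‖ ≤ 2 * ε := by
      rw [hw, norm_mul, norm_real, Real.norm_eq_abs, abs_of_pos hε, mul_comm]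
      gcongr
      refine (norm_add_le _ _).trans ?_
      simp [abs_of_nonneg hu.1]
      linarith [hu.2]
    have hw2 : w ∈ Metric.closedBall (0 : ℂ) 2 := by
      rw [mem_closedBall_zero_iff]; linarith
    have hε2 : (ε : ℂ) ∈ Metric.closedBall (0 : ℂ) 2 := by
      rw [mem_closedBall_zero_iff, norm_real, Real.norm_eq_abs, abs_of_pos hε]; linarith
    have hz2 : (0 : ℂ) ∈ Metric.closedBall (0 : ℂ) 2 := by simp
    have hw3 : w ∈ Metric.ball (0 : ℂ) 3 := Metric.closedBall_subset_ball (by norm_num) hw2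
    set β : ℂ := poleFactor n k₁ k₂ w / π ^ N - 1 with hβ
    set ζ : ℂ := R * (regPart w - regPart ε - (w - ε) * deriv regPart ε) with hζ
    have hβn : ‖β‖ ≤ 2 * L * ε := by
      have h1 := hL w hw2 0 hz2
      rw [poleFactor_zero, sub_zero] at h1
      have h2 : (1 : ℝ) ≤ π ^ N := one_le_pow₀ (by linarith)
      have h3 : β = (poleFactor n k₁ k₂ w - π ^ N) / π ^ N := by rw [hβ]; field_simp
      rw [h3, norm_div, norm_pow, norm_real, Real.norm_eq_abs, abs_of_pos Real.pi_pos]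
      refine (div_le_self (norm_nonneg _) h2).trans (h1.trans ?_)
      calc L * ‖w‖ ≤ L * (2 * ε) := by gcongr
        _ = _ := by ring
    have hζn : ‖ζ‖ ≤ T * ε * (μ * u ^ 2) := by
      have h1 := hT w hw2 ε hε2
      have h2 : ‖w - ε‖ = ε * u := by
        rw [hw, show (ε * (1 + u * I) - ε : ℂ) = ε * u * I by ring]
        simp [abs_of_pos hε, abs_of_nonneg hu.1]
      rw [h2] at h1
      rw [hζ, norm_mul, norm_real, Real.norm_eq_abs, abs_of_pos hR]
      have hRμ : R ≤ μ * ε := by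
        rw [hμ]; field_simp; linarith
      calc R * _ ≤ (μ * ε) * (T * (ε * u) ^ 2) := by gcongr
        _ = T * ε * (μ * u ^ 2) * ε ^ 2 := by ring
        _ ≤ _ := mul_le_of_le_one_right (by positivity) (pow_le_one₀ hε.le hε1)
    have hψu : ψ u = (1 + β) * (saddleFn m μ u * Complex.exp ζ) := by
      have e1 : (((ε * u : ℝ) : ℂ) + (π - ε : ℝ) * I) = I * (π - w) := by
        rw [hw]; push_cast; ring_nf; simp
      have e2 : phase R t w = phase R t ε + (-(μ / 2) * u ^ 2 / (1 + u * I) + ζ) := by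
        have := phase_sub_phase hε ht hw0
        rw [← hζ] at this
        have h3 : (R * π * ((w - ε) ^ 2 / (ε ^ 2 * w)) : ℂ) =
            -(μ / 2) * u ^ 2 / (1 + u * I) := by
          rw [hw, hμ]
          push_cast
          field_simp
          ring_nf
          simp
        rw [h3] at this
        linear_combination this
      have hs : ((-1 : ℂ) ^ (k₁ + k₂)) * (-1) ^ (k₁ + k₂) = 1 := by
        rw [← mul_pow]; simp
      simp only [hψ]
      rw [e1, integrand_eq_phase n k₁ k₂ R t hw3 hw0, e2, Complex.exp_add, Complex.exp_add,
        ← hp₀c, saddleFn, hβ, hA, hw, mul_pow, inv_pow]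
      have he : Complex.exp p₀ ≠ 0 := Complex.exp_ne_zero _
      push_cast
      generalize poleFactor n k₁ k₂ (ε * (1 + u * I)) = B
      generalize ((-1 : ℂ) ^ (k₁ + k₂)) = σ at hs ⊢
      field_simp
      linear_combination ((ε : ℂ) ^ m * B * (1 + u * I) ^ m) * hs
    have h1 := norm_perturbed_saddleFn_sub_le m hμ0 hu hβn hζn (by positivity) hεT
    have h2 := abs_re_saddleFn_sub_le m hμ0 hu
    rw [← hψu] at h1
    have h3 := (Complex.abs_re_le_norm _).trans h1
    rw [sub_re] at h3
    have h4 := (abs_sub_le (ψ u).re (saddleFn m μ u).re (Real.exp (-(μ * u ^ 2) / 2))).trans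
      (add_le_add h3 h2)
    refine h4.trans ?_
    have hE := Real.exp_pos (-(μ * u ^ 2) / 16)
    have e : (256 * (1 + m) ^ 2 + (2 * L + 8 * T)) *
        ((u ^ 2 + ε) * Real.exp (-(μ * u ^ 2) / 16)) =
        (2 * L + 8 * T) * ε * Real.exp (-(μ * u ^ 2) / 16) +
        256 * (1 + m) ^ 2 * (u ^ 2 * Real.exp (-(μ * u ^ 2) / 16)) +
        (256 * (1 + m) ^ 2 * ε + (2 * L + 8 * T) * u ^ 2) *
          Real.exp (-(μ * u ^ 2) / 16) := by ring
    rw [e]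
    exact le_add_of_nonneg_right (by positivity)
  have hfin := abs_re_integral_sub_gaussian_le hμ0 hε
    (C := 256 * (1 + m) ^ 2 + (2 * L + 8 * T)) ?_ hcont.continuousOn hpt
  · have e : π ^ N * Real.exp p₀ * (ε / ε ^ m) = A * ε := by rw [hA]; ring
    rw [e, hint, ← mul_sub, abs_mul, abs_of_pos (by positivity : 0 < A * ε)]
    gcongr
  · have : (0 : ℝ) ≤ m := Nat.cast_nonneg _
    nlinarith

theorem remainder_le_of_re_le {T ε r : ℝ} (hT : 0 ≤ T) (hε : 0 < ε) (hε1 : ε ≤ 2 / 5)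
    (hεT : T * ε ≤ 1 / 16) (hr1 : r ≤ ε) (hr2 : -(π / 2) ≤ r) :
    T * ((ε - r) ^ 2 + ε ^ 2) ≤ π * ((ε - r) / (2 * ε ^ 2) + 1 / (4 * ε)) := by
  have hpi := Real.pi_gt_three
  have hpi' := Real.pi_lt_d2
  have h0 : T * ε ^ 2 ≤ 1 / 16 := by
    rw [pow_two, ← mul_assoc]
    exact (mul_le_of_le_one_right (by positivity) (by linarith)).trans hεT
  have a1 : T * (ε - r) ^ 2 ≤ π * ((ε - r) / (2 * ε ^ 2)) := by
    obtain ⟨s, hs⟩ : ∃ s, s = ε - r := ⟨_, rfl⟩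
    rw [← hs]
    have hs0 : 0 ≤ s := by linarith
    have hs2 : s ≤ 2 := by linarith
    rw [← mul_div_assoc, le_div_iff₀ (by positivity)]
    calc T * s ^ 2 * (2 * ε ^ 2) = T * ε ^ 2 * s * (2 * s) := by ring
      _ ≤ 1 / 16 * 2 * (2 * s) := by gcongr
      _ ≤ π * s := by nlinarith only [hs0, hpi]
  have a2 : T * ε ^ 2 ≤ π * (1 / (4 * ε)) := by
    rw [← mul_div_assoc, le_div_iff₀ (by positivity)]
    calc T * ε ^ 2 * (4 * ε) ≤ 1 / 16 * (4 * (2 / 5)) := by gcongr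
      _ ≤ π * 1 := by linarith
  linarith

theorem phase_re_le_of_im_eq {R t ε μ y : ℝ} (hε : 0 < ε)
    (ht : (t : ℂ) = R * (π / ε ^ 2 - deriv regPart ε)) {w : ℂ} (hw0 : w ≠ 0)
    (hwre : w.re = π - y) (hwim : w.im = ε)
    (hT : ‖regPart w - regPart ε - (w - ε) * deriv regPart ε‖ ≤
      π * ((ε - (π - y)) / (2 * ε ^ 2) + 1 / (4 * ε)))
    (hR : 0 < R) (hμ : μ = 2 * π * R / ε) :
    (phase R t w).re ≤ (phase R t ε).re + -μ / 8 + -(μ / (4 * ε)) * (y - (π - ε)) := by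
  have hpi := Real.pi_pos
  obtain ⟨r, hr⟩ : ∃ r, r = π - y := ⟨_, rfl⟩
  rw [← hr] at hwre hT
  have h1 := phase_sub_phase hε ht hw0
  have hwsq : ‖w‖ ^ 2 = r ^ 2 + ε ^ 2 := by
    rw [Complex.sq_norm, Complex.normSq_apply, hwre, hwim]; ring
  have h4 : ((w - ε) ^ 2 / (ε ^ 2 * w) : ℂ).re =
      (r - ε) / ε ^ 2 + r / (r ^ 2 + ε ^ 2) - 1 / ε := by
    have hne : (ε : ℂ) ≠ 0 := by exact_mod_cast hε.ne'
    have : ((w - ε) ^ 2 / (ε ^ 2 * w) : ℂ) =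
        ((1 / ε ^ 2 : ℝ) : ℂ) * w + w⁻¹ - ((2 / ε : ℝ) : ℂ) := by
      push_cast
      field_simp
      ring
    rw [this, sub_re, add_re, re_ofReal_mul, Complex.inv_re, ofReal_re, hwre,
      ← Complex.sq_norm, hwsq]
    field_simp
    ring
  have h5 : r / (r ^ 2 + ε ^ 2) ≤ 1 / (2 * ε) := by
    rw [div_le_div_iff₀ (by positivity) (by positivity)]
    nlinarith only [sq_nonneg (r - ε)]
  have h6 : (R * (regPart w - regPart ε - (w - ε) * deriv regPart ε)).re ≤
      R * (π * ((ε - r) / (2 * ε ^ 2) + 1 / (4 * ε))) := by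
    rw [re_ofReal_mul]
    gcongr
    exact (Complex.re_le_norm _).trans hT
  have h7 : (phase R t w).re - (phase R t ε).re =
      R * π * ((r - ε) / ε ^ 2 + r / (r ^ 2 + ε ^ 2) - 1 / ε) +
        (R * (regPart w - regPart ε - (w - ε) * deriv regPart ε)).re := by
    rw [← sub_re, h1, add_re, ← h4, ← re_ofReal_mul]
    push_cast
    rfl
  have h9 : -μ / 8 + -(μ / (4 * ε)) * (y - (π - ε)) =
      R * π * ((r - ε) / ε ^ 2 + 1 / (2 * ε) - 1 / ε) +
        R * (π * ((ε - r) / (2 * ε ^ 2) + 1 / (4 * ε))) := by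
    rw [hμ, hr]
    field_simp
    ring
  have h11 : R * π * ((r - ε) / ε ^ 2 + r / (r ^ 2 + ε ^ 2) - 1 / ε) ≤
      R * π * ((r - ε) / ε ^ 2 + 1 / (2 * ε) - 1 / ε) := by gcongr
  linarith

/-- The contribution of the vertical segment past the pole. -/
theorem exists_vertical_segment_bound (n k₁ k₂ : ℕ) :
    ∃ C, 0 < C ∧ ∃ ε₀, 0 < ε₀ ∧ ε₀ ≤ 1 ∧ ∀ R t ε : ℝ, 0 < R → 0 < ε → ε ≤ ε₀ →
      (t : ℂ) = R * (π / ε ^ 2 - deriv regPart ε) → ∀ μ, μ = 2 * π * R / ε →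
      ‖∫ y : ℝ in (π - ε)..(3 * π / 2), integrand n k₁ k₂ R t (ε + y * I)‖ ≤
        C * Real.exp (phase R t ε).re * (ε / ε ^ (n + k₁)) * (Real.exp (-μ / 8) / μ) := by
  obtain ⟨L, hL0, hL⟩ := exists_norm_le_of_differentiableOn
    (differentiableOn_poleFactor n k₁ k₂)
  obtain ⟨T, hT0, hT⟩ := exists_norm_sub_sub_le_of_differentiableOn differentiableOn_regPart
  refine ⟨4 * L, by positivity, min (2 / 5) (1 / (16 * T)), by positivity,
    (min_le_left _ _).trans (by norm_num), ?_⟩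
  intro R t ε hR hε hε' ht μ hμ
  set m := n + k₁ with hm
  have hε1 : ε ≤ 2 / 5 := hε'.trans (min_le_left _ _)
  have hεT : T * ε ≤ 1 / 16 := by
    have := hε'.trans (min_le_right _ _)
    rw [le_div_iff₀ (by positivity)] at this
    linarith
  have hpi := Real.pi_gt_three
  have hpi' := Real.pi_lt_d2
  have hμ0 : 0 < μ := by rw [hμ]; positivity
  set p₀ := (phase R t ε).re with hp₀
  have hpt : ∀ y ∈ Set.Ioc (π - ε) (3 * π / 2),
      ‖integrand n k₁ k₂ R t (ε + y * I)‖ ≤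
        L / ε ^ m * Real.exp p₀ * Real.exp (-μ / 8) * Real.exp (-(μ / (4 * ε)) * (y - (π - ε))) := by
    intro y hy
    set r := π - y with hr
    set w : ℂ := r + ε * I with hw
    have hr1 : r < ε := by rw [hr]; linarith [hy.1]
    have hr2 : -(π / 2) ≤ r := by rw [hr]; linarith [hy.2]
    have hwre : w.re = r := by simp [hw]
    have hwim : w.im = ε := by simp [hw]
    have hwsq : ‖w‖ ^ 2 = r ^ 2 + ε ^ 2 := by
      rw [Complex.sq_norm, hw, Complex.normSq_add_mul_I]
    have hwε : ε ≤ ‖w‖ := by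
      refine le_of_sq_le_sq ?_ (norm_nonneg _)
      rw [hwsq]; nlinarith
    have hw0 : w ≠ 0 := fun h => by rw [h, norm_zero] at hwε; linarith
    have hw2 : w ∈ Metric.closedBall (0 : ℂ) 2 := by
      rw [mem_closedBall_zero_iff]
      refine le_of_sq_le_sq ?_ (by norm_num)
      rw [hwsq]; nlinarith
    have hε2 : (ε : ℂ) ∈ Metric.closedBall (0 : ℂ) 2 := by
      rw [mem_closedBall_zero_iff, norm_real, Real.norm_eq_abs, abs_of_pos hε]; linarith
    have hw3 : w ∈ Metric.ball (0 : ℂ) 3 := Metric.closedBall_subset_ball (by norm_num) hw2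
    have e1 : (ε + y * I : ℂ) = I * (π - w) := by
      rw [hw, hr]; push_cast; ring_nf; simp
    have hph : (phase R t w).re ≤ p₀ + -μ / 8 + -(μ / (4 * ε)) * (y - (π - ε)) := by
      refine phase_re_le_of_im_eq hε ht hw0 hwre hwim ((hT w hw2 ε hε2).trans ?_) hR hμ
      have h3 : ‖w - ε‖ ^ 2 = (ε - r) ^ 2 + ε ^ 2 := by
        rw [show w - ε = ((r - ε : ℝ) : ℂ) + ε * I by rw [hw]; push_cast; ring, Complex.sq_norm,
          Complex.normSq_add_mul_I]
        ring
      rw [h3]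
      exact remainder_le_of_re_le hT0.le hε hε1 hεT hr1.le hr2
    rw [e1, integrand_eq_phase n k₁ k₂ R t hw3 hw0, norm_mul, norm_pow, norm_neg, norm_one, one_pow,
      one_mul, norm_mul, norm_div, norm_pow, Complex.norm_exp]
    calc ‖poleFactor n k₁ k₂ w‖ / ‖w‖ ^ (n + k₁) * Real.exp (phase R t w).re ≤
          L / ε ^ m * Real.exp (p₀ + -μ / 8 + -(μ / (4 * ε)) * (y - (π - ε))) := by
          gcongr
          exact hL w hw2
      _ = _ := by rw [Real.exp_add, Real.exp_add]; ring
  set c := μ / (4 * ε) with hc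
  have hc0 : 0 < c := by positivity
  set D := L / ε ^ m * Real.exp p₀ * Real.exp (-μ / 8) with hD
  have hD0 : 0 ≤ D := by rw [hD]; positivity
  clear_value D
  have hexp : Integrable (fun y => D * Real.exp (-c * (y - (π - ε))))
      (volume.restrict (Set.Ioi (π - ε))) := by
    have := (exp_neg_integrableOn_Ioi (π - ε) hc0).const_mul (D * Real.exp (c * (π - ε)))
    refine this.congr (Filter.Eventually.of_forall fun y => ?_)
    simp only
    rw [mul_assoc, ← Real.exp_add]
    congr 2
    ring
  have hval : ∫ y in Set.Ioi (π - ε), D * Real.exp (-c * (y - (π - ε))) = D / c := by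
    have h1 := integral_exp_mul_Ioi (a := -c) (by linarith) (π - ε)
    have h2 : ∀ y, D * Real.exp (-c * (y - (π - ε))) =
        D * Real.exp (c * (π - ε)) * Real.exp (-c * y) := fun y => by
      rw [mul_assoc, ← Real.exp_add]
      congr 2
      ring
    simp_rw [h2]
    rw [integral_const_mul, h1, mul_assoc, mul_div_assoc', mul_neg, ← Real.exp_add]
    simp
    rw [div_eq_mul_inv]
  rw [intervalIntegral.integral_of_le (by linarith)]
  calc _ ≤ ∫ y in Set.Ioc (π - ε) (3 * π / 2), D * Real.exp (-c * (y - (π - ε))) :=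
        norm_integral_le_of_norm_le (hexp.mono_measure
          (Measure.restrict_mono Set.Ioc_subset_Ioi_self le_rfl))
          ((ae_restrict_mem measurableSet_Ioc).mono hpt)
    _ ≤ ∫ y in Set.Ioi (π - ε), D * Real.exp (-c * (y - (π - ε))) :=
        setIntegral_mono_set hexp (Filter.Eventually.of_forall fun y => by positivity)
          Set.Ioc_subset_Ioi_self.eventuallyLE
    _ = _ := by
      rw [hval, hD, hc]
      field_simp

/-- The contribution of the horizontal half-line past the pole. -/
theorem exists_horizontal_bound {n : ℕ} (hn : 1 ≤ n) (k₁ k₂ : ℕ) :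
    ∃ C, 0 < C ∧ ∀ R t ε : ℝ, 0 ≤ R → 0 < ε →
      ‖∫ s : ℝ in Set.Ioi ε, integrand n k₁ k₂ R t (s + (3 * π / 2 : ℝ) * I)‖ ≤
        C * Real.exp (-(3 * π / 2 * t)) := by
  obtain ⟨C, -, hC⟩ := exists_norm_amplitude_le hn k₁ k₂
  have hpi := Real.pi_pos
  have hcont : Continuous fun s : ℝ => amplitude n k₁ k₂ (s + (3 * π / 2 : ℝ) * I) := by
    refine continuous_iff_continuousAt.2 fun s => ?_
    have h : sinhc (s + (3 * π / 2 : ℝ) * I) ≠ 0 := sinhc_ne_zero_of_sin_im_ne_zero (by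
      have : ((s : ℂ) + (3 * π / 2 : ℝ) * I).im = 3 * π / 2 := by simp [-ofReal_div, -ofReal_mul]
      rw [this, sin_three_mul_pi_div_two]
      norm_num)
    exact (differentiableAt_amplitude n k₁ k₂ h).continuousAt.comp
      (f := fun s : ℝ => ((s : ℂ) + (3 * π / 2 : ℝ) * I)) (by fun_prop : Continuous _).continuousAt
  have hint := (integrableOn_Ioi_horizontal (a := 0) hcont.continuousOn
    fun s hs => hC s hs (3 * π / 2) ⟨by positivity, le_rfl⟩).norm
  set J := ∫ s : ℝ in Set.Ioi 0, ‖amplitude n k₁ k₂ (s + (3 * π / 2 : ℝ) * I)‖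
  have hJ : 0 ≤ J := integral_nonneg fun _ => norm_nonneg _
  refine ⟨J + 1, by positivity, fun R t ε hR hε => ?_⟩
  have hsub : Set.Ioi ε ⊆ Set.Ioi 0 := Set.Ioi_subset_Ioi hε.le
  have hint' := hint.const_mul (Real.exp (-(3 * π / 2 * t)))
  calc _ ≤ ∫ s : ℝ in Set.Ioi ε, Real.exp (-(3 * π / 2 * t)) *
        ‖amplitude n k₁ k₂ (s + (3 * π / 2 : ℝ) * I)‖ := by
        refine norm_integral_le_of_norm_le (hint'.mono_measure
          (Measure.restrict_mono hsub le_rfl))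
          ((ae_restrict_mem measurableSet_Ioi).mono fun s hs => ?_)
        refine norm_integrand_le n k₁ k₂ hR ?_
        have hs0 : 0 < s := hsub hs
        have e : Real.sin (2 * (3 * π / 2)) = 0 := by
          rw [show 2 * (3 * π / 2) = (3 : ℕ) * π by push_cast; ring, Real.sin_nat_mul_pi]
        rw [e, mul_zero, add_zero]
        exact mul_nonneg hs0.le (Real.sinh_nonneg_iff.2 (by linarith))
    _ ≤ ∫ s : ℝ in Set.Ioi 0, Real.exp (-(3 * π / 2 * t)) *
        ‖amplitude n k₁ k₂ (s + (3 * π / 2 : ℝ) * I)‖ :=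
        setIntegral_mono_set hint' (Filter.Eventually.of_forall fun y => by positivity)
          hsub.eventuallyLE
    _ = Real.exp (-(3 * π / 2 * t)) * J := integral_const_mul _ _
    _ ≤ _ := by nlinarith [Real.exp_pos (-(3 * π / 2 * t))]

theorem exp_neg_div_eight_le {μ : ℝ} (hμ : 0 < μ) : Real.exp (-μ / 8) ≤ 8 / μ := by
  rw [neg_div, Real.exp_neg, ← inv_div μ 8]
  gcongr
  linarith [Real.add_one_le_exp (μ / 8)]

theorem one_div_le_one_div_sqrt {μ : ℝ} (hμ : 1 ≤ μ) : 1 / μ ≤ 1 / √μ := by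
  have : √μ ≤ μ := Real.sqrt_le_iff.2 ⟨by linarith, by nlinarith⟩
  gcongr

theorem exists_norm_deriv_regPart_le :
    ∃ B, 0 < B ∧ ∀ ε : ℝ, 0 < ε → ε ≤ 1 → ‖deriv regPart (ε : ℂ)‖ ≤ B := by
  obtain ⟨B, hB0, hB⟩ := exists_norm_sub_le_of_differentiableOn differentiableOn_regPart
  refine ⟨B, hB0, fun ε hε hε1 => ?_⟩
  have hball : (ε : ℂ) ∈ Metric.ball (0 : ℂ) 2 := by
    rw [mem_ball_zero_iff, norm_real, Real.norm_eq_abs, abs_of_pos hε]; linarith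
  refine norm_deriv_le_of_lip' hB0.le ?_
  filter_upwards [Metric.isOpen_ball.mem_nhds hball] with z hz
  exact hB z (Metric.ball_subset_closedBall hz) _ (Metric.ball_subset_closedBall hball)

/-- At large `t` the phase at the saddle point dominates the decay on the line `Im = 3π/2`. -/
theorem exists_exp_neg_le (n k₁ : ℕ) (hn : 1 ≤ n) :
    ∃ ε₀, 0 < ε₀ ∧ ε₀ ≤ 1 ∧ ∀ R t ε : ℝ, 0 < R → 0 < ε → ε ≤ ε₀ →
      (t : ℂ) = R * (π / ε ^ 2 - deriv regPart ε) → ∀ μ, μ = 2 * π * R / ε → 1 ≤ μ →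
      Real.exp (-(3 * π / 2 * t)) ≤
        64 * (Real.exp (phase R t ε).re * (ε / ε ^ (n + k₁)) * (1 / √μ) * (1 / μ)) := by
  obtain ⟨A, hA0, hA⟩ := exists_norm_le_of_differentiableOn differentiableOn_regPart
  obtain ⟨B, hB0, hB⟩ := exists_norm_deriv_regPart_le
  refine ⟨min 1 (min (1 / A) (1 / (2 * B))), by positivity, min_le_left _ _, ?_⟩
  intro R t ε hR hε hε' ht μ hμ hμ1
  have hpi := Real.pi_gt_three
  have hε1 : ε ≤ 1 := hε'.trans (min_le_left _ _)
  have hεA : A * ε ≤ 1 := by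
    have := hε'.trans ((min_le_right _ _).trans (min_le_left _ _))
    rwa [le_div_iff₀ hA0, mul_comm] at this
  have hεB : B * ε ≤ 1 / 2 := by
    have := hε'.trans ((min_le_right _ _).trans (min_le_right _ _))
    rw [le_div_iff₀ (by positivity)] at this
    linarith
  have hμ0 : 0 < μ := by linarith
  have hball : (ε : ℂ) ∈ Metric.ball (0 : ℂ) 2 := by
    rw [mem_ball_zero_iff, norm_real, Real.norm_eq_abs, abs_of_pos hε]; linarith
  have hd := hB ε hε hε1
  have htre : t = R * (π / ε ^ 2 - (deriv regPart (ε : ℂ)).re) := by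
    have h1 := congrArg Complex.re ht
    rw [ofReal_re, re_ofReal_mul, sub_re] at h1
    rw [h1, show (π / ε ^ 2 : ℂ) = ((π / ε ^ 2 : ℝ) : ℂ) by push_cast; rfl, ofReal_re]
  have htμ : μ / 4 ≤ t := by
    have h1 := (Complex.re_le_norm _).trans hd
    have h2 : B ≤ π / ε ^ 2 / 2 := by
      rw [div_div, le_div_iff₀ (by positivity)]
      have : B * ε * ε ≤ 1 / 2 * 1 := by gcongr
      linarith
    have h3 : R * (π / (2 * ε)) ≤ t := by
      rw [htre]
      gcongr
      have : π / (2 * ε) ≤ π / ε ^ 2 / 2 := by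
        rw [div_div]
        exact div_le_div_of_nonneg_left (by linarith) (by positivity) (by nlinarith)
      linarith
    have h4 : μ / 4 = R * (π / (2 * ε)) := by rw [hμ]; field_simp; norm_num
    rwa [h4]
  have hp : -(π * t) ≤ (phase R t ε).re := by
    have h1 : phase R t ε = ((-(π - ε) * t : ℝ) : ℂ) + (R : ℂ) * (((π / ε : ℝ) : ℂ) + regPart ε) := by
      rw [phase]; push_cast; rfl
    rw [h1, add_re, ofReal_re, re_ofReal_mul, add_re, ofReal_re]
    have h2 := (abs_le.1 ((Complex.abs_re_le_norm _).trans
      (hA ε (Metric.ball_subset_closedBall hball)))).1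
    have h3 : A ≤ π / ε := by
      rw [le_div_iff₀ hε]; linarith
    have h4 : 0 ≤ R * (π / ε + (regPart ε).re) := mul_nonneg hR.le (by linarith)
    have h5 : 0 ≤ ε * t := mul_nonneg hε.le (by linarith)
    linarith
  have hq : 1 ≤ ε / ε ^ (n + k₁) := by
    rw [one_le_div (by positivity)]
    exact pow_le_of_le_one hε.le hε1 (by omega)
  have h1 : Real.exp (-(3 * π / 2 * t)) ≤
      Real.exp (phase R t ε).re * (Real.exp (-μ / 8) * Real.exp (-μ / 8)) := by
    rw [← Real.exp_add, ← Real.exp_add, Real.exp_le_exp]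
    nlinarith
  have h2 := exp_neg_div_eight_le hμ0
  have h3 := one_div_le_one_div_sqrt hμ1
  calc _ ≤ Real.exp (phase R t ε).re * 1 * (8 / μ * (8 / μ)) := by
        rw [mul_one]; exact h1.trans (by gcongr)
    _ = 64 * (Real.exp (phase R t ε).re * 1 * (1 / μ) * (1 / μ)) := by ring
    _ ≤ _ := by gcongr

theorem exists_re_integral_bound {n : ℕ} (hn : 1 ≤ n) (k₁ k₂ : ℕ) :
    ∃ C, 0 < C ∧ ∃ ε₀, 0 < ε₀ ∧ ε₀ ≤ 1 ∧ ∀ R t ε : ℝ, 0 < R → 0 ≤ t → 0 < ε → ε ≤ ε₀ →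
      (t : ℂ) = R * (π / ε ^ 2 - deriv regPart ε) → ∀ μ, μ = 2 * π * R / ε → 1 ≤ μ →
      |(-1) ^ (k₁ + k₂) * (2 * (∫ s : ℝ in Set.Ioi 0, integrand n k₁ k₂ R t s).re) -
        π ^ (n + k₁ + k₂) * (Real.exp (phase R t ε).re * (ε / ε ^ (n + k₁))) * √(2 * π / μ)| ≤
      C * (Real.exp (phase R t ε).re * (ε / ε ^ (n + k₁)) * (1 / √μ) * (1 / μ + ε)) := by
  obtain ⟨Cs, hCs, ε₁, h1, h1', hS⟩ := exists_saddle_segment_bound n k₁ k₂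
  obtain ⟨Cv, hCv, ε₂, h2, h2', hV⟩ := exists_vertical_segment_bound n k₁ k₂
  obtain ⟨Ch, hCh, hH⟩ := exists_horizontal_bound hn k₁ k₂
  obtain ⟨ε₃, h3, h3', hE⟩ := exists_exp_neg_le n k₁ hn
  refine ⟨π ^ (n + k₁ + k₂) * 32 * Cs * √(32 * π) + 16 * Cv + 128 * Ch, by positivity,
    min ε₁ (min ε₂ ε₃), by positivity, (min_le_left _ _).trans h1', ?_⟩
  intro R t ε hR ht0 hε hε' ht μ hμ hμ1
  have hε1 : ε ≤ 1 := hε'.trans ((min_le_left _ _).trans h1')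
  have hμ0 : 0 < μ := by linarith
  have bS := hS R t ε hR hε (hε'.trans (min_le_left _ _)) ht μ hμ
  have bV := hV R t ε hR hε (hε'.trans ((min_le_right _ _).trans (min_le_left _ _))) ht μ hμ
  have bH := hH R t ε hR.le hε
  have bE := hE R t ε hR hε (hε'.trans ((min_le_right _ _).trans (min_le_right _ _))) ht μ hμ hμ1
  rw [re_integral_integrand_eq hn k₁ k₂ hR.le ht0 hε hε1]
  generalize (∫ s : ℝ in (0 : ℝ)..ε, integrand n k₁ k₂ R t (s + (π - ε : ℝ) * I)).re = S at bS ⊢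
  generalize (∫ y : ℝ in (π - ε)..(3 * π / 2), integrand n k₁ k₂ R t (ε + y * I)) = V at bV ⊢
  generalize (∫ s : ℝ in Set.Ioi ε, integrand n k₁ k₂ R t (s + (3 * π / 2 : ℝ) * I)) = H at bH ⊢
  have bV1 : |(I * V).re| ≤ ‖V‖ := by
    have := Complex.abs_re_le_norm (I * V)
    rwa [norm_mul, norm_I, one_mul] at this
  have bH1 := Complex.abs_re_le_norm H
  have hs := one_div_le_one_div_sqrt hμ1
  have hs1 : √(32 * π / μ) = √(32 * π) * (1 / √μ) := by
    rw [Real.sqrt_div' _ hμ0.le, mul_one_div]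
  have hq0 : 0 < Real.exp (phase R t ε).re * (ε / ε ^ (n + k₁)) := by positivity
  rw [mul_assoc (π ^ (n + k₁ + k₂)) (Real.exp _), hs1] at bS
  rw [mul_assoc Cv] at bV
  generalize Real.exp (phase R t ε).re * (ε / ε ^ (n + k₁)) = q at *
  generalize hsg : ((-1 : ℝ)) ^ (k₁ + k₂) = σ at *
  have hσ : |σ| = 1 := by rw [← hsg, abs_pow, abs_neg, abs_one, one_pow]
  have hsμ : 0 < 1 / √μ := by positivity
  generalize 1 / √μ = s at *
  have hexp := exp_neg_div_eight_le hμ0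
  have cV : ‖V‖ ≤ 8 * Cv * (q * s * (1 / μ + ε)) := by
    refine bV.trans ?_
    calc Cv * q * (Real.exp (-μ / 8) / μ) = Cv * q * (Real.exp (-μ / 8) * (1 / μ)) := by ring
      _ ≤ Cv * q * (8 / μ * (1 / μ)) := by gcongr
      _ = 8 * Cv * (q * (1 / μ) * (1 / μ + 0)) := by ring
      _ ≤ _ := by gcongr
  have cH : ‖H‖ ≤ 64 * Ch * (q * s * (1 / μ + ε)) := by
    refine bH.trans ?_
    calc _ ≤ Ch * (64 * (q * s * (1 / μ))) := by gcongr
      _ = 64 * Ch * (q * s * (1 / μ + 0)) := by ring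
      _ ≤ _ := by gcongr
  have cS : π ^ (n + k₁ + k₂) * q * (Cs * (32 / μ + ε) * (√(32 * π) * s / 2)) ≤
      π ^ (n + k₁ + k₂) * 32 * Cs * √(32 * π) / 2 * (q * s * (1 / μ + ε)) := by
    calc _ ≤ π ^ (n + k₁ + k₂) * q * (Cs * (32 / μ + 32 * ε) * (√(32 * π) * s / 2)) := by
          gcongr; linarith
      _ = _ := by ring
  have e : σ * (2 * (S + (I * V).re + H.re)) - π ^ (n + k₁ + k₂) * q * √(2 * π / μ) =
      2 * (σ * S - π ^ (n + k₁ + k₂) * q * (√(2 * π / μ) / 2)) + 2 * (σ * (I * V).re) +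
        2 * (σ * H.re) := by ring
  rw [e]
  refine (abs_add_three _ _ _).trans ?_
  rw [abs_mul 2, abs_mul 2, abs_mul 2, abs_mul σ (I * V).re, abs_mul σ H.re, hσ, abs_two, one_mul,
    one_mul]
  linarith

theorem theta_le_self {y : ℝ} (h0 : 0 < y) (h1 : y ≤ π / 2) : theta y ≤ y := by
  have hs : 0 < Real.sin y := Real.sin_pos_of_pos_of_lt_pi h0 (by linarith)
  have hc : 0 ≤ Real.cos y := Real.cos_nonneg_of_mem_Icc ⟨by linarith, h1⟩
  have hyc : y * Real.cos y ≤ Real.sin y := by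
    rcases h1.lt_or_eq with h | h
    · have hc' : 0 < Real.cos y := Real.cos_pos_of_mem_Ioo ⟨by linarith, h⟩
      have := (Real.lt_tan h0 h).le
      rwa [Real.tan_eq_sin_div_cos, le_div_iff₀ hc'] at this
    · rw [h, Real.cos_pi_div_two]; simp
  rw [theta, if_neg h0.ne', div_le_iff₀ (by positivity), Real.sin_two_mul]
  nlinarith [Real.sin_sq_add_cos_sq y, mul_le_mul_of_nonneg_right hyc hc]

theorem theta_pi_sub {ε : ℝ} (h0 : 0 < ε) (h1 : ε < π) :
    theta (π - ε) = Real.cos ε / Real.sin ε + (π - ε) / Real.sin ε ^ 2 := by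
  have hs : 0 < Real.sin ε := Real.sin_pos_of_pos_of_lt_pi h0 h1
  rw [theta, if_neg (by linarith), Real.sin_two_mul, Real.sin_pi_sub, Real.cos_pi_sub]
  field_simp
  ring

theorem pi_sub_le_of_theta_eq {y δ : ℝ} (hy : y ∈ Set.Ico 0 π) (h0 : 0 < δ) (h1 : δ ≤ 1 / 4)
    (h : theta y = 1 / (π * δ ^ 2)) : π - y ≤ 6 * δ := by
  have hpi := Real.pi_gt_three
  have hpi' := Real.pi_lt_d2
  have hδ2 : δ ^ 2 ≤ 1 / 16 := by nlinarith
  have hy0 : 0 < y := by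
    rcases hy.1.lt_or_eq with h' | h'
    · exact h'
    · rw [← h', theta, if_pos rfl] at h
      have : 0 < 1 / (π * δ ^ 2) := by positivity
      linarith
  have hy2 : π / 2 < y := by
    by_contra! hle
    have h2 := (theta_le_self hy0 hle).trans hle
    rw [h, div_le_iff₀ (by positivity)] at h2
    have : π / 2 * (π * δ ^ 2) ≤ 3.15 / 2 * (3.15 * (1 / 16)) := by gcongr
    linarith
  obtain ⟨ε, hε⟩ : ∃ ε, ε = π - y := ⟨_, rfl⟩
  have hε0 : 0 < ε := by linarith [hy.2]
  have hs := Real.mul_le_sin hε0.le (by linarith)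
  have hs0 : 0 < 2 / π * ε := by positivity
  have hsε : 0 < Real.sin ε := hs0.trans_le hs
  have hys : Real.sin y = Real.sin ε := by rw [hε, Real.sin_pi_sub]
  rw [← hε]
  refine le_of_sq_le_sq ?_ (by positivity)
  rw [theta, if_neg hy0.ne', hys, div_eq_div_iff (by positivity) (by positivity), one_mul] at h
  have h3 : 2 * y - Real.sin (2 * y) ≤ 7.3 := by linarith [Real.neg_one_le_sin (2 * y), hy.2]
  have h4 : 2 * (2 / π * ε) ^ 2 ≤ 7.3 * (π * δ ^ 2) := by
    calc _ ≤ 2 * Real.sin ε ^ 2 := by gcongr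
      _ = _ := h.symm
      _ ≤ _ := by gcongr
  have h5 : 2 * (2 / π * ε) ^ 2 = 8 * ε ^ 2 / π ^ 2 := by field_simp; norm_num
  rw [h5, div_le_iff₀ (by positivity)] at h4
  have h6 : 7.3 * (π * δ ^ 2) * π ^ 2 ≤ 7.3 * (3.15 * δ ^ 2) * 3.15 ^ 2 := by gcongr
  nlinarith [sq_nonneg δ]

theorem phase_re_eq {R t ε : ℝ} (h0 : 0 < ε) (h3 : ε < 3)
    (ht : t = R * (Real.cos ε / Real.sin ε + (π - ε) / Real.sin ε ^ 2)) :
    (phase R t ε).re = -(R * ((π - ε) / Real.sin ε) ^ 2) := by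
  have hs : 0 < Real.sin ε := Real.sin_pos_of_pos_of_lt_pi h0 (by linarith [Real.pi_gt_three])
  rw [phase_ofReal h0 h3, ofReal_re, ht]
  field_simp
  ring

theorem exists_abs_pow_div_sqrt_sub_one_le (k : ℕ) :
    ∃ C, 0 < C ∧ ∃ η, 0 < η ∧ η ≤ 1 / 2 ∧
      ∀ r : ℝ, |r - 1| ≤ η → |r ^ k / √r - 1| ≤ C * |r - 1| := by
  have hd : DifferentiableAt ℝ (fun r : ℝ => r ^ k / √r) 1 :=
    (differentiableAt_id.pow k).div (differentiableAt_id.sqrt one_ne_zero) (by simp)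
  obtain ⟨C, hC, hb⟩ := hd.isBigO_sub.exists_pos
  obtain ⟨η, hη, hb⟩ := Metric.eventually_nhds_iff.1 hb.bound
  refine ⟨C, hC, min (η / 2) (1 / 2), by positivity, min_le_right _ _, fun r hr => ?_⟩
  have := hb (y := r) (by
    rw [Real.dist_eq]; linarith [hr.trans (min_le_left _ _)])
  simpa using this

theorem prefactor_eq (n k₁ k₂ k : ℕ) {E ε δ κ r : ℝ} (hε : 0 < ε)
    (hκ : 0 < κ) (hr : 0 < r) (hδ : π * δ = r * ε) :
    2 / (4 * π) ^ (n + 1) * (π ^ (n + k₁ + k₂) * (E * (ε / ε ^ (k + 1))) * √(2 * π / (κ * r))) =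
      π ^ (k₁ + k₂) / (4 ^ n * (π * δ) ^ k * √(2 * π * κ)) * E * (r ^ k / √r) := by
  have hpi := Real.pi_pos
  rw [Real.sqrt_div' _ (by positivity), Real.sqrt_mul' _ hr.le, Real.sqrt_mul' _ hκ.le, hδ]
  have h2 : √(2 * π) ^ 2 = 2 * π := Real.sq_sqrt (by positivity)
  have h3 : 0 < √(2 * π) := by positivity
  generalize √(2 * π) = S at *
  rw [mul_pow, mul_pow, add_assoc n k₁ k₂, pow_add π n, pow_succ 4 n, pow_one, pow_succ ε k]
  field_simp
  rw [h2]
  ring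

theorem abs_sub_one_le_of_inv_sq {r b : ℝ} (hr : 0 < r) (hb : b ≤ 1 / 2)
    (h : |1 / r ^ 2 - 1| ≤ b) : |r - 1| ≤ 2 * b := by
  have h1 : 1 / r ^ 2 - 1 = (1 - r ^ 2) / r ^ 2 := by field_simp
  have h2 : r ^ 2 ≤ 2 := by
    have := (abs_le.1 h).1
    have h3 : 1 / 2 ≤ 1 / r ^ 2 := by linarith
    rwa [one_div_le_one_div (by norm_num) (by positivity)] at h3
  rw [h1, abs_div, abs_of_pos (by positivity : 0 < r ^ 2), div_le_iff₀ (by positivity)] at h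
  have hb0 : 0 ≤ b := by
    by_contra! hb'
    have := abs_nonneg (1 - r ^ 2)
    nlinarith [sq_nonneg r, mul_pos_of_neg_of_neg hb' (neg_lt_zero.2 (by positivity : 0 < r ^ 2))]
  have h4 : |1 - r ^ 2| = |r - 1| * (1 + r) := by
    rw [show 1 - r ^ 2 = -((r - 1) * (1 + r)) by ring, abs_neg, abs_mul,
      abs_of_pos (by linarith : 0 < 1 + r)]
  rw [h4] at h
  nlinarith [abs_nonneg (r - 1), mul_nonneg hb0 (sub_nonneg.2 h2), mul_nonneg (abs_nonneg (r - 1)) hr.le]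

theorem exists_real_part_bound {n : ℕ} (hn : 1 ≤ n) (k₁ k₂ : ℕ) :
    ∃ K, 0 < K ∧ ∃ δ₀, 0 < δ₀ ∧ ∃ κ₀, 0 < κ₀ ∧ ∀ R t y δ κ : ℝ, 0 < R → 0 < t →
      y ∈ Set.Ico 0 π → theta y = t / R → δ = √(R / (π * t)) → κ = 2 * √(π * t * R) →
      δ ≤ δ₀ → κ₀ ≤ κ → ∀ Q, Q = π ^ (k₁ + k₂) /
        (4 ^ n * (π * δ) ^ (n + k₁ - 1) * √(2 * π * κ)) * Real.exp (-(R * (y / Real.sin y) ^ 2)) →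
      |2 / (4 * π) ^ (n + 1) * ((-1) ^ (k₁ + k₂) *
          (2 * (∫ s : ℝ in Set.Ioi 0, integrand n k₁ k₂ R t s).re)) - Q| ≤
        K * Q * (1 / κ + δ) := by
  obtain ⟨C, hC, ε₀, hε₀, hε₀1, hJ⟩ := exists_re_integral_bound hn k₁ k₂
  obtain ⟨k, hk⟩ : ∃ k, n + k₁ = k + 1 := ⟨n + k₁ - 1, by omega⟩
  obtain ⟨D, hD, η, hη, hη1, hρ⟩ := exists_abs_pow_div_sqrt_sub_one_le k
  obtain ⟨B, hB, hreg⟩ := exists_norm_deriv_regPart_le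
  refine ⟨6 * C * (1 + D) + 12 * D * B, by positivity,
    min (1 / 4) (min (ε₀ / 6) (η / (12 * B))), by positivity, 2, by norm_num, ?_⟩
  intro R t y δ κ hR ht hy hθ hδ hκ hδ' hκ' Q hQ
  have hpi := Real.pi_gt_three
  have hδ0 : 0 < δ := by rw [hδ]; positivity
  have hκ0 : 0 < κ := by linarith
  have hδsq : δ ^ 2 = R / (π * t) := by rw [hδ, Real.sq_sqrt (by positivity)]
  have hκδ : κ * δ = 2 * R := by
    rw [hκ, hδ, mul_assoc, ← Real.sqrt_mul (by positivity),
      show π * t * R * (R / (π * t)) = R ^ 2 by field_simp, Real.sqrt_sq hR.le]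
  obtain ⟨ε, hε⟩ : ∃ ε, ε = π - y := ⟨_, rfl⟩
  have hε0 : 0 < ε := by linarith [hy.2]
  have hεδ : ε ≤ 6 * δ := by
    rw [hε]
    refine pi_sub_le_of_theta_eq hy hδ0 (hδ'.trans (min_le_left _ _)) ?_
    rw [hθ, hδsq]
    field_simp
  have hε' : ε ≤ ε₀ := by
    have := hδ'.trans ((min_le_right _ _).trans (min_le_left _ _))
    linarith
  have hε1 : ε ≤ 1 := hε'.trans hε₀1
  have hεη : 2 * (B * ε) ≤ η := by
    have := hδ'.trans ((min_le_right _ _).trans (min_le_right _ _))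
    rw [le_div_iff₀ (by positivity)] at this
    calc 2 * (B * ε) ≤ 2 * (B * (6 * δ)) := by gcongr
      _ ≤ η := by linarith
  have hsin : 0 < Real.sin ε := Real.sin_pos_of_pos_of_lt_pi hε0 (by linarith)
  have hy' : y = π - ε := by linarith
  have htR : t = R * (Real.cos ε / Real.sin ε + (π - ε) / Real.sin ε ^ 2) := by
    rw [hy', theta_pi_sub hε0 (by linarith)] at hθ
    rw [hθ]
    field_simp
  obtain ⟨h', hh'⟩ : ∃ h', h' = π / ε ^ 2 -
      (Real.cos ε / Real.sin ε + (π - ε) / Real.sin ε ^ 2) := ⟨_, rfl⟩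
  have hderiv : deriv regPart (ε : ℂ) = (h' : ℂ) := by
    rw [deriv_regPart hε0 (by linarith), hh']
  have htR' : t = R * (π / ε ^ 2 - h') := by rw [htR, hh']; ring
  have htc : (t : ℂ) = R * (π / ε ^ 2 - deriv regPart ε) := by
    rw [hderiv, htR']; push_cast; rfl
  obtain ⟨r, hr⟩ : ∃ r, r = π * δ / ε := ⟨_, rfl⟩
  have hr0 : 0 < r := by rw [hr]; positivity
  have hrε : π * δ = r * ε := by rw [hr]; field_simp
  have hμ : κ * r = 2 * π * R / ε := by
    rw [hr, mul_div_assoc', mul_left_comm, hκδ]; ring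
  have hr1 : |r - 1| ≤ 2 * (B * ε) := by
    refine abs_sub_one_le_of_inv_sq hr0 (by linarith) ?_
    have e : 1 / r ^ 2 - 1 = -(ε * (ε * h') / π) := by
      rw [hr, div_pow, mul_pow, hδsq, htR']
      field_simp
      ring
    have hn' : |h'| ≤ B := by
      have := hreg ε hε0 hε1
      rwa [hderiv, norm_real, Real.norm_eq_abs] at this
    rw [e, abs_neg, abs_div, abs_mul, abs_mul, abs_of_pos hε0, abs_of_pos Real.pi_pos]
    calc _ ≤ ε * (1 * B) / 1 := by gcongr; linarith
      _ = B * ε := by ring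
  have hρr := hρ r (hr1.trans hεη)
  have hr2 := abs_le.1 (hr1.trans (hεη.trans hη1))
  have hr3 : |r - 1| ≤ 1 := by linarith
  have hμκ : κ / 2 ≤ κ * r := by nlinarith
  have hmain := hJ R t ε hR ht.le hε0 hε' htc (κ * r) hμ (by linarith)
  have hphase : (phase R t ε).re = -(R * (y / Real.sin y) ^ 2) := by
    rw [phase_re_eq hε0 (by linarith) htR, hy', Real.sin_pi_sub]
  rw [hphase, hk] at hmain
  have hE := Real.exp_pos (-(R * (y / Real.sin y) ^ 2))
  generalize Real.exp (-(R * (y / Real.sin y) ^ 2)) = E at *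
  have hpre := prefactor_eq n k₁ k₂ k (E := E) hε0 hκ0 hr0 hrε
  rw [hk, Nat.add_sub_cancel] at hQ
  rw [← hQ, hk] at hpre
  have hQ0 : 0 < Q := by rw [hQ]; positivity
  have hμ0 : 0 < κ * r := by positivity
  have hμinv : 1 / (κ * r) ≤ 2 / κ := by
    rw [div_le_div_iff₀ hμ0 hκ0]; linarith
  generalize κ * r = μ at *
  have hρ2 : |r ^ k / √r - 1| ≤ D * (2 * (B * ε)) := hρr.trans (by gcongr)
  have hρ1 : r ^ k / √r ≤ 1 + D := by
    have h1 := (abs_le.1 (hρr.trans (mul_le_of_le_one_right hD.le hr3))).2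
    linarith
  generalize r ^ k / √r = ρ at *
  have hsqrt : 1 / √μ ≤ π ^ (k + 1 + k₂) * √(2 * π / μ) := by
    rw [Real.sqrt_div' _ hμ0.le, mul_div_assoc']
    gcongr
    exact one_le_mul_of_one_le_of_one_le (one_le_pow₀ (by linarith))
      (Real.one_le_sqrt.2 (by linarith))
  have hscale : 2 / (4 * π) ^ (n + 1) * (E * (ε / ε ^ (k + 1)) * (1 / √μ)) ≤
      Q * (1 + D) := by
    refine le_trans ?_ (mul_le_mul_of_nonneg_left hρ1 hQ0.le)
    rw [← hpre]
    calc _ ≤ 2 / (4 * π) ^ (n + 1) * (E * (ε / ε ^ (k + 1)) *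
          (π ^ (k + 1 + k₂) * √(2 * π / μ))) := by gcongr
      _ = _ := by ring
  have hsmall : 1 / μ + ε ≤ 6 * (1 / κ + δ) := by
    have : 2 / κ ≤ 6 * (1 / κ) := by rw [mul_one_div]; gcongr; norm_num
    linarith
  generalize (∫ s : ℝ in Set.Ioi 0, integrand n k₁ k₂ R t s).re = J at *
  have h1 : 0 < 2 / (4 * π) ^ (n + 1) := by positivity
  have h2 : |2 / (4 * π) ^ (n + 1) * ((-1) ^ (k₁ + k₂) * (2 * J)) - Q * ρ| ≤
      C * (Q * (1 + D) * (6 * (1 / κ + δ))) := by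
    rw [← hpre, ← mul_sub, abs_mul, abs_of_pos h1]
    refine (mul_le_mul_of_nonneg_left hmain h1.le).trans ?_
    calc _ = C * (2 / (4 * π) ^ (n + 1) * (E * (ε / ε ^ (k + 1)) * (1 / √μ)) * (1 / μ + ε)) := by
          ring
      _ ≤ _ := by gcongr C * ?_; exact mul_le_mul hscale hsmall (by positivity) (by positivity)
  have h3 : |Q * ρ - Q| ≤ Q * (D * (2 * (B * (6 * (1 / κ + δ))))) := by
    rw [show Q * ρ - Q = Q * (ρ - 1) by ring, abs_mul, abs_of_pos hQ0]
    have : ε ≤ 6 * (1 / κ + δ) := by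
      have : 0 < 1 / κ := by positivity
      linarith
    exact (mul_le_mul_of_nonneg_left hρ2 hQ0.le).trans (by gcongr)
  calc _ ≤ _ := (abs_sub_le _ (Q * ρ) _).trans (add_le_add h2 h3)
    _ = _ := by ring

end HeisenbergHeat

/-- Case II asymptotics on the Heisenberg group: for δ → 0⁺ and κ → +∞,
p_{1,k₁,k₂}(x,t) = ((−1)^{k₂}π^{k₁+k₂}/(4ⁿ(πδ)^{n+k₁−1}√(2πκ))) e^{−d²/4} [1 + O(1/κ + δ)]. -/
theorem heisenberg_caseII (n k₁ k₂ : ℕ) (hn : 1 ≤ n) :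
    ∃ K : ℝ, 0 < K ∧ ∃ δ₀ : ℝ, 0 < δ₀ ∧ ∃ κ₀ : ℝ, 0 < κ₀ ∧
      ∀ (x : EuclideanSpace ℝ (Fin (2 * n))) (t : ℝ) (yω δ κ d P : ℝ),
        x ≠ 0 → t ≠ 0 →
        yω ∈ Set.Ico 0 π → theta yω = 4 * |t| / ‖x‖ ^ 2 →
        δ = Real.sqrt ((‖x‖ ^ 2 / 4) / (π * |t|)) →
        κ = 2 * Real.sqrt (π * |t| * (‖x‖ ^ 2 / 4)) →
        d = ‖x‖ * yω / Real.sin yω →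
        P = ((-1 : ℝ) ^ k₂ * π ^ (k₁ + k₂) /
              (4 ^ n * (π * δ) ^ (n + k₁ - 1) * Real.sqrt (2 * π * κ))) *
            Real.exp (-d ^ 2 / 4) →
        δ ≤ δ₀ → κ₀ ≤ κ →
        ‖pH n k₁ k₂ x t - (P : ℂ)‖ ≤ K * |P| * (1 / κ + δ) := by
  obtain ⟨K, hK, δ₀, hδ₀, κ₀, hκ₀, h⟩ := HeisenbergHeat.exists_real_part_bound hn k₁ k₂
  refine ⟨K, hK, δ₀, hδ₀, κ₀, hκ₀, fun x t y δ κ d P hx ht hy hθ hδ hκ hd hP hδ' hκ' => ?_⟩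
  have hR : 0 < ‖x‖ ^ 2 / 4 := by positivity
  have hT : 0 < |t| := by positivity
  have hb := h (‖x‖ ^ 2 / 4) |t| y δ κ hR hT hy (by rw [hθ]; field_simp) hδ hκ hδ' hκ' _ rfl
  have hd' : -d ^ 2 / 4 = -(‖x‖ ^ 2 / 4 * (y / Real.sin y) ^ 2) := by rw [hd]; ring
  have hδ0 : 0 < δ := by rw [hδ]; positivity
  have hκ0 : 0 < κ := hκ₀.trans_le hκ'
  rw [hd', mul_div_assoc, mul_assoc] at hP
  rw [HeisenbergHeat.pH_eq hn, ← ofReal_sub, norm_real, Real.norm_eq_abs]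
  set Q := π ^ (k₁ + k₂) / (4 ^ n * (π * δ) ^ (n + k₁ - 1) * √(2 * π * κ)) *
    Real.exp (-(‖x‖ ^ 2 / 4 * (y / Real.sin y) ^ 2)) with hQ
  have hQ0 : 0 < Q := by positivity
  have hsq : ((-1 : ℝ) ^ k₂) * (-1) ^ k₂ = 1 := by rw [← mul_pow]; simp
  have habs : |((-1 : ℝ) ^ k₂)| = 1 := by rw [abs_pow, abs_neg, abs_one, one_pow]
  generalize (∫ s : ℝ in Set.Ioi 0, HeisenbergHeat.integrand n k₁ k₂ (‖x‖ ^ 2 / 4) |t| s).re = J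
    at hb ⊢
  have e : 2 * (-1) ^ k₁ / (4 * π) ^ (n + 1) * (2 * J) - P =
      (-1) ^ k₂ * (2 / (4 * π) ^ (n + 1) * ((-1) ^ (k₁ + k₂) * (2 * J)) - Q) := by
    rw [hP, pow_add]
    linear_combination (-(2 * (-1) ^ k₁ / (4 * π) ^ (n + 1) * (2 * J))) * hsq
  rw [e, hP, abs_mul, abs_mul, habs, one_mul, one_mul, abs_of_pos hQ0]
  exact hb
end
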